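/- Let λ/μ be a skew shape with λ, μ partitions with at most n parts. Then the refined dual stable Grothendieck polynomial satisfies g̃_{λ/μ}(x; t) = Σ_{S ∈ 𝕊(λ/μ)} (−1)^{|ex(S)|} wt_{λ/μ}(S) · g_{sh(S)}(x), where 𝕊(λ/μ) is the (finite) set of semi-standard set-valued tableaux of partition shape whose reading word is Knuth equivalent to an element of 𝕋(λ/μ), wt_{λ/μ}(S) = t^{ceq(rect(w(S)))}, and g_ν denotes the dual stable Grothendieck polynomial. -/

import Mathlib

open Classical

attribute [local instance 2000] Classical.propDecidable

noncomputable section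

namespace SkewG

abbrev Cell : Type := ℕ × ℕ

def IsPartitionShape (s : Finset Cell) : Prop :=
  ∀ i j i' j', (i, j) ∈ s → i' ≤ i → j' ≤ j → (i', j') ∈ s

def AtMostRows (s : Finset Cell) (n : ℕ) : Prop := ∀ c ∈ s, c.1 < n

def Adj (c d : Cell) : Prop :=
  (c.1 = d.1 ∧ (c.2 = d.2 + 1 ∨ d.2 = c.2 + 1)) ∨
  (c.2 = d.2 ∧ (c.1 = d.1 + 1 ∨ d.1 = c.1 + 1))

def ConnectedShape (s : Finset Cell) : Prop :=
  ∀ c ∈ s, ∀ d ∈ s,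
    Relation.ReflTransGen (fun a b => a ∈ s ∧ b ∈ s ∧ Adj a b) c d

def IsSkewShape (s : Finset Cell) : Prop :=
  ∃ lam mu : Finset Cell, IsPartitionShape lam ∧ IsPartitionShape mu ∧
    mu ⊆ lam ∧ s = lam \ mu

def IsSVTOn (n : ℕ) (s : Finset Cell) (T : Cell → Finset ℕ) : Prop :=
  (∀ c ∈ s, (T c).Nonempty) ∧
  (∀ c, c ∉ s → T c = ∅) ∧
  (∀ c, ∀ x ∈ T c, 1 ≤ x ∧ x ≤ n) ∧
  (∀ i j, (i, j) ∈ s → (i, j + 1) ∈ s →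
    ∀ x ∈ T (i, j), ∀ y ∈ T (i, j + 1), x ≤ y) ∧
  (∀ i j, (i, j) ∈ s → (i + 1, j) ∈ s →
    ∀ x ∈ T (i, j), ∀ y ∈ T (i + 1, j), x < y)

def IsSSYTOn (s : Finset Cell) (T : Cell → ℕ) : Prop :=
  (∀ c ∈ s, 1 ≤ T c) ∧
  (∀ c, c ∉ s → T c = 0) ∧
  (∀ i j, (i, j) ∈ s → (i, j + 1) ∈ s → T (i, j) ≤ T (i, j + 1)) ∧
  (∀ i j, (i, j) ∈ s → (i + 1, j) ∈ s → T (i, j) < T (i + 1, j))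

def IsRevRowStrictOn (s : Finset Cell) (T : Cell → ℕ) : Prop :=
  (∀ c ∈ s, 1 ≤ T c) ∧
  (∀ c, c ∉ s → T c = 0) ∧
  (∀ i j, (i, j) ∈ s → (i, j + 1) ∈ s → T (i, j + 1) < T (i, j)) ∧
  (∀ i j, (i, j) ∈ s → (i + 1, j) ∈ s → T (i + 1, j) ≤ T (i, j))

def IsRowBounded (s : Finset Cell) (T : Cell → ℕ) : Prop :=
  ∀ c ∈ s, T c ≤ c.1

def IsRowWeaklyBounded (s : Finset Cell) (T : Cell → ℕ) : Prop :=
  ∀ c ∈ s, T c ≤ c.1 + 1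

def wtOn (s : Finset Cell) (T : Cell → Finset ℕ) (v : ℕ) : ℕ :=
  ∑ c ∈ s, if v ∈ T c then 1 else 0

def wtS (s : Finset Cell) (T : Cell → ℕ) (v : ℕ) : ℕ :=
  ∑ c ∈ s, if T c = v then 1 else 0

def exRow (s : Finset Cell) (T : Cell → Finset ℕ) (i : ℕ) : ℕ :=
  (∑ c ∈ s.filter (fun c => c.1 = i), (T c).card) - (s.filter (fun c => c.1 = i)).card

def exTotal (s : Finset Cell) (T : Cell → Finset ℕ) : ℕ :=
  (∑ c ∈ s, (T c).card) - s.card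

def IsFlag (n : ℕ) (Φ : ℕ → ℕ) : Prop :=
  (∀ i j, i ≤ j → j < n → Φ i ≤ Φ j) ∧ (∀ i, i < n → 1 ≤ Φ i) ∧ Φ (n - 1) = n

def RespectsFlag (Φ : ℕ → ℕ) (T : Cell → Finset ℕ) : Prop :=
  ∀ i j, ∀ x ∈ T (i, j), x ≤ Φ i

def RespectsFlagS (s : Finset Cell) (Φ : ℕ → ℕ) (T : Cell → ℕ) : Prop :=
  ∀ c ∈ s, T c ≤ Φ c.1

def svtOf (T : Cell → ℕ) : Cell → Finset ℕ := fun c => if T c = 0 then ∅ else {T c}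

def colHas (T : Cell → Finset ℕ) (v j : ℕ) : Prop := ∃ i, v ∈ T (i, j)

def IsPlusCol (T : Cell → Finset ℕ) (v j : ℕ) : Prop := colHas T v j ∧ ¬ colHas T (v + 1) j

def IsMinusCol (T : Cell → Finset ℕ) (v j : ℕ) : Prop := colHas T (v + 1) j ∧ ¬ colHas T v j

def plusCount (T : Cell → Finset ℕ) (v a b : ℕ) : ℕ :=
  ((Finset.Ico a b).filter (fun j => IsPlusCol T v j)).card

def minusCount (T : Cell → Finset ℕ) (v a b : ℕ) : ℕ :=
  ((Finset.Ico a b).filter (fun j => IsMinusCol T v j)).card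

def UnmatchedPlus (T : Cell → Finset ℕ) (v j : ℕ) : Prop :=
  IsPlusCol T v j ∧ minusCount T v 0 j < plusCount T v 0 (j + 1)

def UnmatchedMinus (T : Cell → Finset ℕ) (v j : ℕ) : Prop :=
  IsMinusCol T v j ∧ ∀ b, plusCount T v (j + 1) b ≤ minusCount T v (j + 1) b

def fFill (v : ℕ) (T : Cell → Finset ℕ) : Option (Cell → Finset ℕ) :=
  if h : ∃ j, UnmatchedPlus T v j then
    letI j := sSup {j | UnmatchedPlus T v j}
    if hr : ∃ i, v ∈ T (i, j) then
      letI r := Classical.choose hr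
      if v ∈ T (r, j + 1) then
        some (fun c =>
          if c = (r, j + 1) then (T c).erase v
          else if c = (r, j) then insert (v + 1) (T c)
          else T c)
      else
        some (fun c => if c = (r, j) then insert (v + 1) ((T c).erase v) else T c)
    else none
  else none

def eFill (v : ℕ) (T : Cell → Finset ℕ) : Option (Cell → Finset ℕ) :=
  if h : ∃ j, UnmatchedMinus T v j then
    letI j := sInf {j | UnmatchedMinus T v j}
    if hr : ∃ i, (v + 1) ∈ T (i, j) then
      letI r := Classical.choose hr
      if 1 ≤ j ∧ (v + 1) ∈ T (r, j - 1) then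
        some (fun c =>
          if c = (r, j - 1) then (T c).erase (v + 1)
          else if c = (r, j) then insert v (T c)
          else T c)
      else
        some (fun c => if c = (r, j) then insert v ((T c).erase (v + 1)) else T c)
    else none
  else none

def fIter (v : ℕ) : ℕ → (Cell → Finset ℕ) → Option (Cell → Finset ℕ)
  | 0, T => some T
  | k + 1, T => (fIter v k T).bind (fFill v)

def eIter (v : ℕ) : ℕ → (Cell → Finset ℕ) → Option (Cell → Finset ℕ)
  | 0, T => some T
  | k + 1, T => (eIter v k T).bind (eFill v)

def phiOp (v : ℕ) (T : Cell → Finset ℕ) : ℕ := sSup {k | (fIter v k T).isSome}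

def epsOp (v : ℕ) (T : Cell → Finset ℕ) : ℕ := sSup {k | (eIter v k T).isSome}

def HighestWeight (n : ℕ) (T : Cell → Finset ℕ) : Prop :=
  ∀ v, 1 ≤ v → v + 1 ≤ n → eFill v T = none

def CrystRel (n : ℕ) (T U : Cell → Finset ℕ) : Prop :=
  ∃ v, 1 ≤ v ∧ v + 1 ≤ n ∧ (fFill v T = some U ∨ fFill v U = some T)

def ComponentOf (n : ℕ) (X : Set (Cell → Finset ℕ)) (S' : Cell → Finset ℕ) :
    Set (Cell → Finset ℕ) :=
  {T | T ∈ X ∧ Relation.ReflTransGen (fun a b => a ∈ X ∧ b ∈ X ∧ CrystRel n a b) S' T}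

def rowList (s : Finset Cell) (i : ℕ) : List ℕ :=
  (List.range (s.sup Prod.snd + 1)).filter (fun j => decide ((i, j) ∈ s))

def rowLenOf (s : Finset Cell) (i : ℕ) : ℕ := (rowList s i).length

def rowWordOn (s : Finset Cell) (T : Cell → ℕ) (i : ℕ) : List ℕ :=
  (rowList s i).map (fun j => T (i, j))

def readingWordOn (s : Finset Cell) (T : Cell → ℕ) : List ℕ :=
  ((List.range (s.sup Prod.fst + 1)).reverse.map (rowWordOn s T)).flatten

def bwordOn (s : Finset Cell) : List ℕ :=
  ((List.range (s.sup Prod.fst + 1)).reverse.map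
    (fun i => List.replicate (rowList s i).length (i + 1))).flatten

def bwordComp (n : ℕ) (α : ℕ → ℕ) : List ℕ :=
  ((List.range n).reverse.map (fun i => List.replicate (α i) (i + 1))).flatten

inductive KnuthStep : List ℕ → List ℕ → Prop
  | kxzy (u w : List ℕ) (x y z : ℕ) (h1 : x ≤ y) (h2 : y < z) :
      KnuthStep (u ++ x :: z :: y :: w) (u ++ z :: x :: y :: w)
  | kyxz (u w : List ℕ) (x y z : ℕ) (h1 : x < y) (h2 : y ≤ z) :
      KnuthStep (u ++ y :: x :: z :: w) (u ++ y :: z :: x :: w)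

def KnuthEquiv : List ℕ → List ℕ → Prop := Relation.EqvGen KnuthStep

def IsYamanouchi (w : List ℕ) : Prop :=
  ∀ k v, (w.drop k).count (v + 2) ≤ (w.drop k).count (v + 1)

def IsBiword (top bot : List ℕ) : Prop :=
  top.length = bot.length ∧
  (∀ x ∈ top, 1 ≤ x) ∧ (∀ x ∈ bot, 1 ≤ x) ∧
  ∀ p, p + 1 < top.length →
    top.getD (p + 1) 0 ≤ top.getD p 0 ∧
    (bot.getD (p + 1) 0 < bot.getD p 0 → top.getD (p + 1) 0 < top.getD p 0)

def dsort (n : ℕ) (α : ℕ → ℕ) (i : ℕ) : ℕ :=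
  sSup {m | i < ((Finset.range n).filter (fun k => m ≤ α k)).card}

def diagOf (n : ℕ) (f : ℕ → ℕ) : Finset Cell :=
  (Finset.product (Finset.range n) (Finset.range (f 0))).filter (fun c => c.2 < f c.1)

def permOfWord (is : List ℕ) : Equiv.Perm ℕ :=
  (is.map (fun i => Equiv.swap i (i + 1))).prod

def IsReducedWord (τ : Equiv.Perm ℕ) (is : List ℕ) : Prop :=
  permOfWord is = τ ∧ ∀ js : List ℕ, permOfWord js = τ → is.length ≤ js.length

def permuteComp (τ : Equiv.Perm ℕ) (f : ℕ → ℕ) : ℕ → ℕ := fun i => f (τ.symm i)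

def highestTabOf (sh : Finset Cell) : Cell → ℕ := fun c => if c ∈ sh then c.1 + 1 else 0

def applyF : List ℕ → List ℕ → (Cell → Finset ℕ) → Option (Cell → Finset ℕ)
  | [], _, T => some T
  | _ :: _, [], T => some T
  | i :: is, k :: ks, T => (applyF is ks T).bind (fIter i k)

def DemazureSet (sh : Finset Cell) (word : List ℕ) : Set (Cell → Finset ℕ) :=
  {T | ∃ ks : List ℕ, ks.length = word.length ∧
        applyF word ks (svtOf (highestTabOf sh)) = some T}

def demMono (n : ℕ) (i : ℕ) (h : i + 1 < n) (a : Fin n →₀ ℕ) : MvPolynomial (Fin n) ℤ :=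
  letI i0 : Fin n := ⟨i, Nat.lt_of_succ_lt h⟩
  letI i1 : Fin n := ⟨i + 1, h⟩
  letI p := a i0
  letI q := a i1
  if q ≤ p then
    ∑ m ∈ Finset.Icc q p,
      MvPolynomial.monomial ((a.update i0 m).update i1 (p + q - m)) (1 : ℤ)
  else
    - ∑ m ∈ Finset.Ico (p + 1) q,
      MvPolynomial.monomial ((a.update i0 m).update i1 (p + q - m)) (1 : ℤ)

def demOp (n : ℕ) (i : ℕ) (f : MvPolynomial (Fin n) ℤ) : MvPolynomial (Fin n) ℤ :=
  if h : i + 1 < n then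
    ∑ a ∈ f.support, MvPolynomial.C (MvPolynomial.coeff a f) * demMono n i h a
  else f

def demWord (n : ℕ) : List ℕ → MvPolynomial (Fin n) ℤ → MvPolynomial (Fin n) ℤ
  | [], f => f
  | i :: is, f => demOp n i (demWord n is f)

def xMono (n : ℕ) (α : ℕ → ℕ) : MvPolynomial (Fin n) ℤ :=
  ∏ i : Fin n, MvPolynomial.X i ^ α (i : ℕ)

def keyPoly (n : ℕ) (α : ℕ → ℕ) : MvPolynomial (Fin n) ℤ :=
  if h : ∃ is : List ℕ, IsReducedWord (permOfWord is) is ∧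
      (∀ i, i < n → permuteComp (permOfWord is) (dsort n α) i = α i)
  then demWord n h.choose (xMono n (dsort n α))
  else 0

abbrev XPoly (n : ℕ) := MvPolynomial (Fin n) ℤ
abbrev XTPoly (n : ℕ) := MvPolynomial (Fin n) (MvPolynomial (Fin n) ℤ)

def liftX (n : ℕ) (f : XPoly n) : XTPoly n :=
  MvPolynomial.map (MvPolynomial.C : ℤ →+* MvPolynomial (Fin n) ℤ) f

def tMono (n : ℕ) (α : ℕ → ℕ) : XTPoly n :=
  MvPolynomial.C (∏ i : Fin n, MvPolynomial.X i ^ α (i : ℕ))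

def xWt (n : ℕ) (s : Finset Cell) (T : Cell → Finset ℕ) : XTPoly n :=
  ∏ i : Fin n, MvPolynomial.X i ^ wtOn s T ((i : ℕ) + 1)

def extendf (n : ℕ) (α : Fin n → ℕ) : ℕ → ℕ :=
  fun r => if h : r < n then α ⟨r, h⟩ else 0

def Gflagged (n : ℕ) (s : Finset Cell) (Φ : ℕ → ℕ) : XTPoly n :=
  ∑ᶠ T : {T : Cell → Finset ℕ // IsSVTOn n s T ∧ RespectsFlag Φ T},
    ((-1 : XTPoly n) ^ exTotal s T.1) * tMono n (exRow s T.1) * xWt n s T.1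

def sFlagged (n : ℕ) (s : Finset Cell) (Φ : ℕ → ℕ) : XPoly n :=
  ∑ᶠ U : {U : Cell → ℕ // IsSSYTOn s U ∧ (∀ c ∈ s, U c ≤ n) ∧ RespectsFlagS s Φ U},
    ∏ i : Fin n, MvPolynomial.X i ^ wtS s U.1 ((i : ℕ) + 1)

def schurOf (n : ℕ) (sh : Finset Cell) : XPoly n :=
  ∑ᶠ U : {U : Cell → ℕ // IsSSYTOn sh U ∧ ∀ c ∈ sh, U c ≤ n},
    ∏ i : Fin n, MvPolynomial.X i ^ wtS sh U.1 ((i : ℕ) + 1)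

def RGone (n : ℕ) (sh : Finset Cell) : XPoly n :=
  ∑ᶠ T : {T : Cell → Finset ℕ // IsSVTOn n sh T},
    ((-1 : XPoly n) ^ exTotal sh T.1) *
      ∏ i : Fin n, MvPolynomial.X i ^ wtOn sh T.1 ((i : ℕ) + 1)

def IsRPPOn (s : Finset Cell) (R : Cell → ℕ) : Prop :=
  (∀ c ∈ s, 1 ≤ R c) ∧ (∀ c, c ∉ s → R c = 0) ∧
  (∀ i j, (i, j) ∈ s → (i, j + 1) ∈ s → R (i, j) ≤ R (i, j + 1)) ∧
  (∀ i j, (i, j) ∈ s → (i + 1, j) ∈ s → R (i, j) ≤ R (i + 1, j))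

def wtRPP (s : Finset Cell) (R : Cell → ℕ) (v : ℕ) : ℕ :=
  ((Finset.range (s.sup Prod.snd + 1)).filter
    (fun j => ∃ i, (i, j) ∈ s ∧ R (i, j) = v)).card

def ceqOn (s : Finset Cell) (R : Cell → ℕ) (i : ℕ) : ℕ :=
  (s.filter (fun c => c.1 = i ∧ (c.1 + 1, c.2) ∈ s ∧ R c = R (c.1 + 1, c.2))).card

def gDual (n : ℕ) (sh : Finset Cell) : XPoly n :=
  ∑ᶠ R : {R : Cell → ℕ // IsRPPOn sh R ∧ ∀ c ∈ sh, R c ≤ n},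
    ∏ i : Fin n, MvPolynomial.X i ^ wtRPP sh R.1 ((i : ℕ) + 1)

def gFlagged (n : ℕ) (s : Finset Cell) (Φ : ℕ → ℕ) : XTPoly n :=
  ∑ᶠ R : {R : Cell → ℕ // IsRPPOn s R ∧ RespectsFlagS s Φ R},
    tMono n (ceqOn s R.1) * ∏ i : Fin n, MvPolynomial.X i ^ wtRPP s R.1 ((i : ℕ) + 1)

def rppCircled (s : Finset Cell) (R : Cell → ℕ) (c : Cell) : Prop :=
  c ∈ s ∧ (c.1 = 0 ∨ (c.1 - 1, c.2) ∉ s ∨ R (c.1 - 1, c.2) ≠ R c)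

def rppReadingWord (s : Finset Cell) (R : Cell → ℕ) : List ℕ :=
  ((List.range (s.sup Prod.fst + 1)).reverse.map (fun i =>
    ((rowList s i).filter (fun j => decide (rppCircled s R (i, j)))).map
      (fun j => R (i, j)))).flatten

def rppRowWord (s : Finset Cell) (R : Cell → ℕ) : List ℕ :=
  ((List.range (s.sup Prod.fst + 1)).reverse.map (fun i =>
    ((rowList s i).filter (fun j => decide ((i + 1, j) ∉ s ∨ R (i + 1, j) ≠ R (i, j)))).map
      (fun j => R (i, j)))).flatten

def rppHeights (s : Finset Cell) (R : Cell → ℕ) : List ℕ :=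
  ((List.range (s.sup Prod.fst + 1)).reverse.map (fun i =>
    ((rowList s i).filter (fun j => decide ((i + 1, j) ∉ s ∨ R (i + 1, j) ≠ R (i, j)))).map
      (fun _ => i + 1))).flatten

def boxMin (A : Finset ℕ) : ℕ := sInf (A : Set ℕ)

def boxExtras (A : Finset ℕ) : List ℕ :=
  ((List.range (A.sup id + 1)).filter (fun x => decide (x ∈ A ∧ x ≠ boxMin A))).reverse

def svtReadingWord (s : Finset Cell) (T : Cell → Finset ℕ) : List ℕ :=
  ((List.range (s.sup Prod.fst + 1)).reverse.map (fun i =>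
    (((rowList s i).reverse.map (fun j => boxExtras (T (i, j)))).flatten) ++
      ((rowList s i).map (fun j => boxMin (T (i, j)))))).flatten

def minRowOf (s : Finset Cell) : ℕ := sInf (Prod.fst '' (s : Set Cell))
def minColOf (s : Finset Cell) : ℕ := sInf (Prod.snd '' (s : Set Cell))

def rowSpan (s : Finset Cell) : ℕ := if s = ∅ then 0 else s.sup Prod.fst + 1 - minRowOf s
def colSpan (s : Finset Cell) : ℕ := if s = ∅ then 0 else s.sup Prod.snd + 1 - minColOf s

def rowOffset (shapes : List (Finset Cell)) (i : ℕ) : ℕ := ((shapes.take i).map rowSpan).sum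
def colOffset (shapes : List (Finset Cell)) (i : ℕ) : ℕ :=
  ((shapes.drop (i + 1)).map colSpan).sum

def embedCell (shapes : List (Finset Cell)) (i : ℕ) (c : Cell) : Cell :=
  (rowOffset shapes i + (c.1 - minRowOf (shapes.getD i ∅)),
   colOffset shapes i + (c.2 - minColOf (shapes.getD i ∅)))

def unembedCell (shapes : List (Finset Cell)) (i : ℕ) (c : Cell) : Cell :=
  (c.1 - rowOffset shapes i + minRowOf (shapes.getD i ∅),
   c.2 - colOffset shapes i + minColOf (shapes.getD i ∅))

def compositeShape (shapes : List (Finset Cell)) : Finset Cell :=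
  (Finset.range shapes.length).biUnion (fun i => (shapes.getD i ∅).image (embedCell shapes i))

def compositeTab (shapes : List (Finset Cell)) (Ts : List (Cell → ℕ)) : Cell → ℕ :=
  fun c => ∑ i ∈ Finset.range shapes.length,
    if unembedCell shapes i c ∈ shapes.getD i ∅ ∧
        embedCell shapes i (unembedCell shapes i c) = c
    then Ts.getD i (fun _ => 0) (unembedCell shapes i c) else 0

def compositeFlag (shapes : List (Finset Cell)) (flags : List (ℕ → ℕ)) : ℕ → ℕ :=
  fun r => ∑ i ∈ Finset.range shapes.length,
    if rowOffset shapes i ≤ r ∧ r < rowOffset shapes i + rowSpan (shapes.getD i ∅)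
    then flags.getD i (fun _ => 0) (r - rowOffset shapes i) else 0

def IsComponents (s : Finset Cell) (comps : List (Finset Cell)) : Prop :=
  (∀ c, c ∈ s ↔ ∃ i < comps.length, c ∈ comps.getD i ∅) ∧
  (∀ i, i < comps.length → (comps.getD i ∅).Nonempty) ∧
  (∀ i, i < comps.length → ConnectedShape (comps.getD i ∅)) ∧
  (∀ i j, i < j → j < comps.length →
    ∀ c ∈ comps.getD i ∅, ∀ d ∈ comps.getD j ∅, c.1 < d.1) ∧
  (∀ i j, i < comps.length → j < comps.length → i ≠ j →
    ∀ c ∈ comps.getD i ∅, ∀ d ∈ comps.getD j ∅, ¬ Adj c d)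

def restrict (u : Finset Cell) (T : Cell → Finset ℕ) : Cell → Finset ℕ :=
  fun c => if c ∈ u then T c else ∅

structure BurgeOut where
  sh : Finset Cell
  P : Cell → ℕ
  Q : Cell → ℕ

structure BurgeData where
  out : List ℕ → List ℕ → BurgeOut
  shape_part : ∀ top bot, IsBiword top bot → IsPartitionShape (out top bot).sh
  ssytP : ∀ top bot, IsBiword top bot → IsSSYTOn (out top bot).sh (out top bot).P
  ssytQ : ∀ top bot, IsBiword top bot → IsSSYTOn (out top bot).sh (out top bot).Q
  knuthP : ∀ top bot, IsBiword top bot →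
    KnuthEquiv (readingWordOn (out top bot).sh (out top bot).P) bot
  contentP : ∀ top bot, IsBiword top bot →
    ∀ v, wtS (out top bot).sh (out top bot).P v = bot.count v
  contentQ : ∀ top bot, IsBiword top bot →
    ∀ v, wtS (out top bot).sh (out top bot).Q v = top.count v
  inj : ∀ top bot top' bot', IsBiword top bot → IsBiword top' bot' →
    out top bot = out top' bot' → top = top' ∧ bot = bot'
  surj : ∀ (sh : Finset Cell) (P Q : Cell → ℕ), IsPartitionShape sh →
    IsSSYTOn sh P → IsSSYTOn sh Q →
    ∃ top bot, IsBiword top bot ∧ out top bot = ⟨sh, P, Q⟩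

structure CPOut where
  sTil : Finset Cell
  Q : Cell → ℕ
  Til : Cell → ℕ

def CPTarget (n : ℕ) (s : Finset Cell) (e : ℕ → ℕ) (o : CPOut) : Prop :=
  s ⊆ o.sTil ∧ IsSkewShape o.sTil ∧ ConnectedShape o.sTil ∧
  (∀ c ∈ o.sTil, ∃ r, (r, c.2) ∈ s) ∧
  (∀ c ∈ o.sTil, c ∉ s → ∃ r, r < c.1 ∧ (r, c.2) ∈ s) ∧
  IsRevRowStrictOn (o.sTil \ s) o.Q ∧ IsRowBounded (o.sTil \ s) o.Q ∧
  (∀ r, wtS (o.sTil \ s) o.Q (r + 1) = e r) ∧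
  IsSSYTOn o.sTil o.Til ∧ (∀ c ∈ o.sTil, o.Til c ≤ n)

structure CPData (n : ℕ) where
  out : Finset Cell → (Cell → Finset ℕ) → CPOut
  steps : Finset Cell → (Cell → Finset ℕ) → List (Finset Cell × (Cell → Finset ℕ))
  valid : ∀ s T, IsSkewShape s → ConnectedShape s → IsSVTOn n s T →
    CPTarget n s (exRow s T) (out s T) ∧
    (∀ v, wtS (out s T).sTil (out s T).Til v = wtOn s T v)
  steps_first : ∀ s T, IsSkewShape s → ConnectedShape s → IsSVTOn n s T →
    (steps s T).head? = some (s, T)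
  steps_last : ∀ s T, IsSkewShape s → ConnectedShape s → IsSVTOn n s T →
    (steps s T).getLast? = some ((out s T).sTil, svtOf (out s T).Til)
  steps_svt : ∀ s T, IsSkewShape s → ConnectedShape s → IsSVTOn n s T →
    ∀ p ∈ steps s T, IsSVTOn n p.1 p.2
  steps_len : ∀ s T, IsSkewShape s → ConnectedShape s → IsSVTOn n s T →
    (steps s T).length = exTotal s T + 1
  steps_add : ∀ s T, IsSkewShape s → ConnectedShape s → IsSVTOn n s T →
    ∀ j, j + 1 < (steps s T).length →
      ((steps s T).getD j (∅, fun _ => ∅)).1 ⊆ ((steps s T).getD (j + 1) (∅, fun _ => ∅)).1 ∧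
      (((steps s T).getD (j + 1) (∅, fun _ => ∅)).1 \
        ((steps s T).getD j (∅, fun _ => ∅)).1).card = 1
  bij : ∀ s, IsSkewShape s → ConnectedShape s → ∀ (e : ℕ → ℕ) (o : CPOut),
    CPTarget n s e o →
    ∃! T : {T : Cell → Finset ℕ // IsSVTOn n s T ∧ ∀ r, exRow s T r = e r}, out s T.1 = o

def addedRows (n : ℕ) (cp : CPData n) (s : Finset Cell) (T : Cell → Finset ℕ) : List ℕ :=
  (List.range ((cp.steps s T).length - 1)).map (fun j =>
    ((((cp.steps s T).getD (j + 1) (∅, fun _ => ∅)).1 \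
      (((cp.steps s T).getD j (∅, fun _ => ∅)).1)).sup Prod.fst))

def flagSeq (Φ : ℕ → ℕ) (ks : List ℕ) : ℕ → (ℕ → ℕ)
  | 0 => Φ
  | j + 1 => fun r => if r = ks.getD j 0 then flagSeq Φ ks j (r - 1) else flagSeq Φ ks j r

def inducedFlag (n : ℕ) (cp : CPData n) (s : Finset Cell) (T : Cell → Finset ℕ)
    (Φ : ℕ → ℕ) : ℕ → ℕ :=
  flagSeq Φ (addedRows n cp s T) (addedRows n cp s T).length

def compTilShapes (n : ℕ) (cp : CPData n) (comps : List (Finset Cell))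
    (T : Cell → Finset ℕ) : List (Finset Cell) :=
  comps.map (fun θ => (cp.out θ (restrict θ T)).sTil)

def compTilQs (n : ℕ) (cp : CPData n) (comps : List (Finset Cell))
    (T : Cell → Finset ℕ) : List (Cell → ℕ) :=
  comps.map (fun θ => (cp.out θ (restrict θ T)).Q)

def compTilTabs (n : ℕ) (cp : CPData n) (comps : List (Finset Cell))
    (T : Cell → Finset ℕ) : List (Cell → ℕ) :=
  comps.map (fun θ => (cp.out θ (restrict θ T)).Til)

def insShape (n : ℕ) (cp : CPData n) (comps : List (Finset Cell))
    (T : Cell → Finset ℕ) : Finset Cell :=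
  compositeShape (compTilShapes n cp comps T)

def insTab (n : ℕ) (cp : CPData n) (comps : List (Finset Cell))
    (T : Cell → Finset ℕ) : Cell → ℕ :=
  compositeTab (compTilShapes n cp comps T) (compTilTabs n cp comps T)

def componentFlag (comps : List (Finset Cell)) (Φ : ℕ → ℕ) (i : ℕ) : ℕ → ℕ :=
  fun r => Φ (rowOffset comps i + (r - minRowOf (comps.getD i ∅)))

def insFlag (n : ℕ) (cp : CPData n) (comps : List (Finset Cell))
    (T : Cell → Finset ℕ) (Φ : ℕ → ℕ) : ℕ → ℕ :=
  compositeFlag (compTilShapes n cp comps T)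
    ((List.range comps.length).map (fun i => fun p =>
      inducedFlag n cp (comps.getD i ∅) (restrict (comps.getD i ∅) T)
        (componentFlag comps Φ i) (minRowOf (comps.getD i ∅) + p)))

def insBurge (n : ℕ) (B : BurgeData) (cp : CPData n) (comps : List (Finset Cell))
    (T : Cell → Finset ℕ) : BurgeOut :=
  B.out (bwordOn (insShape n cp comps T))
    (readingWordOn (insShape n cp comps T) (insTab n cp comps T))

def IsCompatibleSVT (n : ℕ) (B : BurgeData) (cp : CPData n) (s : Finset Cell)
    (comps : List (Finset Cell)) (Φ : ℕ → ℕ) (e : ℕ → ℕ) (p : BurgeOut) : Prop :=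
  ∃ P : Cell → Finset ℕ, IsSVTOn n s P ∧ RespectsFlag Φ P ∧ HighestWeight n P ∧
    (∀ r, exRow s P r = e r) ∧ insBurge n B cp comps P = p

def IsCompatibleSVT' (n : ℕ) (B : BurgeData) (cp : CPData n) (s : Finset Cell)
    (comps : List (Finset Cell)) (Φ : ℕ → ℕ) (p : BurgeOut) : Prop :=
  ∃ P : Cell → Finset ℕ, IsSVTOn n s P ∧ RespectsFlag Φ P ∧ HighestWeight n P ∧
    insBurge n B cp comps P = p

def PieceSet (n : ℕ) (cp : CPData n) (s : Finset Cell) (comps : List (Finset Cell))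
    (Φ e : ℕ → ℕ) (tilShapes : List (Finset Cell)) (Qs : List (Cell → ℕ)) :
    Set (Cell → Finset ℕ) :=
  {T | IsSVTOn n s T ∧ RespectsFlag Φ T ∧ (∀ r, exRow s T r = e r) ∧
       compTilShapes n cp comps T = tilShapes ∧ compTilQs n cp comps T = Qs}

def ASet (n : ℕ) (B : BurgeData) (sTil : Finset Cell) (Ψflag : ℕ → ℕ) (R : BurgeOut) :
    Set (Cell → ℕ) :=
  {U | IsSSYTOn sTil U ∧ (∀ c ∈ sTil, U c ≤ n) ∧ RespectsFlagS sTil Ψflag U ∧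
       (B.out (bwordOn sTil) (readingWordOn sTil U)).sh = R.sh ∧
       (B.out (bwordOn sTil) (readingWordOn sTil U)).Q = R.Q}

def colSetOf (sh : Finset Cell) (K : Cell → ℕ) (j : ℕ) : Set ℕ :=
  {v | ∃ i, (i, j) ∈ sh ∧ K (i, j) = v}

def IsKeyTab (sh : Finset Cell) (K : Cell → ℕ) : Prop :=
  IsSSYTOn sh K ∧ ∀ j, colSetOf sh K (j + 1) ⊆ colSetOf sh K j

structure LeftKeyData where
  lk : Finset Cell → (Cell → ℕ) → (Cell → ℕ)
  key : ∀ sh R, IsPartitionShape sh → IsSSYTOn sh R → IsKeyTab sh (lk sh R)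
  knuth : ∀ sh R, IsPartitionShape sh → IsSSYTOn sh R →
    ∀ v, wtS sh (lk sh R) v ≤ wtS sh R v + wtS sh R v + 1

def betaOf (L : LeftKeyData) (p : BurgeOut) : ℕ → ℕ :=
  fun r => wtS p.sh (L.lk p.sh p.Q) (r + 1)

def wordOfFactors (n : ℕ) (v : ℕ → List ℕ) : List ℕ :=
  ((List.range n).reverse.map v).flatten

def WSet (n : ℕ) (B : BurgeData) (α : ℕ → ℕ) (Φ : ℕ → ℕ) : Set (ℕ → List ℕ) :=
  {v | (∀ i, n ≤ i → v i = []) ∧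
       (∀ i, (v i).length = α i) ∧
       (∀ i, (v i).Chain' (· ≤ ·)) ∧
       (∀ i, ∀ x ∈ v i, 1 ≤ x ∧ x ≤ Φ i) ∧
       (∀ i i', i' < i → v i ≠ [] → v i' ≠ [] →
          (∀ m, i' < m → m < i → v m = []) → (v i').headI < (v i).getLastD 0) ∧
       (∀ r, rowLenOf (B.out (bwordComp n α) (wordOfFactors n v)).sh r = dsort n α r) ∧
       (∀ u, wtS (B.out (bwordComp n α) (wordOfFactors n v)).sh
               (B.out (bwordComp n α) (wordOfFactors n v)).Q u =
             if 1 ≤ u ∧ u ≤ n then α (u - 1) else 0)}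

structure RSHatData (n : ℕ) (B : BurgeData) where
  hat : (ℕ → ℕ) → (ℕ → ℕ) → (ℕ → ℕ)
  sorted : ∀ α Φ, IsFlag n Φ → ∀ i, dsort n (hat α Φ) i = dsort n α i
  zeta : ∀ α Φ, IsFlag n Φ → (WSet n B α Φ).Nonempty →
    ∃ ζ : (ℕ → List ℕ) → (ℕ → List ℕ),
      Set.BijOn ζ (WSet n B α Φ) (WSet n B (hat α Φ) (fun i => i + 1)) ∧
      ∀ v ∈ WSet n B α Φ, KnuthEquiv (wordOfFactors n v) (wordOfFactors n (ζ v))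

def IsCompatibleRPP (n : ℕ) (B : BurgeData) (s : Finset Cell) (Φ : ℕ → ℕ)
    (q : BurgeOut) (T' : Cell → ℕ) : Prop :=
  (IsRPPOn s T' ∧ RespectsFlagS s Φ T' ∧ IsYamanouchi (rppRowWord s T') ∧
    B.out (rppHeights s T') (rppRowWord s T') = q) ∧
  (∀ T'' : Cell → ℕ,
    (IsRPPOn s T'' ∧ RespectsFlagS s Φ T'' ∧ IsYamanouchi (rppRowWord s T'') ∧
      (B.out (rppHeights s T'') (rppRowWord s T'')).Q = q.Q) → T'' = T')

section Helpers
attribute [local instance 1] Classical.propDecidable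
set_option linter.all false
open Finset

def cls (v : ℕ) : List ℕ → ℕ
  | [] => 0
  | a :: z => if a = v then cls v z + 1 else if a = v + 1 then cls v z - 1 else cls v z

def opn (v : ℕ) : List ℕ → ℕ
  | [] => 0
  | a :: z => if a = v + 1 ∧ cls v z = 0 then opn v z + 1 else opn v z

def fw (v : ℕ) : List ℕ → List ℕ
  | [] => []
  | a :: z => if a = v ∧ cls v z = 0 then (v + 1) :: z else a :: fw v z

def ew (v : ℕ) : List ℕ → List ℕ
  | [] => []
  | a :: z => if a = v + 1 ∧ cls v z = 0 then v :: z else a :: ew v z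

theorem cls_fw (v : ℕ) (w : List ℕ) (h : 0 < cls v w) :
    cls v (fw v w) + 1 = cls v w ∧ opn v (fw v w) = opn v w + 1 := by
  induction w with
  | nil => simp [cls] at h
  | cons a z ih =>
    simp only [fw]
    by_cases h1 : a = v
    · by_cases h2 : cls v z = 0
      · simp [h1, h2, cls, opn]
      · have := ih (by omega)
        have h3 : ¬ (v = v + 1) := by omega
        simp [h1, h2, cls, opn]
        omega
    · by_cases h2 : a = v + 1
      · have h3 : ¬ (v + 1 = v) := by omega
        simp [h2, cls] at h
        have := ih (by omega)
        simp [h2, cls, opn]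
        grind
      · simp [h1, h2, cls] at h
        have := ih h
        simp [h1, h2, cls, opn]
        omega

theorem cls_ew (v : ℕ) (w : List ℕ) (h : 0 < opn v w) :
    cls v (ew v w) = cls v w + 1 ∧ opn v (ew v w) + 1 = opn v w := by
  induction w with
  | nil => simp [opn] at h
  | cons a z ih =>
    simp only [ew]
    by_cases h2 : a = v + 1
    · have h3 : ¬ (v + 1 = v) := by omega
      by_cases h4 : cls v z = 0
      · simp [h2, h4, cls, opn]
      · simp [h2, h4, opn] at h
        have := ih h
        simp [h2, h4, cls, opn]
        grind
    · simp [h2, opn] at h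
      have := ih h
      by_cases h1 : a = v
      · have h3 : ¬ (v = v + 1) := by omega
        simp [h1, cls, opn]
        omega
      · simp [h1, h2, cls, opn]
        omega

theorem ew_fw (v : ℕ) (w : List ℕ) (h : 0 < cls v w) : ew v (fw v w) = w := by
  induction w with
  | nil => simp [cls] at h
  | cons a z ih =>
    simp only [fw]
    by_cases h1 : a = v
    · by_cases h2 : cls v z = 0
      · simp [h1, h2, ew]
      · have := ih (by omega)
        simp [h1, h2, ew, this]
    · by_cases h2 : a = v + 1
      · simp [h2, cls] at h
        have := ih (by omega)
        have h7 := cls_fw v z (by omega)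
        simp [h2, ew, this]
        omega
      · simp [h1, h2, cls] at h
        have := ih h
        simp [h1, h2, ew, this]

theorem fw_ew (v : ℕ) (w : List ℕ) (h : 0 < opn v w) : fw v (ew v w) = w := by
  induction w with
  | nil => simp [opn] at h
  | cons a z ih =>
    simp only [ew]
    by_cases h2 : a = v + 1
    · by_cases h4 : cls v z = 0
      · simp [h2, h4, fw]
      · simp [h2, h4, opn] at h
        have := ih h
        simp [h2, h4, fw, this]
    · simp [h2, opn] at h
      have := ih h
      have h7 := cls_ew v z h
      by_cases h1 : a = v
      · simp [h1, fw, this, h7]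
      · simp [h1, h2, fw, this]

theorem fw_decomp (v : ℕ) (w : List ℕ) (h : 0 < cls v w) :
    ∃ u z, w = u ++ v :: z ∧ fw v w = u ++ (v + 1) :: z ∧ cls v z = 0 ∧ opn v u = 0 := by
  have key : ∀ w : List ℕ, 0 < cls v w →
    ∃ u z, w = u ++ v :: z ∧ fw v w = u ++ (v + 1) :: z ∧ cls v z = 0 ∧
      opn v u = 0 ∧ cls v w = cls v u + 1 := by
    clear h w
    intro w h
    induction w with
    | nil => simp [cls] at h
    | cons a z ih =>
      by_cases h1 : a = v
      · by_cases h2 : cls v z = 0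
        · exact ⟨[], z, by simp [h1, fw, h2, opn, cls]⟩
        · obtain ⟨u, z', e1, e2, e3, e4, e5⟩ := ih (by omega)
          refine ⟨a :: u, z', by simp [e1], by simp [fw, h1, h2, e2], e3, ?_, ?_⟩
          · simp [opn, h1, e4]
          · simp [cls, h1, e5]
      · by_cases h2 : a = v + 1
        · have h3 : ¬ (v + 1 = v) := by omega
          simp [h2, cls] at h
          obtain ⟨u, z', e1, e2, e3, e4, e5⟩ := ih (by omega)
          refine ⟨a :: u, z', by simp [e1], by simp [fw, h1, e2], e3, ?_, ?_⟩
          · simp [opn, e4]; omega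
          · simp [cls, h2, e5]; omega
        · simp [h1, h2, cls] at h
          obtain ⟨u, z', e1, e2, e3, e4, e5⟩ := ih (by omega)
          refine ⟨a :: u, z', by simp [e1], by simp [fw, h1, e2], e3, ?_, ?_⟩
          · simp [opn, e4]; omega
          · simp [cls, h1, h2, e5]
  grind

theorem ew_decomp (v : ℕ) (w : List ℕ) (h : 0 < opn v w) :
    ∃ u z, w = u ++ (v + 1) :: z ∧ ew v w = u ++ v :: z ∧ cls v z = 0 ∧ opn v u = 0 := by
  have h1 := cls_ew v w h
  obtain ⟨u, z, e1, e2, e3, e4⟩ := fw_decomp v (ew v w) (by omega)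
  rw [fw_ew v w h] at e2
  grind

theorem cls_opn_count (v : ℕ) (w : List ℕ) :
    cls v w + w.count (v + 1) = opn v w + w.count v := by
  induction w with
  | nil => simp [cls, opn]
  | cons a z ih =>
    by_cases h1 : a = v
    · simp [h1, cls, opn, List.count_cons]; omega
    · by_cases h2 : a = v + 1
      · by_cases h3 : cls v z = 0
        · simp [h2, h3, cls, opn, List.count_cons]; omega
        · simp [h2, h3, cls, opn, List.count_cons]; omega
      · simp [h1, h2, cls, opn, List.count_cons]; omega

theorem opn_append_le (v : ℕ) (u z : List ℕ) : opn v z ≤ opn v (u ++ z) := by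
  induction u with
  | nil => simp
  | cons a u ih => simp only [List.cons_append, opn]; split_ifs <;> omega

theorem hDE : (fun a b : ℕ => Classical.propDecidable (a = b)) = instDecidableEqNat :=
  Subsingleton.elim _ _

theorem yam_def (w : List ℕ) : IsYamanouchi w ↔
    ∀ k v, (w.drop k).count (v + 2) ≤ (w.drop k).count (v + 1) := by
  unfold IsYamanouchi
  rw [hDE]

theorem yam_iff (w : List ℕ) : IsYamanouchi w ↔ ∀ v, opn (v + 1) w = 0 := by
  rw [yam_def]
  constructor
  · intro h v
    induction w with
    | nil => simp [opn]
    | cons a z ih =>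
      have hz : opn (v + 1) z = 0 := ih (fun k u => by simpa using h (k + 1) u)
      by_cases h2 : a = v + 1 + 1 ∧ cls (v + 1) z = 0
      · have h3 := h 0 v
        have h4 := cls_opn_count (v + 1) z
        grind
      · simp [opn, h2, hz]
  · intro h k v
    have h1 := cls_opn_count (v + 1) (w.drop k)
    have h2 := opn_append_le (v + 1) (w.take k) (w.drop k)
    rw [List.take_append_drop, h v] at h2
    grind

theorem knuth_refl (w : List ℕ) : KnuthEquiv w w := Relation.EqvGen.refl w
theorem knuth_symm {w w' : List ℕ} (h : KnuthEquiv w w') : KnuthEquiv w' w :=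
  Relation.EqvGen.symm _ _ h
theorem knuth_trans {w w' w'' : List ℕ} (h : KnuthEquiv w w') (h' : KnuthEquiv w' w'') :
    KnuthEquiv w w'' := Relation.EqvGen.trans _ _ _ h h'

theorem knuthstep_cons (a : ℕ) {w w' : List ℕ} (h : KnuthStep w w') :
    KnuthStep (a :: w) (a :: w') := by
  cases h with
  | kxzy u w x y z h1 h2 => exact KnuthStep.kxzy (a :: u) w x y z h1 h2
  | kyxz u w x y z h1 h2 => exact KnuthStep.kyxz (a :: u) w x y z h1 h2

theorem knuth_cons (a : ℕ) {w w' : List ℕ} (h : KnuthEquiv w w') :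
    KnuthEquiv (a :: w) (a :: w') := by
  induction h with
  | rel x y h => exact Relation.EqvGen.rel _ _ (knuthstep_cons a h)
  | refl x => exact knuth_refl _
  | symm x y _ ih => exact knuth_symm ih
  | trans x y z _ _ ih1 ih2 => exact knuth_trans ih1 ih2

theorem knuth_x {x y z : ℕ} (t : List ℕ) (h1 : x ≤ y) (h2 : y < z) :
    KnuthEquiv (x :: z :: y :: t) (z :: x :: y :: t) :=
  Relation.EqvGen.rel _ _ (KnuthStep.kxzy [] t x y z h1 h2)
theorem knuth_y {x y z : ℕ} (t : List ℕ) (h1 : x < y) (h2 : y ≤ z) :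
    KnuthEquiv (y :: x :: z :: t) (y :: z :: x :: t) :=
  Relation.EqvGen.rel _ _ (KnuthStep.kyxz [] t x y z h1 h2)

def KGood (v : ℕ) (w w' : List ℕ) : Prop :=
  cls v w = cls v w' ∧ opn v w = opn v w' ∧
  (0 < cls v w → KnuthEquiv (fw v w) (fw v w')) ∧ (0 < opn v w → KnuthEquiv (ew v w) (ew v w'))

theorem kgood_cons (v a : ℕ) {w w' : List ℕ} (hk : KnuthEquiv w w') (h : KGood v w w') :
    KGood v (a :: w) (a :: w') := by
  obtain ⟨h1, h2, h3, h4⟩ := h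
  refine ⟨by simp [cls, h1], by simp [opn, h1, h2], ?_, ?_⟩
  · intro hp
    simp only [fw, ← h1]
    split_ifs with h5
    · exact knuth_cons _ hk
    · apply knuth_cons
      apply h3
      simp only [cls] at hp
      grind
  · intro hp
    simp only [ew, ← h1]
    split_ifs with h5
    · exact knuth_cons _ hk
    · apply knuth_cons
      apply h4
      simpa [opn, h5] using hp

theorem kgood_base_x (v : ℕ) {x y z : ℕ} (t : List ℕ) (h1 : x ≤ y) (h2 : y < z) :
    KGood v (x :: z :: y :: t) (z :: x :: y :: t) := by
  have hx : x = v ∨ x = v + 1 ∨ (x ≠ v ∧ x ≠ v + 1) := by omega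
  have hy : y = v ∨ y = v + 1 ∨ (y ≠ v ∧ y ≠ v + 1) := by omega
  have hz : z = v ∨ z = v + 1 ∨ (z ≠ v ∧ z ≠ v + 1) := by omega
  have hn : cls v t = 0 ∨ cls v t = 1 ∨ (cls v t ≠ 0 ∧ cls v t ≠ 1 ∧ cls v t - 1 ≠ 0) := by omega
  rcases hx with rfl | rfl | ⟨x1, x2⟩ <;> rcases hy with rfl | rfl | ⟨y1, y2⟩ <;>
    rcases hz with rfl | rfl | ⟨z1, z2⟩ <;>
    first
    | (exfalso; omega)
    | (rcases hn with hn | hn | ⟨hn, hn', hn''⟩ <;>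
       simp_all (maxSteps := 200000) [KGood, cls, opn, fw, ew] <;>
       (try apply And.intro) <;>
       (try intro _) <;>
       first
       | (apply knuth_x <;> omega)
       | (apply knuth_y <;> omega)
       | (apply knuth_symm; apply knuth_x <;> omega)
       | (apply knuth_symm; apply knuth_y <;> omega)
       | skip)

theorem kgood_base_y (v : ℕ) {x y z : ℕ} (t : List ℕ) (h1 : x < y) (h2 : y ≤ z) :
    KGood v (y :: x :: z :: t) (y :: z :: x :: t) := by
  have hx : x = v ∨ x = v + 1 ∨ (x ≠ v ∧ x ≠ v + 1) := by omega
  have hy : y = v ∨ y = v + 1 ∨ (y ≠ v ∧ y ≠ v + 1) := by omega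
  have hz : z = v ∨ z = v + 1 ∨ (z ≠ v ∧ z ≠ v + 1) := by omega
  have hn : cls v t = 0 ∨ cls v t = 1 ∨ (cls v t ≠ 0 ∧ cls v t ≠ 1 ∧ cls v t - 1 ≠ 0) := by omega
  rcases hx with rfl | rfl | ⟨x1, x2⟩ <;> rcases hy with rfl | rfl | ⟨y1, y2⟩ <;>
    rcases hz with rfl | rfl | ⟨z1, z2⟩ <;>
    first
    | (exfalso; omega)
    | (rcases hn with hn | hn | ⟨hn, hn', hn''⟩ <;>
       simp_all (maxSteps := 200000) [KGood, cls, opn, fw, ew] <;>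
       (try apply And.intro) <;>
       (try intro _) <;>
       first
       | (apply knuth_x <;> omega)
       | (apply knuth_y <;> omega)
       | (apply knuth_symm; apply knuth_x <;> omega)
       | (apply knuth_symm; apply knuth_y <;> omega)
       | skip)

theorem kgood_of_step (v : ℕ) {w w' : List ℕ} (h : KnuthStep w w') : KGood v w w' := by
  cases h with
  | kxzy u w x y z h1 h2 =>
    induction u with
    | nil => exact kgood_base_x v w h1 h2
    | cons a u ih => exact kgood_cons v a (Relation.EqvGen.rel _ _ (KnuthStep.kxzy u w x y z h1 h2)) ih
  | kyxz u w x y z h1 h2 =>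
    induction u with
    | nil => exact kgood_base_y v w h1 h2
    | cons a u ih => exact kgood_cons v a (Relation.EqvGen.rel _ _ (KnuthStep.kyxz u w x y z h1 h2)) ih

theorem kgood_of_equiv (v : ℕ) {w w' : List ℕ} (h : KnuthEquiv w w') : KGood v w w' := by
  induction h with
  | rel x y h => exact kgood_of_step v h
  | refl x => exact ⟨rfl, rfl, fun _ => knuth_refl _, fun _ => knuth_refl _⟩
  | symm x y _ ih =>
    obtain ⟨h1, h2, h3, h4⟩ := ih
    exact ⟨h1.symm, h2.symm, fun h => knuth_symm (h3 (by omega)), fun h => knuth_symm (h4 (by omega))⟩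
  | trans x y z _ _ ih1 ih2 =>
    obtain ⟨h1, h2, h3, h4⟩ := ih1
    obtain ⟨k1, k2, k3, k4⟩ := ih2
    exact ⟨h1.trans k1, h2.trans k2, fun h => knuth_trans (h3 h) (k3 (by omega)),
      fun h => knuth_trans (h4 h) (k4 (by omega))⟩

theorem knuth_perm {w w' : List ℕ} (h : KnuthEquiv w w') : w.Perm w' := by
  induction h with
  | rel x y h =>
    cases h with
    | kxzy u w x y z h1 h2 => exact List.Perm.append_left _ (List.Perm.swap _ _ _)
    | kyxz u w x y z h1 h2 =>
      grind
  | refl x => exact List.Perm.refl _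
  | symm x y _ ih => exact ih.symm
  | trans x y z _ _ ih1 ih2 => exact ih1.trans ih2

theorem sum_ew (v : ℕ) (w : List ℕ) (h : 0 < opn v w) : (ew v w).sum + 1 = w.sum := by
  obtain ⟨u, z, h1, h2, _⟩ := ew_decomp v w h
  grind

theorem opn_pos_mem (v : ℕ) (w : List ℕ) (h : 0 < opn v w) : v + 1 ∈ w := by
  obtain ⟨u, z, h1, h2, _⟩ := ew_decomp v w h
  grind

theorem zlemma_step {ι κ A : Type*} [AddCommMonoid A] (X : Finset ι) (word : ι → List ℕ)
    (tag : ι → κ) (τ : κ → A) (v : ℕ)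
    (inj : ∀ x ∈ X, ∀ y ∈ X, word x = word y → tag x = tag y → x = y)
    (hf : ∀ x ∈ X, 0 < cls v (word x) → ∃ y ∈ X, word y = fw v (word x) ∧ tag y = tag x)
    (he : ∀ x ∈ X, 0 < opn v (word x) → ∃ y ∈ X, word y = ew v (word x) ∧ tag y = tag x)
    (w : List ℕ) (hw : 0 < opn v w) :
    ∑ x ∈ X.filter (fun x => KnuthEquiv (word x) w), τ (tag x) =
    ∑ x ∈ X.filter (fun x => KnuthEquiv (word x) (ew v w)), τ (tag x) := by
  have key : ∀ x ∈ X.filter (fun x => KnuthEquiv (word x) w), 0 < opn v (word x) := by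
    intro x hx
    rw [mem_filter] at hx
    rw [(kgood_of_equiv v hx.2).2.1]; exact hw
  have hmem : ∀ x ∈ X.filter (fun x => KnuthEquiv (word x) w), x ∈ X :=
    fun x hx => (mem_filter.1 hx).1
  choose! e he1 he2 he3 using he
  refine sum_bij (fun x _ => e x) ?_ ?_ ?_ ?_
  · intro x hx
    rw [mem_filter]
    refine ⟨he1 x (hmem x hx) (key x hx), ?_⟩
    rw [he2 x (hmem x hx) (key x hx)]
    exact (kgood_of_equiv v (mem_filter.1 hx).2).2.2.2 (key x hx)
  · intro x hx y hy hxy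
    apply inj x (hmem x hx) y (hmem y hy)
    · have h1 := he2 x (hmem x hx) (key x hx)
      have h2 := he2 y (hmem y hy) (key y hy)
      rw [← fw_ew v (word x) (key x hx), ← fw_ew v (word y) (key y hy), ← h1, ← h2, hxy]
    · grind
  · intro y hy
    rw [mem_filter] at hy
    have h1 := kgood_of_equiv v hy.2
    have h2 := cls_ew v w hw
    have h3 : 0 < cls v (word y) := by have := h1.1; omega
    obtain ⟨x, hx, hx1, hx2⟩ := hf y hy.1 h3
    have hx' : x ∈ X.filter (fun x => KnuthEquiv (word x) w) := by
      rw [mem_filter]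
      refine ⟨hx, ?_⟩
      rw [hx1]
      have := h1.2.2.1 h3
      rwa [fw_ew v w hw] at this
    refine ⟨x, hx', ?_⟩
    apply inj _ (he1 x hx (key x hx')) _ hy.1
    · rw [he2 x hx (key x hx'), hx1, ew_fw v _ h3]
    · grind
  · grind

theorem cls_append (v : ℕ) (u z : List ℕ) : cls v (u ++ z) = cls v u + (cls v z - opn v u) := by
  induction u with
  | nil => simp [cls, opn]
  | cons a u ih =>
    simp only [List.cons_append, cls, opn, ih]
    grind

theorem opn_append (v : ℕ) (u z : List ℕ) : opn v (u ++ z) = opn v z + (opn v u - cls v z) := by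
  induction u with
  | nil => simp [opn]
  | cons a u ih =>
    simp only [List.cons_append, opn, ih, cls_append]
    grind

theorem cls_le_count (v : ℕ) (l : List ℕ) : cls v l ≤ l.count v := by
  induction l with
  | nil => simp [cls]
  | cons a l ih =>
    by_cases h : a = v
    · subst h; simp [cls]; omega
    · simp only [cls, List.count_cons, h]; simp [h]; split_ifs <;> omega

theorem opn_le_count (v : ℕ) (l : List ℕ) : opn v l ≤ l.count (v + 1) := by
  have := cls_le_count v l
  have := cls_opn_count v l
  omega

theorem cls_zero_of_not_mem (v : ℕ) (l : List ℕ) (h : v ∉ l) : cls v l = 0 := by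
  have := cls_le_count v l
  grind

theorem cls_sorted (v : ℕ) (l : List ℕ) (h : l.Pairwise (· ≤ ·)) :
    cls v l = l.count v ∧ opn v l = l.count (v + 1) := by
  induction l with
  | nil => simp [cls, opn]
  | cons a l ih =>
    rw [List.pairwise_cons] at h
    obtain ⟨h1, h2⟩ := ih h.2
    by_cases e : a = v
    · subst e
      simp [cls, opn, h1, h2]
    · by_cases e' : a = v + 1
      · subst e'
        have : cls v l = 0 := cls_zero_of_not_mem v l (fun hm => by have := h.1 _ hm; omega)
        have e2 : l.count v = 0 := by omega
        simp [cls, opn, this, h2, e2]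
      · simp [cls, opn, e, e', h1, h2]

theorem cls_desc (v : ℕ) (l : List ℕ) (h : l.Pairwise (· > ·)) :
    cls v l = l.count v - l.count (v + 1) ∧ opn v l = l.count (v + 1) - l.count v ∧
    l.count v ≤ 1 ∧ l.count (v + 1) ≤ 1 := by
  have hn : l.Nodup := h.imp (fun h => by omega)
  have c1 := List.nodup_iff_count_le_one.1 hn v
  have c2 := List.nodup_iff_count_le_one.1 hn (v + 1)
  have key : cls v l = l.count v - l.count (v + 1) := by
    clear c1 c2 hn
    induction l with
    | nil => simp [cls]
    | cons a l ih =>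
      rw [List.pairwise_cons] at h
      have h1 := ih h.2
      by_cases e : a = v
      · subst e
        have : l.count (a + 1) = 0 :=
          List.count_eq_zero_of_not_mem (fun hm => by have := h.1 _ hm; omega)
        simp [cls, h1, this]
      · by_cases e' : a = v + 1
        · subst e'
          have : l.count (v + 1) = 0 :=
            List.count_eq_zero_of_not_mem (fun hm => by have := h.1 _ hm; omega)
          simp [cls, h1, this]
        · simp [cls, e, e', h1]
  have := cls_opn_count v l
  omega

def seg (L : ℕ → List ℕ) (p : ℕ) : ℕ → List ℕ
  | 0 => []
  | d + 1 => L (p + d) ++ seg L p d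

theorem seg_add (L : ℕ → List ℕ) (a e d : ℕ) :
    seg L a (e + d) = seg L (a + e) d ++ seg L a e := by
  induction d with
  | zero => simp [seg]
  | succ d ih => rw [← Nat.add_assoc]; simp [seg, ih, Nat.add_assoc]

theorem seg_congr (L L' : ℕ → List ℕ) (a d : ℕ) (h : ∀ i, a ≤ i → i < a + d → L i = L' i) :
    seg L a d = seg L' a d := by
  induction d with
  | zero => rfl
  | succ d ih => simp only [seg]; rw [h (a + d) (by omega) (by omega), ih (fun i h1 h2 => h i h1 (by omega))]

theorem seg_nil (L : ℕ → List ℕ) (a d : ℕ) (h : ∀ i, a ≤ i → L i = []) :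
    seg L a d = [] := by
  induction d with
  | zero => rfl
  | succ d ih => simp only [seg]; rw [h (a + d) (by omega), ih]; rfl

theorem seg_extend (L : ℕ → List ℕ) (a b : ℕ) (h : ∀ i, min a b ≤ i → L i = []) :
    seg L 0 a = seg L 0 b := by
  rcases le_total a b with hab | hab
  · obtain ⟨d, rfl⟩ := Nat.exists_eq_add_of_le hab
    rw [seg_add, seg_nil _ (0 + _)]
    · rfl
    · grind
  · obtain ⟨d, rfl⟩ := Nat.exists_eq_add_of_le hab
    rw [seg_add, seg_nil _ (0 + _)]
    · rfl
    · grind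

theorem seg_one (L : ℕ → List ℕ) (p K : ℕ) (h : p < K) :
    seg L 0 K = seg L (p + 1) (K - p - 1) ++ L p ++ seg L 0 p := by
  have : K = p + 1 + (K - p - 1) := by omega
  conv_lhs => rw [this]
  rw [seg_add, seg]
  simp

theorem seg_low (L : ℕ → List ℕ) (p K : ℕ) (h : p < K) :
    seg L p (K - p) = seg L (p + 1) (K - (p + 1)) ++ L p := by
  have : K - p = 1 + (K - (p + 1)) := by omega
  rw [this, seg_add, seg]
  simp [seg]

theorem seg_split (L : ℕ → List ℕ) (K : ℕ) (u z : List ℕ) (c : ℕ) (h : seg L 0 K = u ++ c :: z) :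
    ∃ p < K, ∃ l1 l2, L p = l1 ++ c :: l2 ∧ u = seg L (p + 1) (K - p - 1) ++ l1 ∧
      z = l2 ++ seg L 0 p := by
  induction K generalizing u z with
  | zero => simp [seg] at h
  | succ K ih =>
    simp only [seg, Nat.zero_add] at h
    rw [List.append_eq_append_iff] at h
    rcases h with ⟨a, h1, h2⟩ | ⟨a, h1, h2⟩
    · obtain ⟨p, hp, l1, l2, e1, e2, e3⟩ := ih a z h2
      refine ⟨p, by omega, l1, l2, e1, ?_, e3⟩
      have : K + 1 - p - 1 = (K - p - 1) + 1 := by omega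
      rw [this, seg, h1, e2, List.append_assoc]
      grind
    · rcases a with _ | ⟨b, a⟩
      · simp only [List.nil_append] at h2
        obtain ⟨p, hp, l1, l2, e1, e2, e3⟩ := ih [] z h2.symm
        refine ⟨p, by omega, l1, l2, e1, ?_, e3⟩
        have : K + 1 - p - 1 = (K - p - 1) + 1 := by omega
        rw [this, seg, List.append_assoc, ← e2, List.append_nil]
        grind
      · simp only [List.cons_append, List.cons.injEq] at h2
        refine ⟨K, by omega, u, a, ?_, ?_, h2.2⟩
        · grind
        · simp [seg]

theorem seg_update (L L' : ℕ → List ℕ) (K p : ℕ) (hp : p < K) (h : ∀ i, i ≠ p → L' i = L i) :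
    seg L' 0 K = seg L (p + 1) (K - p - 1) ++ L' p ++ seg L 0 p := by
  rw [seg_one L' p K hp]
  congr 1
  · congr 1
    exact seg_congr _ _ _ _ (fun i h1 h2 => h i (by omega))
  · exact seg_congr _ _ _ _ (fun i h1 h2 => h i (by omega))

theorem seg_mem (L : ℕ → List ℕ) (a d x : ℕ) (h : x ∈ seg L a d) : ∃ i, x ∈ L i := by
  induction d with
  | zero => simp [seg] at h
  | succ d ih =>
    simp only [seg, List.mem_append] at h
    grind

theorem seg_length (L : ℕ → List ℕ) (d : ℕ) :
    (seg L 0 d).length = ∑ i ∈ range d, (L i).length := by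
  induction d with
  | zero => simp [seg]
  | succ d ih => simp [seg, sum_range_succ, ih]; omega

theorem seg_count (L : ℕ → List ℕ) (d x : ℕ) :
    (seg L 0 d).count x = ∑ i ∈ range d, (L i).count x := by
  induction d with
  | zero => simp [seg]
  | succ d ih => simp [seg, sum_range_succ, ih]; omega

theorem seg_inj (L L' : ℕ → List ℕ) (d : ℕ) (hl : ∀ i, i < d → (L i).length = (L' i).length)
    (h : seg L 0 d = seg L' 0 d) : ∀ i, i < d → L i = L' i := by
  induction d with
  | zero => intro i hi; omega
  | succ d ih =>
    simp only [seg, Nat.zero_add] at h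
    obtain ⟨h1, h2⟩ := List.append_inj h (hl d (by omega))
    grind

theorem flatten_eq_seg (L : ℕ → List ℕ) (K : ℕ) :
    ((List.range K).reverse.map L).flatten = seg L 0 K := by
  induction K with
  | zero => rfl
  | succ K ih => simp only [List.range_succ, List.reverse_append, List.map_append, List.flatten_append, ih, seg]; simp

def rowOf (n : ℕ) (m : ℕ → ℕ) : List ℕ :=
  (List.range n).flatMap (fun x => List.replicate (m x) (x + 1))

theorem rowOf_succ (n : ℕ) (m : ℕ → ℕ) :
    rowOf (n + 1) m = rowOf n m ++ List.replicate (m n) (n + 1) := by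
  simp [rowOf, List.range_succ]

theorem rowOf_mem (n : ℕ) (m : ℕ → ℕ) (x : ℕ) (h : x ∈ rowOf n m) : 1 ≤ x ∧ x ≤ n := by
  simp only [rowOf, List.mem_flatMap, List.mem_range, List.mem_replicate] at h
  omega

theorem rowOf_sorted (n : ℕ) (m : ℕ → ℕ) : (rowOf n m).Pairwise (· ≤ ·) := by
  induction n with
  | zero => simp [rowOf]
  | succ n ih =>
    rw [rowOf_succ, List.pairwise_append]
    refine ⟨ih, List.pairwise_replicate.2 (Or.inr le_rfl), ?_⟩
    intro a ha b hb
    have := rowOf_mem _ _ _ ha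
    grind

theorem rowOf_count (n : ℕ) (m : ℕ → ℕ) (x : ℕ) :
    (rowOf n m).count (x + 1) = if x < n then m x else 0 := by
  induction n with
  | zero => simp [rowOf]
  | succ n ih =>
    rw [rowOf_succ, List.count_append, ih, List.count_replicate]
    grind

theorem rowOf_count_zero (n : ℕ) (m : ℕ → ℕ) : (rowOf n m).count 0 = 0 :=
  List.count_eq_zero_of_not_mem (fun h => by have := rowOf_mem _ _ _ h; omega)

theorem rowOf_length (n : ℕ) (m : ℕ → ℕ) : (rowOf n m).length = ∑ x ∈ range n, m x := by
  induction n with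
  | zero => simp [rowOf]
  | succ n ih => rw [rowOf_succ]; simp [sum_range_succ, ih]

theorem sorted_ext {l l' : List ℕ} (h : l.Pairwise (· ≤ ·)) (h' : l'.Pairwise (· ≤ ·))
    (hc : ∀ x, l.count x = l'.count x) : l = l' := by
  have hp : l.Perm l' := List.perm_iff_count.2 hc
  exact hp.eq_of_pairwise (fun a b _ _ h1 h2 => le_antisymm h1 h2) h h'

theorem desc_ext {l l' : List ℕ} (h : l.Pairwise (· > ·)) (h' : l'.Pairwise (· > ·))
    (hc : ∀ x, l.count x = l'.count x) : l = l' := by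
  have hp : l.Perm l' := List.perm_iff_count.2 hc
  exact hp.eq_of_pairwise (fun a b _ _ h1 h2 => by omega) h h'

theorem eq_rowOf (n : ℕ) (m : ℕ → ℕ) (l : List ℕ) (h : l.Pairwise (· ≤ ·))
    (h1 : ∀ x ∈ l, 1 ≤ x ∧ x ≤ n) (h2 : ∀ x, x < n → l.count (x + 1) = m x) :
    l = rowOf n m := by
  apply sorted_ext h (rowOf_sorted n m)
  intro x
  rcases x with _ | x
  · rw [rowOf_count_zero]
    exact List.count_eq_zero_of_not_mem (fun h => by have := h1 _ h; omega)
  · rw [rowOf_count]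
    grind

theorem sorted_change_f (v : ℕ) (l1 l2 : List ℕ) (h : (l1 ++ v :: l2).Pairwise (· ≤ ·))
    (hv : v ∉ l2) : (l1 ++ (v + 1) :: l2).Pairwise (· ≤ ·) := by
  rw [List.pairwise_append, List.pairwise_cons] at *
  refine ⟨h.1, ⟨?_, h.2.1.2⟩, ?_⟩
  · grind
  · intro a ha b hb
    have h3 := h.2.2 a ha v (by simp)
    grind

theorem sorted_change_e (v : ℕ) (l1 l2 : List ℕ) (h : (l1 ++ (v + 1) :: l2).Pairwise (· ≤ ·))
    (hv : v + 1 ∉ l1) : (l1 ++ v :: l2).Pairwise (· ≤ ·) := by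
  rw [List.pairwise_append, List.pairwise_cons] at *
  refine ⟨h.1, ⟨?_, h.2.1.2⟩, ?_⟩
  · grind
  · intro a ha b hb
    have h3 := h.2.2 a ha (v + 1) (by simp)
    grind

theorem count_change_f (v : ℕ) (l1 l2 : List ℕ) (x : ℕ) :
    (l1 ++ (v + 1) :: l2).count x + (if x = v then 1 else 0) =
    (l1 ++ v :: l2).count x + (if x = v + 1 then 1 else 0) := by grind

structure RD (n : ℕ) (lam mu : ℕ → ℕ) (C : ℕ → ℕ → ℕ) : Prop where
  zero : ∀ i, C i 0 = mu i
  mono : ∀ i x, C i x ≤ C i (x + 1)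
  anti : ∀ i x, C (i + 1) x ≤ C i x
  top : ∀ i x, n ≤ x → C i x = lam i

def mI (C : ℕ → ℕ → ℕ) (i x : ℕ) : ℕ := C i (x + 1) - max (C i x) (C (i + 1) (x + 1))

def rowW (n : ℕ) (C : ℕ → ℕ → ℕ) (i : ℕ) : List ℕ := rowOf n (mI C i)

def wd (n : ℕ) (C : ℕ → ℕ → ℕ) : List ℕ := seg (rowW n C) 0 (n + 1)

theorem RD.mono' {n : ℕ} {lam mu : ℕ → ℕ} {C : ℕ → ℕ → ℕ} (h : RD n lam mu C) (i : ℕ) {x y : ℕ}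
    (hxy : x ≤ y) : C i x ≤ C i y :=
  monotone_nat_of_le_succ (h.mono i) hxy

theorem RD.le_lam {n : ℕ} {lam mu : ℕ → ℕ} {C : ℕ → ℕ → ℕ} (h : RD n lam mu C) (i x : ℕ) :
    C i x ≤ lam i := by
  have := h.mono' i (le_max_left x n)
  rwa [h.top i _ (le_max_right x n)] at this

theorem mI_eq {n : ℕ} {lam mu : ℕ → ℕ} {C : ℕ → ℕ → ℕ} (h : RD n lam mu C) (i x : ℕ) :
    C i (x + 1) = max (C i x) (C (i + 1) (x + 1)) + mI C i x := by
  have h1 := h.mono i x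
  have h2 := h.anti i (x + 1)
  simp only [mI]; omega

theorem RD.opn_bound {n : ℕ} {lam mu : ℕ → ℕ} {C : ℕ → ℕ → ℕ} (h : RD n lam mu C) (K w : ℕ)
    (hK : ∀ x, C K x = 0) (hw : w + 2 ≤ n) (i : ℕ) (hi : i ≤ K) :
    C i (w + 2) ≤ C i (w + 1) + opn (w + 1) (seg (rowW n C) i (K - i)) := by
  induction hd : K - i generalizing i with
  | zero =>
    have : i = K := by omega
    grind
  | succ d ih =>
    have := ih (i + 1) (by omega) (by omega)
    have e := seg_low (rowW n C) i K (by omega)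
    rw [hd, show K - (i + 1) = d by omega] at e
    rw [e, opn_append]
    have hs := cls_sorted (w + 1) _ (rowOf_sorted n (mI C i))
    rw [show w + 1 + 1 = (w + 1) + 1 from rfl, rowOf_count, rowOf_count, if_pos (by omega), if_pos (by omega)] at hs
    have e1 := mI_eq h i w
    have e2 := mI_eq h i (w + 1)
    unfold rowW
    rw [hs.1, hs.2]
    unfold rowW at this
    grind

theorem RD.upd {n : ℕ} {lam mu : ℕ → ℕ} {C : ℕ → ℕ → ℕ} (h : RD n lam mu C) (w : ℕ)
    (hw : w + 2 ≤ n) (B' : ℕ → ℕ) (h1 : ∀ i, C i w ≤ B' i) (h2 : ∀ i, B' i ≤ C i (w + 2))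
    (h3 : ∀ i, B' (i + 1) ≤ B' i) :
    RD n lam mu (fun i x => if x = w + 1 then B' i else C i x) where
  zero i := by simp [h.zero]
  mono i x := by
    have := h.mono i x
    grind
  anti i x := by
    have := h.anti i x
    grind
  top i x hx := by
    have : x ≠ w + 1 := by omega
    simp [this, h.top i x hx]

theorem mI_upd (C : ℕ → ℕ → ℕ) (w : ℕ) (B' : ℕ → ℕ) (i x : ℕ) :
    mI (fun i x => if x = w + 1 then B' i else C i x) i x =
    if x = w then B' i - max (C i w) (B' (i + 1))
    else if x = w + 1 then C i (w + 2) - max (B' i) (C (i + 1) (w + 2))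
    else mI C i x := by
  unfold mI
  grind

theorem rowOf_congr (n : ℕ) (m m' : ℕ → ℕ) (h : ∀ x, x < n → m x = m' x) :
    rowOf n m = rowOf n m' := by
  apply eq_rowOf _ _ _ (rowOf_sorted _ _) (rowOf_mem _ _)
  intro x hx
  rw [rowOf_count, if_pos hx, h x hx]

theorem RD.fw_closed {n : ℕ} {lam mu : ℕ → ℕ} {C : ℕ → ℕ → ℕ} (h : RD n lam mu C) (w : ℕ)
    (hK : ∀ x, C (n + 1) x = 0) (hw : w + 2 ≤ n) (hc : 0 < cls (w + 1) (wd n C)) :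
    ∃ C', RD n lam mu C' ∧ wd n C' = fw (w + 1) (wd n C) ∧
      ∀ i, (rowW n C' i).length = (rowW n C i).length := by
  obtain ⟨u, z, hd, hf, hz, hu⟩ := fw_decomp _ _ hc
  obtain ⟨p, hp, l1, l2, e1, e2, e3⟩ := seg_split _ _ _ _ _ hd
  have hsort : (l1 ++ (w + 1) :: l2).Pairwise (· ≤ ·) := by
    rw [← e1]; exact rowOf_sorted _ _
  have hs1 : l1.Pairwise (· ≤ ·) := (List.pairwise_append.1 hsort).1
  have hs2 : l2.Pairwise (· ≤ ·) := (List.pairwise_cons.1 (List.pairwise_append.1 hsort).2.1).2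
  have c1 := cls_sorted (w + 1) l1 hs1
  have c2 := cls_sorted (w + 1) l2 hs2
  have hl1 : w + 2 ∉ l1 := fun hm => by
    have := (List.pairwise_append.1 hsort).2.2 _ hm (w + 1) (by simp)
    omega
  have hl1' : l1.count (w + 2) = 0 := List.count_eq_zero_of_not_mem hl1
  rw [e3, cls_append] at hz
  have hl2' : l2.count (w + 1) = 0 := by omega
  have hl2 : w + 1 ∉ l2 := List.count_eq_zero.1 hl2'
  rw [e2, opn_append] at hu
  have hcnt : ∀ x, x < n → (l1 ++ (w + 1) :: l2).count (x + 1) = mI C p x := by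
    intro x hx; rw [← e1, rowW, rowOf_count, if_pos hx]
  have hv := hcnt w (by omega)
  have hv1 := hcnt (w + 1) (by omega)
  simp only [List.count_append, List.count_cons, show w + 1 + 1 = w + 2 from rfl] at hv hv1 c1 c2
  simp at hv hv1
  have ob := h.opn_bound (n + 1) w hK hw (p + 1) (by omega)
  rw [show n + 1 - (p + 1) = n + 1 - p - 1 by omega] at ob
  set A : ℕ → ℕ := fun i => C i w with hA
  set Bf : ℕ → ℕ := fun i => C i (w + 1) with hB
  set D : ℕ → ℕ := fun i => C i (w + 2) with hD
  have mA : ∀ i, mI C i w = Bf i - max (A i) (Bf (i + 1)) := fun i => rfl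
  have mB : ∀ i, mI C i (w + 1) = D i - max (Bf i) (D (i + 1)) := fun i => rfl
  have AB : ∀ i, A i ≤ Bf i := fun i => h.mono i w
  have BD : ∀ i, Bf i ≤ D i := fun i => h.mono i (w + 1)
  have Ba : ∀ i, Bf (i + 1) ≤ Bf i := fun i => h.anti i (w + 1)
  have Da : ∀ i, D (i + 1) ≤ D i := fun i => h.anti i (w + 2)
  have ob' : D (p + 1) ≤ Bf (p + 1) + opn (w + 1) (seg (rowW n C) (p + 1) (n + 1 - p - 1)) := ob
  have mAp := mA p
  have mBp := mB p
  have ABp := AB p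
  have BDp := BD p
  have Bap := Ba p
  have Dap := Da p
  have alpha : D (p + 1) < Bf p := by omega
  set d : ℕ → ℕ := fun i => if i ≤ p ∧ ∀ l, i ≤ l → l < p → A l < Bf (l + 1) then 1 else 0 with hdd
  have dp : d p = 1 := by grind
  have dgt : ∀ i, p < i → d i = 0 := by grind
  have dstep : ∀ i, i < p → d i = if A i < Bf (i + 1) then d (i + 1) else 0 := by
    intro i hi
    simp only [hdd]
    by_cases ha : A i < Bf (i + 1)
    · rw [if_pos ha]
      congr 1
      grind
    · grind
  have dle : ∀ i, d i ≤ 1 := by intro i; simp only [hdd]; split_ifs <;> omega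
  have inv : ∀ k, k ≤ p → d (p - k) = 1 →
      Bf (p - k) + cls (w + 1) (seg (rowW n C) 0 (p - k)) ≤ D (p - k) ∧
      (0 < k → Bf (p - k) ≤ D (p - k + 1)) := by
    intro k
    induction k with
    | zero =>
      intro _ _
      refine ⟨?_, by omega⟩
      simp only [Nat.sub_zero]
      omega
    | succ k ih =>
      intro hk hd1
      have hi : p - k = p - (k + 1) + 1 := by omega
      set i := p - (k + 1) with hidef
      have ds := dstep i (by omega)
      rw [hd1] at ds
      have ha : A i < Bf (i + 1) := by grind
      rw [if_pos ha] at ds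
      rw [hi] at ih
      have ih' := (ih (by omega) ds.symm).1
      have hs := cls_sorted (w + 1) _ (rowOf_sorted n (mI C i))
      rw [rowOf_count, rowOf_count, if_pos (by omega), if_pos (by omega)] at hs
      rw [seg, Nat.zero_add, cls_append] at ih'
      unfold rowW at ih' ⊢
      rw [hs.1, hs.2] at ih'
      have := mA i
      have := mB i
      have := AB i
      have := BD i
      have := Ba i
      have := Da i
      omega
  have beta : ∀ i, i < p → d i = 1 → Bf i ≤ D (i + 1) := by
    intro i hi hd1
    have := (inv (p - i) (by omega) (by rw [show p - (p - i) = i by omega]; exact hd1)).2 (by omega)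
    rwa [show p - (p - i) = i by omega] at this
  set B' : ℕ → ℕ := fun i => Bf i - d i with hB'
  have dpos : ∀ i, d i = 1 → A i < Bf i := by
    intro i hd1
    rcases Nat.lt_trichotomy i p with h1 | h1 | h1
    · grind
    · grind
    · grind
  have hup := h.upd w hw B' (fun i => by
      have := AB i; have := dpos i; have := dle i
      show A i ≤ Bf i - d i
      omega) (fun i => by have := BD i; show Bf i - d i ≤ D i; omega) (fun i => by
      show Bf (i + 1) - d (i + 1) ≤ Bf i - d i
      have := Ba i
      have := dle i
      have := dle (i + 1)
      have := dpos i
      rcases Nat.lt_trichotomy i p with h1 | h1 | h1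
      · have ds := dstep i h1
        by_cases ha : A i < Bf (i + 1)
        · rw [if_pos ha] at ds; omega
        · omega
      · subst h1; omega
      · have := dgt i h1; omega)
  have hrow : ∀ i, i ≠ p → rowW n (fun i x => if x = w + 1 then B' i else C i x) i = rowW n C i := by
    intro i hip
    apply rowOf_congr
    intro x hx
    rw [mI_upd]
    have := Ba i
    have := AB i
    have := BD i
    have := dle i
    have := dle (i + 1)
    have := mA i
    have := mB i
    split_ifs with hx1 hx2
    · subst hx1
      show Bf i - d i - max (A i) (Bf (i + 1) - d (i + 1)) = _
      rcases Nat.lt_trichotomy i p with h1 | h1 | h1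
      · have ds := dstep i h1
        by_cases ha : A i < Bf (i + 1)
        · rw [if_pos ha] at ds; omega
        · rw [if_neg ha] at ds; omega
      · omega
      · have := dgt i h1; have := dgt (i + 1) (by omega); omega
    · subst hx2
      show D i - max (Bf i - d i) (D (i + 1)) = _
      rcases Nat.lt_trichotomy i p with h1 | h1 | h1
      · have := beta i h1
        omega
      · omega
      · have := dgt i h1; omega
    · rfl
  have hrowp : rowW n (fun i x => if x = w + 1 then B' i else C i x) p = l1 ++ (w + 1 + 1) :: l2 := by
    symm
    apply eq_rowOf
    · exact sorted_change_f _ _ _ hsort hl2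
    · intro x hx
      have hm : ∀ y ∈ l1 ++ (w + 1) :: l2, 1 ≤ y ∧ y ≤ n := by rw [← e1]; exact rowOf_mem _ _
      simp only [List.mem_append, List.mem_cons] at hx hm
      rcases hx with hx | hx | hx
      · grind
      · omega
      · grind
    · intro x hx
      have := count_change_f (w + 1) l1 l2 (x + 1)
      rw [hcnt x hx] at this
      rw [mI_upd]
      generalize List.count (x + 1) (l1 ++ (w + 1 + 1) :: l2) = qq at this ⊢
      have dp1 : d (p + 1) = 0 := dgt (p + 1) (by omega)
      split_ifs with hx1 hx2
      · subst hx1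
        show _ = Bf p - d p - max (A p) (Bf (p + 1) - d (p + 1))
        simp at this
        omega
      · subst hx2
        show _ = D p - max (Bf p - d p) (D (p + 1))
        simp at this
        omega
      · grind
  refine ⟨_, hup, ?_, ?_⟩
  · rw [hf, e2, e3, wd, seg_update _ _ (n + 1) p hp hrow, hrowp]
    simp
  · intro i
    by_cases hip : i = p
    · grind
    · grind

theorem RD.ew_closed {n : ℕ} {lam mu : ℕ → ℕ} {C : ℕ → ℕ → ℕ} (h : RD n lam mu C) (w : ℕ)
    (hK : ∀ x, C (n + 1) x = 0) (hw : w + 2 ≤ n) (hc : 0 < opn (w + 1) (wd n C)) :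
    ∃ C', RD n lam mu C' ∧ wd n C' = ew (w + 1) (wd n C) ∧
      ∀ i, (rowW n C' i).length = (rowW n C i).length := by
  obtain ⟨u, z, hd, hf, hz, hu⟩ := ew_decomp _ _ hc
  obtain ⟨p, hp, l1, l2, e1, e2, e3⟩ := seg_split _ _ _ _ _ hd
  have hsort : (l1 ++ (w + 1 + 1) :: l2).Pairwise (· ≤ ·) := by
    rw [← e1]; exact rowOf_sorted _ _
  have hs1 : l1.Pairwise (· ≤ ·) := (List.pairwise_append.1 hsort).1
  have hs2 : l2.Pairwise (· ≤ ·) := (List.pairwise_cons.1 (List.pairwise_append.1 hsort).2.1).2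
  have c1 := cls_sorted (w + 1) l1 hs1
  have c2 := cls_sorted (w + 1) l2 hs2
  rw [e3, cls_append] at hz
  rw [e2, opn_append] at hu
  have hl1' : l1.count (w + 2) = 0 := by grind
  have hl1 : w + 1 + 1 ∉ l1 := List.count_eq_zero.1 hl1'
  have hl2' : l2.count (w + 1) = 0 := by omega
  have hcnt : ∀ x, x < n → (l1 ++ (w + 1 + 1) :: l2).count (x + 1) = mI C p x := by
    intro x hx; rw [← e1, rowW, rowOf_count, if_pos hx]
  have hv := hcnt w (by omega)
  have hv1 := hcnt (w + 1) (by omega)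
  simp only [List.count_append, List.count_cons, show w + 1 + 1 = w + 2 from rfl] at hv hv1 c1 c2
  simp at hv hv1
  have ob := h.opn_bound (n + 1) w hK hw (p + 1) (by omega)
  rw [show n + 1 - (p + 1) = n + 1 - p - 1 by omega] at ob
  set A : ℕ → ℕ := fun i => C i w with hA
  set Bf : ℕ → ℕ := fun i => C i (w + 1) with hB
  set D : ℕ → ℕ := fun i => C i (w + 2) with hD
  have mA : ∀ i, mI C i w = Bf i - max (A i) (Bf (i + 1)) := fun i => rfl
  have mB : ∀ i, mI C i (w + 1) = D i - max (Bf i) (D (i + 1)) := fun i => rfl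
  have AB : ∀ i, A i ≤ Bf i := fun i => h.mono i w
  have BD : ∀ i, Bf i ≤ D i := fun i => h.mono i (w + 1)
  have Ba : ∀ i, Bf (i + 1) ≤ Bf i := fun i => h.anti i (w + 1)
  have Da : ∀ i, D (i + 1) ≤ D i := fun i => h.anti i (w + 2)
  have ob' : D (p + 1) ≤ Bf (p + 1) + opn (w + 1) (seg (rowW n C) (p + 1) (n + 1 - p - 1)) := ob
  have mAp := mA p
  have mBp := mB p
  have ABp := AB p
  have BDp := BD p
  have Bap := Ba p
  have Dap := Da p
  have alpha : D (p + 1) ≤ Bf p := by omega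
  set d : ℕ → ℕ := fun i => if i ≤ p ∧ ∀ l, i ≤ l → l < p → A l ≤ Bf (l + 1) then 1 else 0 with hdd
  have dp : d p = 1 := by grind
  have dgt : ∀ i, p < i → d i = 0 := by grind
  have dstep : ∀ i, i < p → d i = if A i ≤ Bf (i + 1) then d (i + 1) else 0 := by
    intro i hi
    simp only [hdd]
    by_cases ha : A i ≤ Bf (i + 1)
    · rw [if_pos ha]
      congr 1
      grind
    · grind
  have dle : ∀ i, d i ≤ 1 := by intro i; simp only [hdd]; split_ifs <;> omega
  have inv : ∀ k, k ≤ p → d (p - k) = 1 →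
      Bf (p - k) + 1 + cls (w + 1) (seg (rowW n C) 0 (p - k)) ≤ D (p - k) ∧
      (0 < k → Bf (p - k) + 1 ≤ D (p - k + 1)) := by
    intro k
    induction k with
    | zero =>
      intro _ _
      refine ⟨?_, by omega⟩
      simp only [Nat.sub_zero]
      omega
    | succ k ih =>
      intro hk hd1
      have hi : p - k = p - (k + 1) + 1 := by omega
      set i := p - (k + 1) with hidef
      have ds := dstep i (by omega)
      rw [hd1] at ds
      have ha : A i ≤ Bf (i + 1) := by grind
      rw [if_pos ha] at ds
      rw [hi] at ih
      have ih' := (ih (by omega) ds.symm).1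
      have hs := cls_sorted (w + 1) _ (rowOf_sorted n (mI C i))
      rw [rowOf_count, rowOf_count, if_pos (by omega), if_pos (by omega)] at hs
      rw [seg, Nat.zero_add, cls_append] at ih'
      unfold rowW at ih' ⊢
      rw [hs.1, hs.2] at ih'
      have := mA i
      have := mB i
      have := AB i
      have := BD i
      have := Ba i
      have := Da i
      omega
  have beta : ∀ i, i < p → d i = 1 → Bf i + 1 ≤ D (i + 1) := by
    intro i hi hd1
    have := (inv (p - i) (by omega) (by rw [show p - (p - i) = i by omega]; exact hd1)).2 (by omega)
    rwa [show p - (p - i) = i by omega] at this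
  set B' : ℕ → ℕ := fun i => Bf i + d i with hB'
  have dpos : ∀ i, d i = 1 → Bf i < D i := by
    intro i hd1
    rcases Nat.lt_trichotomy i p with h1 | h1 | h1
    · grind
    · subst h1; omega
    · grind
  have hup := h.upd w hw B' (fun i => by
      grind) (fun i => by
      have := BD i; have := dpos i; have := dle i; show Bf i + d i ≤ D i; omega) (fun i => by
      show Bf (i + 1) + d (i + 1) ≤ Bf i + d i
      have := Ba i
      have := AB i
      have := dle i
      have := dle (i + 1)
      rcases Nat.lt_trichotomy i p with h1 | h1 | h1
      · have ds := dstep i h1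
        by_cases ha : A i ≤ Bf (i + 1)
        · rw [if_pos ha] at ds; omega
        · rw [if_neg ha] at ds; omega
      · subst h1; have := dgt (i + 1) (by omega); omega
      · have := dgt (i + 1) (by omega); omega)
  have hrow : ∀ i, i ≠ p → rowW n (fun i x => if x = w + 1 then B' i else C i x) i = rowW n C i := by
    intro i hip
    apply rowOf_congr
    intro x hx
    rw [mI_upd]
    have := Ba i
    have := AB i
    have := BD i
    have := dle i
    have := dle (i + 1)
    have := mA i
    have := mB i
    split_ifs with hx1 hx2
    · subst hx1
      show Bf i + d i - max (A i) (Bf (i + 1) + d (i + 1)) = _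
      rcases Nat.lt_trichotomy i p with h1 | h1 | h1
      · have ds := dstep i h1
        by_cases ha : A i ≤ Bf (i + 1)
        · rw [if_pos ha] at ds; omega
        · rw [if_neg ha] at ds; omega
      · omega
      · have := dgt i h1; have := dgt (i + 1) (by omega); omega
    · subst hx2
      show D i - max (Bf i + d i) (D (i + 1)) = _
      rcases Nat.lt_trichotomy i p with h1 | h1 | h1
      · have := beta i h1
        omega
      · omega
      · have := dgt i h1; omega
    · rfl
  have hrowp : rowW n (fun i x => if x = w + 1 then B' i else C i x) p = l1 ++ (w + 1) :: l2 := by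
    symm
    apply eq_rowOf
    · exact sorted_change_e _ _ _ hsort hl1
    · intro x hx
      have hm : ∀ y ∈ l1 ++ (w + 1 + 1) :: l2, 1 ≤ y ∧ y ≤ n := by rw [← e1]; exact rowOf_mem _ _
      simp only [List.mem_append, List.mem_cons] at hx hm
      rcases hx with hx | hx | hx
      · grind
      · omega
      · grind
    · intro x hx
      have := count_change_f (w + 1) l1 l2 (x + 1)
      rw [hcnt x hx] at this
      rw [mI_upd]
      generalize List.count (x + 1) (l1 ++ (w + 1) :: l2) = qq at this ⊢
      have dp1 : d (p + 1) = 0 := dgt (p + 1) (by omega)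
      split_ifs with hx1 hx2
      · subst hx1
        show _ = Bf p + d p - max (A p) (Bf (p + 1) + d (p + 1))
        simp at this
        omega
      · subst hx2
        show _ = D p - max (Bf p + d p) (D (p + 1))
        simp at this
        omega
      · grind
  refine ⟨_, hup, ?_, ?_⟩
  · rw [hf, e2, e3, wd, seg_update _ _ (n + 1) p hp hrow, hrowp]
    simp
  · intro i
    by_cases hip : i = p
    · grind
    · grind

abbrev Dat := ℕ → ℕ → ℕ

structure TD (n : ℕ) (C : Dat) : Prop where
  rd : RD n (fun i => C i n) (fun _ => 0) C
  len : ∀ i, (rowW n C i).length = C i n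

theorem tele (f : ℕ → ℕ) (h : ∀ x, f x ≤ f (x + 1)) (n : ℕ) :
    ∑ x ∈ range n, (f (x + 1) - f x) + f 0 = f n := by
  induction n with
  | zero => simp
  | succ n ih => rw [sum_range_succ]; have := h n; omega

theorem TD.strict {n : ℕ} {C : Dat} (h : TD n C) (i x : ℕ) : C (i + 1) (x + 1) ≤ C i x := by
  by_cases hx : x < n
  · have h1 := h.len i
    rw [rowW, rowOf_length] at h1
    have h2 := tele (C i) (h.rd.mono i) n
    rw [h.rd.zero i] at h2
    have h3 : ∀ y ∈ range n, mI C i y ≤ C i (y + 1) - C i y := by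
      intro y _; simp only [mI]; omega
    have h4 : ∑ y ∈ range n, mI C i y = ∑ y ∈ range n, (C i (y + 1) - C i y) := by omega
    have h5 := (sum_eq_sum_iff_of_le h3).1 h4 x (mem_range.2 hx)
    have := h.rd.mono i x
    have := h.rd.anti i (x + 1)
    simp only [mI] at h5; omega
  · have h1 := h.rd.top i x (by omega)
    have h2 := h.rd.top (i + 1) (x + 1) (by omega)
    have h3 := h.rd.anti i n
    omega

theorem TD.of_strict {n : ℕ} {C : Dat} (h : RD n (fun i => C i n) (fun _ => 0) C)
    (hs : ∀ i x, x < n → C (i + 1) (x + 1) ≤ C i x) : TD n C := by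
  refine ⟨h, fun i => ?_⟩
  rw [rowW, rowOf_length]
  have h2 := tele (C i) (h.mono i) n
  rw [h.zero i] at h2
  rw [← h2, add_zero]
  apply sum_congr rfl
  intro x hx
  have := hs i x (mem_range.1 hx)
  simp only [mI]; omega

theorem TD.low {n : ℕ} {C : Dat} (h : TD n C) : ∀ x i, x ≤ i → C i x = 0 := by
  intro x
  induction x with
  | zero => intro i _; exact h.rd.zero i
  | succ x ih =>
    intro i hi
    obtain ⟨j, rfl⟩ : ∃ j, i = j + 1 := ⟨i - 1, by omega⟩
    have := h.strict j x
    grind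

theorem TD.hK {n : ℕ} {C : Dat} (h : TD n C) (x : ℕ) : C (n + 1) x = 0 := by
  have := h.rd.le_lam (n + 1) x
  simp only [h.low n (n + 1) (by omega)] at this
  omega

theorem RD.inj {n : ℕ} {lam mu : ℕ → ℕ} {C C' : Dat} (h : RD n lam mu C) (h' : RD n lam mu C')
    (hl : ∀ i, n + 1 ≤ i → lam i = 0)
    (hw : wd n C = wd n C') (hlen : ∀ i, (rowW n C i).length = (rowW n C' i).length) : C = C' := by
  have hr := seg_inj _ _ _ (fun i _ => hlen i) hw
  have key : ∀ d i, n + 1 ≤ i + d → ∀ x, C i x = C' i x := by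
    intro d
    induction d with
    | zero =>
      intro i hi x
      have h1 := h.le_lam i x
      have h2 := h'.le_lam i x
      grind
    | succ d ih =>
      intro i hi x
      by_cases hi' : n + 1 ≤ i + d
      · grind
      induction x with
      | zero => rw [h.zero, h'.zero]
      | succ x ihx =>
        by_cases hx : x < n
        · rw [mI_eq h, mI_eq h', ihx, ih (i + 1) (by omega)]
          have := hr i (by omega)
          have h3 := rowOf_count n (mI C i) x
          have h4 := rowOf_count n (mI C' i) x
          simp only [rowW] at this
          grind
        · rw [h.top _ _ (by omega), h'.top _ _ (by omega)]
  funext i x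
  exact key (n + 1) i (by omega) x

theorem TD.inj {n : ℕ} {C C' : Dat} (h : TD n C) (h' : TD n C') (hw : wd n C = wd n C')
    (hs : ∀ i, C i n = C' i n) : C = C' := by
  have e : (fun i => C i n) = (fun i => C' i n) := funext hs
  have hr' := h'.rd
  rw [← e] at hr'
  apply RD.inj h.rd hr' _ hw
  · intro i; rw [h.len, h'.len, hs]
  · intro i hi; exact h.low n i (by omega)

theorem TD.fw {n : ℕ} {C : Dat} (h : TD n C) (w : ℕ) (hw : w + 2 ≤ n)
    (hc : 0 < cls (w + 1) (wd n C)) :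
    ∃ C', TD n C' ∧ wd n C' = SkewG.fw (w + 1) (wd n C) ∧ ∀ i, C' i n = C i n := by
  obtain ⟨C', h1, h2, h3⟩ := h.rd.fw_closed w h.hK hw hc
  have e : ∀ i, C' i n = C i n := fun i => h1.top i n le_rfl
  refine ⟨C', ⟨?_, ?_⟩, h2, e⟩
  · grind
  · intro i; rw [h3, e, h.len]

theorem TD.ew {n : ℕ} {C : Dat} (h : TD n C) (w : ℕ) (hw : w + 2 ≤ n)
    (hc : 0 < opn (w + 1) (wd n C)) :
    ∃ C', TD n C' ∧ wd n C' = SkewG.ew (w + 1) (wd n C) ∧ ∀ i, C' i n = C i n := by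
  obtain ⟨C', h1, h2, h3⟩ := h.rd.ew_closed w h.hK hw hc
  have e : ∀ i, C' i n = C i n := fun i => h1.top i n le_rfl
  refine ⟨C', ⟨?_, ?_⟩, h2, e⟩
  · grind
  · intro i; rw [h3, e, h.len]

def Hd (ν : ℕ → ℕ) : Dat := fun i x => if i < x then ν i else 0

theorem Hd_TD (n : ℕ) (ν : ℕ → ℕ) (h1 : ∀ i, ν (i + 1) ≤ ν i) (h2 : ∀ i, n ≤ i → ν i = 0) :
    TD n (Hd ν) ∧ ∀ i, Hd ν i n = ν i := by
  have e : ∀ i, Hd ν i n = ν i := by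
    intro i; simp only [Hd]; split_ifs with h
    · rfl
    · grind
  refine ⟨TD.of_strict ⟨?_, ?_, ?_, ?_⟩ ?_, e⟩
  · intro i; simp [Hd]
  · intro i x; simp only [Hd]; split_ifs <;> omega
  · intro i x; have := h1 i; simp only [Hd]; split_ifs <;> omega
  · intro i x hx; show Hd ν i x = Hd ν i n; rw [e]; simp only [Hd]; split_ifs
    · rfl
    · grind
  · intro i x _; have := h1 i; simp only [Hd]; split_ifs <;> omega

theorem wd_mem {n : ℕ} {C : Dat} {x : ℕ} (h : x ∈ wd n C) : 1 ≤ x ∧ x ≤ n := by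
  obtain ⟨i, hi⟩ := seg_mem _ _ _ _ h
  exact rowOf_mem _ _ _ hi

theorem TD.row_low {n : ℕ} {C : Dat} (h : TD n C) (i a : ℕ) (ha : a ∈ rowW n C i) : i + 1 ≤ a := by
  by_contra hc
  have hm := rowOf_mem _ _ _ ha
  obtain ⟨b, rfl⟩ : ∃ b, a = b + 1 := ⟨a - 1, by omega⟩
  have h1 := rowOf_count n (mI C i) b
  have h2 := List.count_pos_iff.2 ha
  rw [rowW, h1, if_pos (by omega), mI, h.low (b + 1) i (by omega)] at h2
  omega

theorem wd_row_suffix (n : ℕ) (C : Dat) (i : ℕ) (hi : i < n + 1) (v : ℕ)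
    (h : opn v (wd n C) = 0) : opn v (rowW n C i ++ seg (rowW n C) 0 i) = 0 := by
  rw [wd, seg_one _ i _ hi, List.append_assoc] at h
  have := opn_append_le v (seg (rowW n C) (i + 1) (n + 1 - i - 1)) (rowW n C i ++ seg (rowW n C) 0 i)
  omega

theorem TD.yam_row {n : ℕ} {C : Dat} (h : TD n C) (hy : ∀ v, opn (v + 1) (wd n C) = 0) :
    ∀ i, i < n + 1 → ∀ a ∈ rowW n C i, a = i + 1 := by
  intro i
  induction i using Nat.strong_induction_on with
  | _ i ih =>
    intro hi a ha
    have hl := h.row_low i a ha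
    by_contra hne
    obtain ⟨v, rfl⟩ : ∃ v, a = v + 1 + 1 := ⟨a - 2, by omega⟩
    have h1 := wd_row_suffix n C i hi (v + 1) (hy v)
    have hnm : v + 1 ∉ seg (rowW n C) 0 i := by
      intro hm
      have : ∀ d, d ≤ i → v + 1 ∈ seg (rowW n C) 0 d → False := by
        intro d
        induction d with
        | zero => intro _ h; simp [seg] at h
        | succ d ihd =>
          intro hd h
          simp only [seg, List.mem_append] at h
          grind
      grind
    have hc := (cls_sorted (v + 1) (rowW n C i) (rowOf_sorted n (mI C i))).2
    rw [opn_append, cls_zero_of_not_mem _ _ hnm, hc] at h1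
    grind

theorem TD.yam {n : ℕ} {C : Dat} (h : TD n C) (hy : ∀ v, opn (v + 1) (wd n C) = 0) :
    C = Hd (fun i => C i n) := by
  have hst : ∀ i, i < n + 1 → C i (i + 1) = C i n := by
    intro i hi
    have key : ∀ x, i + 1 ≤ x → C i x = C i (i + 1) := by
      intro x hx
      induction x, hx using Nat.le_induction with
      | base => rfl
      | succ x hx ihx =>
        by_cases hxn : x < n
        · rw [← ihx]
          have h1 := rowOf_count n (mI C i) x
          rw [if_pos hxn] at h1
          have h2 : List.count (x + 1) (rowOf n (mI C i)) = 0 := by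
            apply List.count_eq_zero_of_not_mem
            intro hm
            have := h.yam_row hy i hi _ hm
            omega
          have h3 := h.strict i x
          have h4 := h.rd.mono i x
          simp only [mI] at h1; omega
        · rw [h.rd.top i (x + 1) (by omega), ← ihx, h.rd.top i x (by omega)]
    by_cases hin : i + 1 ≤ n
    · grind
    · exact h.rd.top i _ (by omega)
  funext i x
  simp only [Hd]
  split_ifs with hx
  · by_cases hi : i < n + 1
    · apply le_antisymm (h.rd.le_lam i x)
      show C i n ≤ _
      rw [← hst i hi]; exact h.rd.mono' i (by omega)
    · have := h.rd.le_lam i x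
      have e := h.low n i (by omega)
      omega
  · exact h.low x i (by omega)

theorem TD.count_highest {n : ℕ} (ν : ℕ → ℕ) (h1 : ∀ i, ν (i + 1) ≤ ν i) (h2 : ∀ i, n ≤ i → ν i = 0)
    (v : ℕ) : (wd n (Hd ν)).count (v + 1) = ν v := by
  have hrow : ∀ i, (rowW n (Hd ν) i).count (v + 1) = if i = v then ν v else 0 := by
    intro i
    rw [rowW, rowOf_count]
    by_cases hiv : i = v
    · subst hiv
      have := h1 i
      simp [mI, Hd]
      grind
    · rw [if_neg hiv]
      split_ifs with hv
      · have := h1 i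
        simp only [mI, Hd]
        grind
      · rfl
  rw [wd, seg_count, sum_congr rfl (fun i _ => hrow i)]
  rw [sum_ite_eq' ]
  grind

theorem Hd_yam (n : ℕ) (ν : ℕ → ℕ) (h1 : ∀ i, ν (i + 1) ≤ ν i) (h2 : ∀ i, n ≤ i → ν i = 0)
    (v : ℕ) : opn (v + 1) (wd n (Hd ν)) = 0 := by
  have hrow : ∀ i, rowW n (Hd ν) i = List.replicate (ν i) (i + 1) := by
    intro i
    symm
    apply eq_rowOf
    · grind
    · grind
    · intro x hx
      rw [List.count_replicate]
      have := h1 i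
      simp only [mI, Hd]
      grind
  have key : ∀ d, opn (v + 1) (seg (rowW n (Hd ν)) 0 d) = 0 ∧
      cls (v + 1) (seg (rowW n (Hd ν)) 0 d) =
        if d ≤ v then 0 else if d = v + 1 then ν v else ν v - ν (v + 1) := by
    intro d
    induction d with
    | zero => simp [seg, opn, cls]
    | succ d ih =>
      have hs := cls_sorted (v + 1) _ (rowOf_sorted n (mI (Hd ν) d))
      simp only [seg, zero_add, opn_append, cls_append]
      have hr := hrow d
      rw [rowW] at hr ⊢
      grind
  exact (key _).1

theorem TD.uniq {n : ℕ} : ∀ (m : ℕ) (C C' : Dat), TD n C → TD n C' → (wd n C).sum = m →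
    KnuthEquiv (wd n C) (wd n C') → C = C' := by
  intro m
  induction m using Nat.strong_induction_on with
  | _ m ih =>
    intro C C' h h' hm hk
    by_cases hy : ∀ v, opn (v + 1) (wd n C) = 0
    · have hy' : ∀ v, opn (v + 1) (wd n C') = 0 := by
        intro v; rw [← (kgood_of_equiv (v + 1) hk).2.1]; exact hy v
      have e := h.yam hy
      have e' := h'.yam hy'
      have : (fun i => C i n) = (fun i => C' i n) := by
        funext v
        have c1 := TD.count_highest (n := n) (fun i => C i n) (fun i => h.rd.anti i n) (fun i hi => h.low n i hi) v
        have c2 := TD.count_highest (n := n) (fun i => C' i n) (fun i => h'.rd.anti i n) (fun i hi => h'.low n i hi) v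
        rw [← e] at c1
        rw [← e'] at c2
        have := (knuth_perm hk).count_eq (v + 1)
        omega
      grind
    · push Not at hy
      obtain ⟨v, hv⟩ := hy
      have hv : 0 < opn (v + 1) (wd n C) := by omega
      have hg := kgood_of_equiv (v + 1) hk
      have hv' : 0 < opn (v + 1) (wd n C') := by rw [← hg.2.1]; exact hv
      have hvn : v + 2 ≤ n := (wd_mem (opn_pos_mem _ _ hv)).2
      obtain ⟨D, d1, d2, d3⟩ := h.ew v hvn hv
      obtain ⟨D', d1', d2', d3'⟩ := h'.ew v hvn hv'
      have hs := sum_ew _ _ hv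
      have : D = D' := by
        apply ih ((wd n D).sum) (by rw [d2]; omega) D D' d1 d1' rfl
        rw [d2, d2']; exact hg.2.2.2 hv
      subst this
      apply TD.inj h h'
      · rw [← fw_ew _ _ hv, ← d2, d2', fw_ew _ _ hv']
      · grind

theorem box_finite (n N : ℕ) : {C : Dat | (∀ i x, C i x ≤ N) ∧ (∀ i x, n + 1 ≤ i → C i x = 0) ∧
    (∀ i x, n ≤ x → C i x = C i n)}.Finite := by
  let φ : Dat → (Fin (n + 1) → Fin (n + 1) → ℕ) := fun C i x => C i x
  have hφ : Set.InjOn φ {C : Dat | (∀ i x, C i x ≤ N) ∧ (∀ i x, n + 1 ≤ i → C i x = 0) ∧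
    (∀ i x, n ≤ x → C i x = C i n)} := by
    intro C hC C' hC' h
    funext i x
    by_cases hi : n + 1 ≤ i
    · grind
    · by_cases hx : n ≤ x
      · rw [hC.2.2 i x hx, hC'.2.2 i x hx]
        exact congrFun (congrFun h ⟨i, by omega⟩) ⟨n, by omega⟩
      · exact congrFun (congrFun h ⟨i, by omega⟩) ⟨x, by omega⟩
  apply Set.Finite.of_finite_image _ hφ
  apply Set.Finite.subset (s := Set.pi Set.univ (fun _ => Set.pi Set.univ (fun _ => Set.Iic N)))
  · simp_all
  · grind

theorem TDs_fin (n N : ℕ) : {C : Dat | TD n C ∧ C 0 n ≤ N}.Finite := by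
  apply (box_finite n N).subset
  rintro C ⟨h, hN⟩
  have hanti : ∀ i, C i n ≤ C 0 n := by
    intro i
    induction i with
    | zero => exact le_rfl
    | succ i ih => exact (h.rd.anti i n).trans ih
  refine ⟨fun i x => ?_, fun i x hi => ?_, fun i x hx => ?_⟩
  · exact (h.rd.le_lam i x).trans ((hanti i).trans hN)
  · have := h.rd.le_lam i x
    have e := h.low n i (by omega)
    omega
  · exact h.rd.top i x hx

def TDs (n N : ℕ) : Finset Dat := (TDs_fin n N).toFinset

theorem mem_TDs {n N : ℕ} {C : Dat} : C ∈ TDs n N ↔ TD n C ∧ C 0 n ≤ N := by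
  simp [TDs]

def HasRect (n : ℕ) : Prop := ∀ w : List ℕ, (∀ a ∈ w, 1 ≤ a ∧ a ≤ n) →
  ∃ P, TD n P ∧ KnuthEquiv (wd n P) w

theorem TD.total {n : ℕ} {C : Dat} (h : TD n C) :
    (wd n C).length = ∑ i ∈ range (n + 1), C i n := by
  rw [wd, seg_length]
  exact sum_congr rfl (fun i _ => h.len i)

theorem TD.row0_le {n : ℕ} {C : Dat} (h : TD n C) : C 0 n ≤ (wd n C).length := by
  rw [h.total]
  exact single_le_sum (f := fun i => C i n) (fun _ _ => Nat.zero_le _) (by simp)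

structure Crys {ι κ : Type*} (n N : ℕ) (X : Finset ι) (word : ι → List ℕ) (tag : ι → κ) : Prop where
  inj : ∀ x ∈ X, ∀ y ∈ X, word x = word y → tag x = tag y → x = y
  hf : ∀ w, w + 2 ≤ n → ∀ x ∈ X, 0 < cls (w + 1) (word x) →
    ∃ y ∈ X, word y = fw (w + 1) (word x) ∧ tag y = tag x
  he : ∀ w, w + 2 ≤ n → ∀ x ∈ X, 0 < opn (w + 1) (word x) →
    ∃ y ∈ X, word y = ew (w + 1) (word x) ∧ tag y = tag x
  lett : ∀ x ∈ X, ∀ a ∈ word x, 1 ≤ a ∧ a ≤ n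
  len : ∀ x ∈ X, (word x).length ≤ N

theorem Crys.zconst {ι κ A : Type*} [AddCommMonoid A] {n N : ℕ} {X : Finset ι} {word : ι → List ℕ}
    {tag : ι → κ} (h : Crys n N X word tag) (τ : κ → A) :
    ∀ (m : ℕ) (Q : Dat), TD n Q → (wd n Q).sum = m →
    ∑ x ∈ X.filter (fun x => KnuthEquiv (word x) (wd n Q)), τ (tag x) =
    ∑ x ∈ X.filter (fun x => KnuthEquiv (word x) (wd n (Hd (fun i => Q i n)))), τ (tag x) := by
  intro m
  induction m using Nat.strong_induction_on with
  | _ m ih =>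
    intro Q hQ hm
    by_cases hy : ∀ v, opn (v + 1) (wd n Q) = 0
    · rw [← hQ.yam hy]
    · push Not at hy
      obtain ⟨v, hv⟩ := hy
      have hv : 0 < opn (v + 1) (wd n Q) := by omega
      have hvn : v + 2 ≤ n := (wd_mem (opn_pos_mem _ _ hv)).2
      obtain ⟨D, d1, d2, d3⟩ := hQ.ew v hvn hv
      have hs := sum_ew _ _ hv
      have e := zlemma_step X word tag τ (v + 1) h.inj (h.hf v hvn) (h.he v hvn) (wd n Q) hv
      rw [e, ← d2, ih (wd n D).sum (by rw [d2]; omega) D d1 rfl]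
      simp_all

theorem Crys.group {ι κ A : Type*} [AddCommMonoid A] {n N : ℕ} {X : Finset ι} {word : ι → List ℕ}
    {tag : ι → κ} (hR : HasRect n) (h : Crys n N X word tag) (f : ι → A) :
    ∑ x ∈ X, f x = ∑ Q ∈ TDs n N, ∑ x ∈ X.filter (fun x => KnuthEquiv (word x) (wd n Q)), f x := by
  simp only [sum_filter]
  rw [sum_comm]
  apply sum_congr rfl
  intro x hx
  obtain ⟨P, hP, hk⟩ := hR (word x) (h.lett x hx)
  rw [sum_eq_single P]
  · rw [if_pos (knuth_symm hk)]
  · intro Q hQ hne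
    rw [if_neg]
    intro hk'
    exact hne (TD.uniq _ Q P (mem_TDs.1 hQ).1 hP rfl (knuth_trans (knuth_symm hk') (knuth_symm hk)))
  · intro hn
    exfalso
    apply hn
    rw [mem_TDs]
    refine ⟨hP, hP.row0_le.trans ?_⟩
    rw [(knuth_perm hk).length_eq]
    exact h.len x hx

theorem equiv_highest_iff {n : ℕ} (hR : HasRect n) (ν : ℕ → ℕ) (h1 : ∀ i, ν (i + 1) ≤ ν i)
    (h2 : ∀ i, n ≤ i → ν i = 0) (w : List ℕ) (hw : ∀ a ∈ w, 1 ≤ a ∧ a ≤ n) :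
    KnuthEquiv w (wd n (Hd ν)) ↔ ((∀ v, opn (v + 1) w = 0) ∧ ∀ v, w.count (v + 1) = ν v) := by
  constructor
  · intro hk
    refine ⟨fun v => ?_, fun v => ?_⟩
    · rw [(kgood_of_equiv (v + 1) hk).2.1, Hd_yam n ν h1 h2]
    · rw [(knuth_perm hk).count_eq, TD.count_highest ν h1 h2]
  · rintro ⟨hy, hc⟩
    obtain ⟨P, hP, hk⟩ := hR w hw
    have e := hP.yam (fun v => by rw [(kgood_of_equiv (v + 1) hk).2.1, hy])
    have : (fun i => P i n) = ν := by
      funext v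
      have c1 := TD.count_highest (n := n) (fun i => P i n) (fun i => hP.rd.anti i n) (fun i hi => hP.low n i hi) v
      rw [← e, (knuth_perm hk).count_eq, hc] at c1
      omega
    rw [this] at e
    rw [← e]; exact knuth_symm hk

theorem rowOf_change_f (n w : ℕ) (m m' : ℕ → ℕ) (l1 l2 : List ℕ) (hw : w + 2 ≤ n)
    (h : rowOf n m = l1 ++ (w + 1) :: l2) (hv : w + 1 ∉ l2)
    (h1 : m' w + 1 = m w) (h2 : m' (w + 1) = m (w + 1) + 1)
    (h3 : ∀ x, x < n → x ≠ w → x ≠ w + 1 → m' x = m x) :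
    rowOf n m' = l1 ++ (w + 1 + 1) :: l2 := by
  symm
  have hs := rowOf_sorted n m
  rw [h] at hs
  have hm : ∀ y ∈ l1 ++ (w + 1) :: l2, 1 ≤ y ∧ y ≤ n := by rw [← h]; exact rowOf_mem _ _
  apply eq_rowOf _ _ _ (sorted_change_f _ _ _ hs hv)
  · grind
  · intro x hx
    have hc := count_change_f (w + 1) l1 l2 (x + 1)
    have hr := rowOf_count n m x
    grind

theorem rowOf_change_e (n w : ℕ) (m m' : ℕ → ℕ) (l1 l2 : List ℕ) (hw : w + 2 ≤ n)
    (h : rowOf n m = l1 ++ (w + 1 + 1) :: l2) (hv : w + 1 + 1 ∉ l1)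
    (h1 : m' w = m w + 1) (h2 : m' (w + 1) + 1 = m (w + 1))
    (h3 : ∀ x, x < n → x ≠ w → x ≠ w + 1 → m' x = m x) :
    rowOf n m' = l1 ++ (w + 1) :: l2 := by
  symm
  have hs := rowOf_sorted n m
  rw [h] at hs
  have hm : ∀ y ∈ l1 ++ (w + 1 + 1) :: l2, 1 ≤ y ∧ y ≤ n := by rw [← h]; exact rowOf_mem _ _
  apply eq_rowOf _ _ _ (sorted_change_e _ _ _ hs hv)
  · grind
  · intro x hx
    have hc := count_change_f (w + 1) l1 l2 (x + 1)
    have hr := rowOf_count n m x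
    grind

structure SD (n : ℕ) (s e : Dat) : Prop where
  zero : ∀ i, s i 0 = 0
  mono : ∀ i x, s i x ≤ s i (x + 1)
  top : ∀ i x, n ≤ x → s i x = s i n
  e1 : ∀ i x, e i x ≤ 1
  e0 : ∀ i, e i 0 = 0
  etop : ∀ i x, n ≤ x → e i x = e i n
  strict : ∀ i x, x < n → s (i + 1) (x + 1) + e i (x + 1) ≤ s i x

def mS (s : Dat) (i x : ℕ) : ℕ := s i (x + 1) - s i x
def mE (e : Dat) (i x : ℕ) : ℕ := e i (x + 1)
def rowE (n : ℕ) (e : Dat) (i : ℕ) : List ℕ := (rowOf n (mE e i)).reverse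
def rowM (n : ℕ) (s : Dat) (i : ℕ) : List ℕ := rowOf n (mS s i)
def rowS (n : ℕ) (p : Dat × Dat) (i : ℕ) : List ℕ := rowE n p.2 i ++ rowM n p.1 i
def ws (n : ℕ) (p : Dat × Dat) : List ℕ := seg (rowS n p) 0 (n + 1)

theorem SD.low {n : ℕ} {s e : Dat} (h : SD n s e) : ∀ x i, x ≤ n → x ≤ i → s i x = 0 := by
  intro x
  induction x with
  | zero => intro i _ _; exact h.zero i
  | succ x ih =>
    intro i hn hi
    obtain ⟨j, rfl⟩ : ∃ j, i = j + 1 := ⟨i - 1, by omega⟩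
    have := h.strict j x (by omega)
    grind

theorem SD.row0 {n : ℕ} {s e : Dat} (h : SD n s e) (i : ℕ) (hi : n ≤ i) (x : ℕ) : s i x = 0 := by
  have h1 := monotone_nat_of_le_succ (h.mono i) (le_max_left x n)
  rw [h.top i _ (le_max_right x n), h.low n i le_rfl hi] at h1
  omega

theorem SD.rowe0 {n : ℕ} {s e : Dat} (h : SD n s e) (i : ℕ) (hi : n ≤ i) (x : ℕ) : e i x = 0 := by
  have key : ∀ y, y ≤ n → e i y = 0 := by
    intro y hy
    rcases Nat.eq_zero_or_pos y with rfl | hp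
    · exact h.e0 i
    · have := h.strict i (y - 1) (by omega)
      rw [h.row0 i hi, Nat.sub_add_cancel hp] at this
      omega
  rcases le_total x n with hx | hx
  · grind
  · rw [h.etop i x hx]; exact key n le_rfl

theorem rowM_length {n : ℕ} {s e : Dat} (h : SD n s e) (i : ℕ) : (rowM n s i).length = s i n := by
  rw [rowM, rowOf_length]
  have := tele (s i) (h.mono i) n
  rw [h.zero] at this
  exact this

theorem rowM_cls (n : ℕ) (s : Dat) (i w : ℕ) (hw : w + 2 ≤ n) :
    cls (w + 1) (rowM n s i) = s i (w + 1) - s i w ∧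
    opn (w + 1) (rowM n s i) = s i (w + 2) - s i (w + 1) := by
  have hs := cls_sorted (w + 1) _ (rowOf_sorted n (mS s i))
  rw [rowOf_count, rowOf_count, if_pos (by omega), if_pos (by omega)] at hs
  exact hs

theorem rowE_desc {n : ℕ} {s e : Dat} (h : SD n s e) (i : ℕ) : (rowE n e i).Pairwise (· > ·) := by
  rw [rowE, List.pairwise_reverse]
  have h1 := rowOf_sorted n (mE e i)
  have h2 : (rowOf n (mE e i)).Nodup := by
    rw [List.nodup_iff_count_le_one]
    intro a
    rcases a with _ | a
    · rw [rowOf_count_zero]; omega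
    · rw [rowOf_count]; split_ifs
      · exact h.e1 _ _
      · omega
  exact (h1.and h2).imp (fun hab => by have := hab.1; have := hab.2; omega)

theorem rowE_cls {n : ℕ} {s e : Dat} (h : SD n s e) (i w : ℕ) (hw : w + 2 ≤ n) :
    cls (w + 1) (rowE n e i) = e i (w + 1) - e i (w + 2) ∧
    opn (w + 1) (rowE n e i) = e i (w + 2) - e i (w + 1) := by
  have hs := cls_desc (w + 1) _ (rowE_desc h i)
  have h1 : (rowE n e i).count (w + 1) = e i (w + 1) := by
    rw [rowE, List.count_reverse, rowOf_count, if_pos (by omega)]; rfl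
  have h2 : (rowE n e i).count (w + 1 + 1) = e i (w + 2) := by
    rw [rowE, List.count_reverse, rowOf_count, if_pos (by omega)]; rfl
  omega

theorem SD.updE {n : ℕ} {s e : Dat} (h : SD n s e) (p w a b : ℕ) (hw : w + 2 ≤ n)
    (ha : a ≤ 1) (hb : b ≤ 1) (h1 : s (p + 1) (w + 1) + a ≤ s p w)
    (h2 : s (p + 1) (w + 2) + b ≤ s p (w + 1)) :
    SD n s (fun i x => if i = p then (if x = w + 1 then a else if min x n = w + 2 then b else e i x)
      else e i x) where
  zero := h.zero
  mono := h.mono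
  top := h.top
  e1 i x := by have := h.e1 i x; split_ifs <;> omega
  e0 i := by
    have := h.e0 i
    grind
  etop i x hx := by
    have := h.etop i x hx
    grind
  strict i x hx := by
    have := h.strict i x hx
    grind

theorem SD.updS {n : ℕ} {s e : Dat} (h : SD n s e) (p w b : ℕ) (hw : w + 2 ≤ n)
    (h1 : s p w ≤ b) (h2 : b ≤ s p (w + 2)) (h3 : s (p + 1) (w + 2) + e p (w + 2) ≤ b)
    (h4 : ∀ q, p = q + 1 → b + e q (w + 1) ≤ s q w) :
    SD n (fun i x => if i = p ∧ x = w + 1 then b else s i x) e where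
  zero i := by simp [h.zero]
  mono i x := by
    have := h.mono i x
    grind
  top i x hx := by
    have := h.top i x hx
    grind
  e1 := h.e1
  e0 := h.e0
  etop := h.etop
  strict i x hx := by
    have := h.strict i x hx
    grind

theorem append_cons_split {α : Type*} {A B l1 l2 : List α} {c : α} (h : A ++ B = l1 ++ c :: l2) :
    (∃ l2', A = l1 ++ c :: l2' ∧ l2 = l2' ++ B) ∨ (∃ l1', B = l1' ++ c :: l2 ∧ l1 = A ++ l1') := by
  rw [List.append_eq_append_iff] at h
  rcases h with ⟨a, h1, h2⟩ | ⟨a, h1, h2⟩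
  · grind
  · rcases a with _ | ⟨d, a⟩
    · grind
    · grind

theorem SD.opn_next {n : ℕ} {s e : Dat} (h : SD n s e) (p w : ℕ) (hw : w + 2 ≤ n) (hp : p < n + 1) :
    s (p + 1) (w + 2) ≤ s (p + 1) (w + 1) +
      opn (w + 1) (seg (rowS n (s, e)) (p + 1) (n + 1 - p - 1)) := by
  by_cases hpn : p + 1 < n + 1
  · have e1 := seg_low (rowS n (s, e)) (p + 1) (n + 1) hpn
    rw [show n + 1 - p - 1 = n + 1 - (p + 1) by omega, e1, rowS, ← List.append_assoc]
    have := opn_append_le (w + 1) (seg (rowS n (s, e)) (p + 1 + 1) (n + 1 - (p + 1 + 1)) ++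
      rowE n (s, e).2 (p + 1)) (rowM n (s, e).1 (p + 1))
    rw [(rowM_cls n _ _ w hw).2] at this
    grind
  · rw [h.row0 (p + 1) (by omega)]; omega

theorem ws_upd (n : ℕ) (q q' : Dat × Dat) (p : ℕ) (hp : p < n + 1) (a b : ℕ) (l1 l2 : List ℕ)
    (h : ∀ i, i ≠ p → rowS n q' i = rowS n q i) (hr : rowS n q' p = l1 ++ b :: l2) :
    ws n q' = (seg (rowS n q) (p + 1) (n + 1 - p - 1) ++ l1) ++ b :: (l2 ++ seg (rowS n q) 0 p) := by
  rw [ws, seg_update _ _ (n + 1) p hp h, hr]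
  simp

theorem SD.fw_closed {n : ℕ} {s e : Dat} (h : SD n s e) (w : ℕ) (hw : w + 2 ≤ n)
    (hc : 0 < cls (w + 1) (ws n (s, e))) :
    ∃ s' e', SD n s' e' ∧ ws n (s', e') = fw (w + 1) (ws n (s, e)) ∧ (∀ i, s' i n = s i n) ∧
      ∀ i, (rowE n e' i).length = (rowE n e i).length := by
  obtain ⟨u, z, hd, hf, hz, hu⟩ := fw_decomp _ _ hc
  obtain ⟨p, hp, l1, l2, E1, E2, E3⟩ := seg_split _ _ _ _ _ hd
  have hon := h.opn_next p w hw hp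
  generalize hU : seg (rowS n (s, e)) (p + 1) (n + 1 - p - 1) = U at *
  have hst := h.strict p w (by omega)
  have hst2 := h.strict p (w + 1) (by omega)
  have hmo := h.mono p w
  have hmo2 := h.mono p (w + 1)
  have hme := rowE_cls h p w hw
  have hmm := rowM_cls n s p w hw
  simp only [show w + 1 + 1 = w + 2 from rfl] at hst2 hmo2
  rcases append_cons_split E1 with ⟨l2', F1, F2⟩ | ⟨l1', F1, F2⟩
  ·
    simp only at F1 F2
    have hdesc := rowE_desc h p
    rw [F1, List.pairwise_append, List.pairwise_cons] at hdesc
    have hv1 : w + 1 ∉ l1 := fun hm => by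
      grind
    have hl2 : ∀ a ∈ l2', a < w + 1 := fun a ha => hdesc.2.1.1 a ha
    have o2 : opn (w + 1) l2' = 0 := by
      have := opn_le_count (w + 1) l2'
      rw [List.count_eq_zero_of_not_mem (fun hm => by have := hl2 _ hm; omega)] at this
      omega
    have c1 := cls_zero_of_not_mem _ _ hv1
    rw [E2, opn_append, c1] at hu
    have o1 : (w + 1 + 1) ∉ l1 := by
      intro hm
      have := cls_opn_count (w + 1) l1
      grind
    have ee1 : e p (w + 1) = 1 := by
      have := h.e1 p (w + 1)
      have hm : (w + 1) ∈ rowOf n (mE e p) := by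
        rw [← List.mem_reverse]; change w + 1 ∈ rowE n e p; rw [F1]; simp
      have h2 := List.count_pos_iff.2 hm
      rw [rowOf_count, if_pos (by omega), mE] at h2
      omega
    have ee2 : e p (w + 2) = 0 := by
      have hm : (w + 1 + 1) ∉ rowOf n (mE e p) := by
        rw [← List.mem_reverse]; change w + 1 + 1 ∉ rowE n e p; rw [F1]
        grind
      have h2 := List.count_eq_zero_of_not_mem hm
      rw [rowOf_count, if_pos (by omega), mE] at h2
      exact h2
    rw [E3, F2, List.append_assoc, cls_append, cls_append, o2, hmm.1] at hz
    have hup := h.updE p w 0 1 hw (by omega) (by omega) (by omega) (by omega)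
    have hrow : rowE n (fun i x => if i = p then (if x = w + 1 then 0 else if min x n = w + 2 then 1
        else e i x) else e i x) p = l1 ++ (w + 1 + 1) :: l2' := by
      rw [rowE, ← List.reverse_inj, List.reverse_reverse]
      have F1' : rowOf n (mE e p) = l2'.reverse ++ (w + 1) :: l1.reverse := by
        rw [← List.reverse_inj]; change rowE n e p = _; rw [F1]; simp
      rw [rowOf_change_f n w (mE e p) _ _ _ hw F1' (by simpa using hv1)]
      · simp
      · simp [mE, ee1]
      · simp only [mE]; simp [ee2, show ¬ (n < w + 2) by omega]
        omega
      · intro x hx hx1 hx2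
        simp only [mE, if_true]
        grind
    refine ⟨_, _, hup, ?_, fun _ => rfl, ?_⟩
    · rw [ws_upd n (s, e) _ p hp (w + 1) (w + 1 + 1) l1 l2, hf, E2, E3, hU]
      · intro i hi
        simp only [rowS, rowE]
        congr 3
        funext x; simp [mE, hi]
      · simp only [rowS]
        grind
    · intro i
      by_cases hi : i = p
      · grind
      · simp only [rowE]
        congr 3
        funext x; simp [mE, hi]
  · simp only at F1 F2
    have hsort := rowOf_sorted n (mS s p)
    change (rowM n s p).Pairwise (· ≤ ·) at hsort
    rw [F1, List.pairwise_append, List.pairwise_cons] at hsort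
    have cl1 := cls_sorted (w + 1) l1' hsort.1
    have cl2 := cls_sorted (w + 1) l2 hsort.2.1.2
    rw [E3, cls_append, cl2.1] at hz
    have hv2 : w + 1 ∉ l2 := by grind
    have hcnt : l1'.count (w + 1) + 1 = s p (w + 1) - s p w := by
      rw [← hmm.1, (cls_sorted (w + 1) (rowM n s p) (rowOf_sorted n (mS s p))).1, F1]
      grind
    have hcnt2 : l1'.count (w + 1 + 1) = 0 := by
      apply List.count_eq_zero_of_not_mem
      intro hm
      have := hsort.2.2 _ hm (w + 1) (by simp)
      omega
    rw [E2, F2, ← List.append_assoc, opn_append, opn_append, cl1.1, cl1.2, hcnt2, hme.1, hme.2] at hu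
    have hup := h.updS p w (s p (w + 1) - 1) hw (by omega) (by omega) (by omega) (by
      intro q hq
      have := h.strict q w (by omega)
      grind)
    have hrow : rowM n (fun i x => if i = p ∧ x = w + 1 then s p (w + 1) - 1 else s i x) p
        = l1' ++ (w + 1 + 1) :: l2 := by
      rw [rowM]
      apply rowOf_change_f n w (mS s p) _ _ _ hw F1 hv2
      · simp [mS]; try simp only [show w + 1 + 1 = w + 2 from rfl]
        omega
      · simp [mS]; try simp only [show w + 1 + 1 = w + 2 from rfl]
        omega
      · intro x hx hx1 hx2
        simp [mS, hx1, hx2]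
    refine ⟨_, _, hup, ?_, ?_, fun _ => rfl⟩
    · rw [ws_upd n (s, e) _ p hp (w + 1) (w + 1 + 1) l1 l2, hf, E2, E3, hU]
      · intro i hi
        simp only [rowS, rowM]
        congr 2
        funext x; simp [mS, hi]
      · simp only [rowS]
        grind
    · grind

theorem SD.ew_closed {n : ℕ} {s e : Dat} (h : SD n s e) (w : ℕ) (hw : w + 2 ≤ n)
    (hc : 0 < opn (w + 1) (ws n (s, e))) :
    ∃ s' e', SD n s' e' ∧ ws n (s', e') = ew (w + 1) (ws n (s, e)) ∧ (∀ i, s' i n = s i n) ∧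
      ∀ i, (rowE n e' i).length = (rowE n e i).length := by
  obtain ⟨u, z, hd, hf, hz, hu⟩ := ew_decomp _ _ hc
  obtain ⟨p, hp, l1, l2, E1, E2, E3⟩ := seg_split _ _ _ _ _ hd
  generalize hU : seg (rowS n (s, e)) (p + 1) (n + 1 - p - 1) = U at *
  have hst := h.strict p w (by omega)
  have hst2 := h.strict p (w + 1) (by omega)
  have hmo := h.mono p w
  have hmo2 := h.mono p (w + 1)
  have hmo3 := h.mono (p + 1) (w + 1)
  have hme := rowE_cls h p w hw
  have hmm := rowM_cls n s p w hw
  simp only [show w + 1 + 1 = w + 2 from rfl] at hst2 hmo2 hmo3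
  rcases append_cons_split E1 with ⟨l2', F1, F2⟩ | ⟨l1', F1, F2⟩
  ·
    simp only at F1 F2
    have hdesc := rowE_desc h p
    rw [F1, List.pairwise_append, List.pairwise_cons] at hdesc
    have hv1 : w + 1 ∉ l1 := fun hm => by
      have := hdesc.2.2 _ hm (w + 1 + 1) (by simp); omega
    have hv2 : w + 1 + 1 ∉ l1 := fun hm => by
      have := hdesc.2.2 _ hm (w + 1 + 1) (by simp); omega
    have hl2 : ∀ a ∈ l2', a < w + 1 + 1 := fun a ha => hdesc.2.1.1 a ha
    have o2 : opn (w + 1) l2' = 0 := by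
      have := opn_le_count (w + 1) l2'
      grind
    rw [E3, F2, List.append_assoc, cls_append, cls_append, o2, hmm.1] at hz
    have o1 : (w + 1) ∉ l2' := by
      intro hm
      have := cls_opn_count (w + 1) l2'
      grind
    have ee2 : e p (w + 2) = 1 := by
      have := h.e1 p (w + 2)
      have hm : (w + 1 + 1) ∈ rowOf n (mE e p) := by
        rw [← List.mem_reverse]; change w + 1 + 1 ∈ rowE n e p; rw [F1]; simp
      have h2 := List.count_pos_iff.2 hm
      rw [rowOf_count, if_pos (by omega), mE] at h2
      grind
    have ee1 : e p (w + 1) = 0 := by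
      have hm : (w + 1) ∉ rowOf n (mE e p) := by
        rw [← List.mem_reverse]; change w + 1 ∉ rowE n e p; rw [F1]
        grind
      have h2 := List.count_eq_zero_of_not_mem hm
      rw [rowOf_count, if_pos (by omega), mE] at h2
      exact h2
    have hup := h.updE p w 1 0 hw (by omega) (by omega) (by omega) (by omega)
    have hrow : rowE n (fun i x => if i = p then (if x = w + 1 then 1 else if min x n = w + 2 then 0
        else e i x) else e i x) p = l1 ++ (w + 1) :: l2' := by
      rw [rowE, ← List.reverse_inj, List.reverse_reverse]
      have F1' : rowOf n (mE e p) = l2'.reverse ++ (w + 1 + 1) :: l1.reverse := by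
        rw [← List.reverse_inj]; change rowE n e p = _; rw [F1]; simp
      rw [rowOf_change_e n w (mE e p) _ _ _ hw F1' (by
        grind)]
      · simp
      · simp [mE, ee1]
      · simp only [mE]; simp [ee2, show ¬ (n < w + 2) by omega]
        omega
      · intro x hx hx1 hx2
        simp only [mE, if_true]
        grind
    refine ⟨_, _, hup, ?_, fun _ => rfl, ?_⟩
    · rw [ws_upd n (s, e) _ p hp (w + 1 + 1) (w + 1) l1 l2, hf, E2, E3, hU]
      · intro i hi
        simp only [rowS, rowE]
        congr 3
        funext x; simp [mE, hi]
      · simp only [rowS]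
        grind
    · intro i
      by_cases hi : i = p
      · grind
      · simp only [rowE]
        congr 3
        funext x; simp [mE, hi]
  · simp only at F1 F2
    have hsort := rowOf_sorted n (mS s p)
    change (rowM n s p).Pairwise (· ≤ ·) at hsort
    rw [F1, List.pairwise_append, List.pairwise_cons] at hsort
    have cl1 := cls_sorted (w + 1) l1' hsort.1
    have cl2 := cls_sorted (w + 1) l2 hsort.2.1.2
    have hcnt2 : l2.count (w + 1) = 0 := by
      apply List.count_eq_zero_of_not_mem
      grind
    rw [E2, F2, ← List.append_assoc, opn_append, cl1.1, cl1.2] at hu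
    have hv1 : w + 1 + 1 ∉ l1' := by grind
    have hcnt : l2.count (w + 1 + 1) + 1 = s p (w + 2) - s p (w + 1) := by
      rw [← hmm.2, (cls_sorted (w + 1) (rowM n s p) (rowOf_sorted n (mS s p))).2, F1]
      grind
    rw [E3, cls_append, cl2.1, cl2.2] at hz
    have hup := h.updS p w (s p (w + 1) + 1) hw (by omega) (by omega) (by omega) (by
      intro q hq
      have g1 := h.strict q w (by omega)
      have g2 := h.strict q (w + 1) (by omega)
      have g3 := rowE_cls h q w hw
      have g4 := rowM_cls n s q w hw
      simp only [show w + 1 + 1 = w + 2 from rfl] at g2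
      rw [hq, seg, zero_add, rowS, cls_append, cls_append, g3.1, g3.2, g4.1, opn_append, g3.2, g4.1, g4.2] at hz
      grind)
    have hrow : rowM n (fun i x => if i = p ∧ x = w + 1 then s p (w + 1) + 1 else s i x) p
        = l1' ++ (w + 1) :: l2 := by
      rw [rowM]
      apply rowOf_change_e n w (mS s p) _ _ _ hw F1 hv1
      · simp [mS]; try simp only [show w + 1 + 1 = w + 2 from rfl]
        omega
      · simp [mS]; try simp only [show w + 1 + 1 = w + 2 from rfl]
        omega
      · intro x hx hx1 hx2
        simp [mS, hx1, hx2]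
    refine ⟨_, _, hup, ?_, ?_, fun _ => rfl⟩
    · rw [ws_upd n (s, e) _ p hp (w + 1 + 1) (w + 1) l1 l2, hf, E2, E3, hU]
      · intro i hi
        simp only [rowS, rowM]
        congr 2
        funext x; simp [mS, hi]
      · simp only [rowS]
        grind
    · grind

theorem RD.lam_anti {n : ℕ} {lam mu : ℕ → ℕ} {C : Dat} (h : RD n lam mu C) (i : ℕ) :
    lam (i + 1) ≤ lam i := by
  have := h.anti i n
  rwa [h.top _ _ le_rfl, h.top _ _ le_rfl] at this

theorem anti_le0 (f : ℕ → ℕ) (h : ∀ i, f (i + 1) ≤ f i) (i : ℕ) : f i ≤ f 0 := by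
  induction i with
  | zero => exact le_rfl
  | succ i ih => exact (h i).trans ih

theorem RDs_fin (n : ℕ) (lam mu : ℕ → ℕ) (hl : ∀ i, n ≤ i → lam i = 0) :
    {C : Dat | RD n lam mu C}.Finite := by
  apply (box_finite n (lam 0)).subset
  intro C h
  have h : RD n lam mu C := h
  refine ⟨fun i x => (h.le_lam i x).trans (anti_le0 lam h.lam_anti i), fun i x hi => ?_,
    fun i x hx => ?_⟩
  · have := h.le_lam i x
    grind
  · rw [h.top i x hx, h.top i n le_rfl]

def RDs (n : ℕ) (lam mu : ℕ → ℕ) : Finset Dat :=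
  if h : {C : Dat | RD n lam mu C}.Finite then h.toFinset else ∅

theorem mem_RDs {n : ℕ} {lam mu : ℕ → ℕ} (hl : ∀ i, n ≤ i → lam i = 0) {C : Dat} :
    C ∈ RDs n lam mu ↔ RD n lam mu C := by
  rw [RDs, dif_pos (RDs_fin n lam mu hl)]; simp

theorem RD.row_len {n : ℕ} {lam mu : ℕ → ℕ} {C : Dat} (h : RD n lam mu C) (i : ℕ) :
    (rowW n C i).length + mu i ≤ lam i := by
  rw [rowW, rowOf_length]
  have ht := tele (C i) (h.mono i) n
  rw [h.zero, h.top i n le_rfl] at ht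
  have hle : ∑ x ∈ range n, mI C i x ≤ ∑ x ∈ range n, (C i (x + 1) - C i x) := by
    apply sum_le_sum
    intro x _
    show C i (x + 1) - max (C i x) (C (i + 1) (x + 1)) ≤ _
    omega
  omega

theorem RDs_crys (n : ℕ) (lam mu : ℕ → ℕ) (hl : ∀ i, n ≤ i → lam i = 0) :
    Crys n (∑ i ∈ range (n + 1), lam i) (RDs n lam mu) (wd n)
      (fun C => fun i => (rowW n C i).length) where
  inj x hx y hy h1 h2 := by
    rw [mem_RDs hl] at hx hy
    exact RD.inj hx hy (fun i hi => hl i (by omega)) h1 (fun i => congrFun h2 i)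
  hf w hw x hx hc := by
    rw [mem_RDs hl] at hx
    obtain ⟨y, h1, h2, h3⟩ := hx.fw_closed w (fun z => by
      have := hx.le_lam (n + 1) z; rw [hl _ (by omega)] at this; omega) hw hc
    exact ⟨y, (mem_RDs hl).2 h1, h2, funext h3⟩
  he w hw x hx hc := by
    rw [mem_RDs hl] at hx
    obtain ⟨y, h1, h2, h3⟩ := hx.ew_closed w (fun z => by
      have := hx.le_lam (n + 1) z; rw [hl _ (by omega)] at this; omega) hw hc
    exact ⟨y, (mem_RDs hl).2 h1, h2, funext h3⟩
  lett x hx a ha := wd_mem ha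
  len x hx := by
    rw [mem_RDs hl] at hx
    rw [wd, seg_length]
    apply sum_le_sum
    intro i _
    have := hx.row_len i
    omega

theorem SD.len {n : ℕ} {s e : Dat} (h : SD n s e) (i : ℕ) (hi : i < n + 1) :
    s i n ≤ (ws n (s, e)).length := by
  rw [ws, seg_length]
  refine le_trans ?_ (single_le_sum (f := fun i => (rowS n (s, e) i).length)
    (fun _ _ => Nat.zero_le _) (mem_range.2 hi))
  simp only [rowS, List.length_append]
  rw [rowM_length h]
  omega

theorem SDs_fin (n N : ℕ) : {p : Dat × Dat | SD n p.1 p.2 ∧ (ws n p).length = N}.Finite := by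
  apply ((box_finite n (N + 1)).prod (box_finite n (N + 1))).subset
  rintro ⟨s, e⟩ ⟨h, hN⟩
  simp only at h
  refine ⟨⟨fun i x => ?_, fun i x hi => h.row0 i (by omega) x, fun i x hx => h.top i x hx⟩,
    ⟨fun i x => ?_, fun i x hi => h.rowe0 i (by omega) x, fun i x hx => h.etop i x hx⟩⟩
  · by_cases hi : i < n + 1
    · have := h.len i hi
      have h1 := monotone_nat_of_le_succ (h.mono i) (le_max_left x n)
      rw [h.top i _ (le_max_right x n)] at h1
      grind
    · simp only
      rw [h.row0 i (by omega)]; omega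
  · have := h.e1 i x
    grind

def SDs (n N : ℕ) : Finset (Dat × Dat) := (SDs_fin n N).toFinset

theorem mem_SDs {n N : ℕ} {p : Dat × Dat} :
    p ∈ SDs n N ↔ SD n p.1 p.2 ∧ (ws n p).length = N := by
  simp [SDs]

theorem ws_mem {n : ℕ} {p : Dat × Dat} {a : ℕ} (h : a ∈ ws n p) : 1 ≤ a ∧ a ≤ n := by
  rw [ws] at h
  obtain ⟨i, hi⟩ := seg_mem _ _ _ _ h
  simp only [rowS, rowE, rowM, List.mem_append, List.mem_reverse] at hi
  rcases hi with hi | hi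
  · exact rowOf_mem _ _ _ hi
  · exact rowOf_mem _ _ _ hi

theorem SD.inj {n : ℕ} {s e s' e' : Dat} (h : SD n s e) (h' : SD n s' e')
    (hw : ws n (s, e) = ws n (s', e')) (h1 : ∀ i, s i n = s' i n)
    (h2 : ∀ i, (rowE n e i).length = (rowE n e' i).length) : s = s' ∧ e = e' := by
  have hr := seg_inj _ _ _ (fun i _ => by
    simp only [rowS, List.length_append]
    rw [rowM_length h, rowM_length h', h1, h2]) hw
  have hE : ∀ i, i < n + 1 → rowE n e i = rowE n e' i ∧ rowM n s i = rowM n s' i := by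
    intro i hi
    exact List.append_inj (hr i hi) (h2 i)
  constructor
  · funext i x
    by_cases hi : i < n + 1
    · have hm := (hE i hi).2
      have hx : ∀ x, x ≤ n → s i x = s' i x := by
        intro x
        induction x with
        | zero => intro _; rw [h.zero, h'.zero]
        | succ x ih =>
          intro hx
          have c1 := rowOf_count n (mS s i) x
          have c2 := rowOf_count n (mS s' i) x
          simp only [rowM] at hm
          rw [hm, c2, if_pos (by omega), if_pos (by omega)] at c1
          simp only [mS] at c1
          have := ih (by omega)
          have := h.mono i x
          have := h'.mono i x
          omega
      rcases le_total x n with hx1 | hx1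
      · grind
      · rw [h.top i x hx1, h'.top i x hx1, hx n le_rfl]
    · rw [h.row0 i (by omega), h'.row0 i (by omega)]
  · funext i x
    by_cases hi : i < n + 1
    · have hm := (hE i hi).1
      have hx : ∀ x, x ≤ n → e i x = e' i x := by
        intro x hx
        rcases x with _ | x
        · rw [h.e0, h'.e0]
        · have c1 := rowOf_count n (mE e i) x
          have c2 := rowOf_count n (mE e' i) x
          simp only [rowE, List.reverse_inj] at hm
          rw [hm, c2, if_pos (by omega), if_pos (by omega)] at c1
          exact c1.symm
      rcases le_total x n with hx1 | hx1
      · grind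
      · rw [h.etop i x hx1, h'.etop i x hx1, hx n le_rfl]
    · rw [h.rowe0 i (by omega), h'.rowe0 i (by omega)]

theorem ws_length_congr {n : ℕ} {s e s' e' : Dat} (h : SD n s e) (h' : SD n s' e')
    (h1 : ∀ i, s' i n = s i n)
    (h2 : ∀ i, (rowE n e' i).length = (rowE n e i).length) :
    (ws n (s', e')).length = (ws n (s, e)).length := by
  simp only [ws, seg_length, rowS, List.length_append]
  apply sum_congr rfl
  intro i _
  rw [rowM_length h, rowM_length h', h1, h2]

theorem SDs_crys (n N : ℕ) :
    Crys n N (SDs n N) (ws n)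
      (fun p => ((fun i => p.1 i n), (fun i => (rowE n p.2 i).length))) where
  inj := by
    rintro ⟨s, e⟩ hx ⟨s', e'⟩ hy h1 h2
    rw [mem_SDs] at hx hy
    simp only [Prod.mk.injEq] at h2
    obtain ⟨a, b⟩ := SD.inj hx.1 hy.1 h1 (fun i => congrFun h2.1 i) (fun i => congrFun h2.2 i)
    grind
  hf w hw := by
    rintro ⟨s, e⟩ hx hc
    rw [mem_SDs] at hx
    obtain ⟨s', e', h1, h2, h3, h4⟩ := hx.1.fw_closed w hw hc
    refine ⟨(s', e'), mem_SDs.2 ⟨h1, ?_⟩, h2, ?_⟩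
    · rw [ws_length_congr hx.1 h1 h3 h4]; exact hx.2
    · grind
  he w hw := by
    rintro ⟨s, e⟩ hx hc
    rw [mem_SDs] at hx
    obtain ⟨s', e', h1, h2, h3, h4⟩ := hx.1.ew_closed w hw hc
    refine ⟨(s', e'), mem_SDs.2 ⟨h1, ?_⟩, h2, ?_⟩
    · rw [ws_length_congr hx.1 h1 h3 h4]; exact hx.2
    · grind
  lett x hx a ha := ws_mem ha
  len x hx := (mem_SDs.1 hx).2.le

section Local
variable {R : Type*} [CommRing R]

theorem tel1 (z : R) (m : ℕ) :
    ∑ j ∈ range (m + 1), z ^ j * (if j < m then 1 - z else 1) = 1 := by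
  rw [sum_range_succ, if_neg (lt_irrefl m)]
  have : ∀ m, ∑ j ∈ range m, z ^ j * (1 - z) = 1 - z ^ m := by
    intro m
    induction m with
    | zero => simp
    | succ m ih => rw [sum_range_succ, ih]; ring
  rw [sum_congr rfl (g := fun j => z ^ j * (1 - z)) (fun j hj => by
    grind), this]
  ring

theorem tel2 (z : R) (m : ℕ) :
    ∑ j ∈ range (m + 1), z ^ (m - j) * (if 0 < j then 1 - z else 1) = 1 := by
  refine Eq.trans ?_ (tel1 z m)
  rw [← sum_range_reflect]
  apply sum_congr rfl
  grind

theorem sum_window (N p m : ℕ) (f : ℕ → R) (h : p + m ≤ N) :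
    ∑ a ∈ range (N + 1), (if p ≤ a ∧ a ≤ p + m then f a else 0) =
    ∑ j ∈ range (m + 1), f (p + j) := by
  obtain ⟨c, rfl⟩ := Nat.exists_eq_add_of_le h
  rw [show p + m + c + 1 = p + (m + 1 + c) by omega, sum_range_add, sum_range_add]
  rw [sum_eq_zero, zero_add, sum_eq_zero (s := range c), add_zero]
  · apply sum_congr rfl
    grind
  · grind
  · grind

def LocL (x y b : R) (N k k' t t' : ℕ) : R :=
  ∑ a ∈ range (N + 1), (if max k' t' ≤ a ∧ a ≤ k then
    y ^ (a - k') * x ^ (a - max k' t') * (if a < k then 1 - b * y else 1) *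
      x ^ (max k t - max t a) * b ^ (max t a - t) else 0)

def LocR (x y b : R) (N k k' t t' : ℕ) : R :=
  ∑ a ∈ range (N + 1), (if t' ≤ a ∧ a ≤ min k t then
    y ^ (t - a) * (if t' < a then 1 - b * y else 1) *
      x ^ (k - max a k') * b ^ (max a k' - a) else 0)

def Comm4 (x y b : R) (c d m g : ℕ) : R :=
  y ^ (d + m + g) * x ^ (m + c) + ∑ j ∈ range m, (1 - b * y) * (y ^ (d + g + j) * x ^ (j + c))

theorem locL_1 (x y b : R) (N k' t' m d : ℕ) (hN : max k' t' + m ≤ N) :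
    y ^ d * LocL x y b N (max k' t' + m) k' (max k' t' + m + d) t' =
      Comm4 x y b 0 d m (max k' t' - k') := by
  rw [LocL, sum_window _ _ _ _ hN, Comm4, sum_range_succ, mul_add, mul_sum, add_comm]
  congr 1
  · rw [if_neg (lt_irrefl _)]
    have e1 : max k' t' + m - k' = m + (max k' t' - k') := by omega
    have e2 : max (max k' t' + m) (max k' t' + m + d) - max (max k' t' + m + d) (max k' t' + m) = 0 := by omega
    have e3 : max (max k' t' + m + d) (max k' t' + m) - (max k' t' + m + d) = 0 := by omega
    have e4 : max k' t' + m - max k' t' = m := by omega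
    rw [e1, e2, e3, e4]; ring
  · apply sum_congr rfl
    intro j hj
    rw [mem_range] at hj
    rw [if_pos (by omega)]
    have e1 : max k' t' + j - k' = j + (max k' t' - k') := by omega
    have e2 : max (max k' t' + m) (max k' t' + m + d) - max (max k' t' + m + d) (max k' t' + j) = 0 := by omega
    have e3 : max (max k' t' + m + d) (max k' t' + j) - (max k' t' + m + d) = 0 := by omega
    have e4 : max k' t' + j - max k' t' = j := by omega
    rw [e1, e2, e3, e4]; ring

theorem locL_2 (x y b : R) (N k' t' m c : ℕ) (hN : max k' t' + (m + 1 + c) ≤ N) :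
    LocL x y b N (max k' t' + (m + 1 + c)) k' (max k' t' + m) t' =
      Comm4 x y b (c + 1) 0 m (max k' t' - k') := by
  rw [LocL, sum_window _ _ _ _ hN, Comm4, show m + 1 + c + 1 = (m + 1) + (c + 1) by omega,
    sum_range_add]
  have hA : ∀ j ∈ range (m + 1), (y ^ (max k' t' + j - k') * x ^ (max k' t' + j - max k' t') *
      (if max k' t' + j < max k' t' + (m + 1 + c) then 1 - b * y else 1) *
      x ^ (max (max k' t' + (m + 1 + c)) (max k' t' + m) - max (max k' t' + m) (max k' t' + j)) *
      b ^ (max (max k' t' + m) (max k' t' + j) - (max k' t' + m))) =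
      (1 - b * y) * (y ^ (0 + (max k' t' - k') + j) * x ^ (j + (c + 1))) := by
    intro j hj
    rw [mem_range] at hj
    rw [if_pos (by omega)]
    have e1 : max k' t' + j - k' = 0 + (max k' t' - k') + j := by omega
    have e2 : max (max k' t' + (m + 1 + c)) (max k' t' + m) - max (max k' t' + m) (max k' t' + j) = c + 1 := by omega
    have e3 : max (max k' t' + m) (max k' t' + j) - (max k' t' + m) = 0 := by omega
    have e4 : max k' t' + j - max k' t' = j := by omega
    rw [e1, e2, e3, e4]; ring
  have hB : ∀ i ∈ range (c + 1), (y ^ (max k' t' + (m + 1 + i) - k') * x ^ (max k' t' + (m + 1 + i) - max k' t') *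
      (if max k' t' + (m + 1 + i) < max k' t' + (m + 1 + c) then 1 - b * y else 1) *
      x ^ (max (max k' t' + (m + 1 + c)) (max k' t' + m) - max (max k' t' + m) (max k' t' + (m + 1 + i))) *
      b ^ (max (max k' t' + m) (max k' t' + (m + 1 + i)) - (max k' t' + m))) =
      (b * y * (y ^ (m + (max k' t' - k')) * x ^ (m + (c + 1)))) *
        ((b * y) ^ i * (if i < c then 1 - b * y else 1)) := by
    intro i hi
    rw [mem_range] at hi
    have e0 : (max k' t' + (m + 1 + i) < max k' t' + (m + 1 + c)) = (i < c) := by grind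
    have e1 : max k' t' + (m + 1 + i) - k' = i + 1 + (m + (max k' t' - k')) := by omega
    have e2 : max (max k' t' + (m + 1 + c)) (max k' t' + m) - max (max k' t' + m) (max k' t' + (m + 1 + i)) = c - i := by omega
    have e3 : max (max k' t' + m) (max k' t' + (m + 1 + i)) - (max k' t' + m) = i + 1 := by omega
    have e4 : max k' t' + (m + 1 + i) - max k' t' = m + 1 + i := by omega
    have e5 : x ^ (m + (c + 1)) = x ^ (m + 1 + i) * x ^ (c - i) := by
      rw [← pow_add]; congr 1; omega
    rw [e1, e2, e3, e4, e5, mul_pow]; simp only [e0]; ring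
  rw [sum_congr rfl hA, sum_congr rfl hB, ← mul_sum (range (c + 1)), tel1,
    sum_range_succ, zero_add, zero_add]
  ring

theorem locR_1 (x y b : R) (N k k' t t' m : ℕ) (hk : k' ≤ t') (hN : t' + m ≤ N)
    (hq : min k t = t' + m) :
    y ^ (t' - k') * LocR x y b N k k' t t' = Comm4 x y b (k - (t' + m)) (t - (t' + m)) m (t' - k') := by
  rw [LocR, hq, sum_window _ _ _ _ hN, Comm4, sum_range_succ', mul_add, mul_sum, add_comm]
  congr 1
  · rw [if_neg (by omega)]
    have e1 : max (t' + 0) k' = t' := by omega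
    have e2 : t' + 0 = t' := rfl
    rw [e1, e2, Nat.sub_self, show k - t' = m + (k - (t' + m)) by omega,
      show t - (t' + m) + m + (t' - k') = (t' - k') + (t - t') by omega]
    ring
  · rw [← sum_range_reflect]
    apply sum_congr rfl
    intro j hj
    rw [mem_range] at hj
    rw [if_pos (by omega)]
    have e1 : max (t' + (m - 1 - j + 1)) k' = t' + (m - 1 - j + 1) := by omega
    rw [e1, Nat.sub_self, show k - (t' + (m - 1 - j + 1)) = j + (k - (t' + m)) by omega,
      show t - (t' + m) + (t' - k') + j = (t' - k') + (t - (t' + (m - 1 - j + 1))) by omega]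
    ring

theorem locR_2 (x y b : R) (N k k' t t' m d : ℕ) (hk : k' = t' + (d + 1)) (hN : k' + m ≤ N)
    (hq : min k t = k' + m) :
    LocR x y b N k k' t t' = Comm4 x y b (k - (k' + m)) (t - (k' + m)) m 0 := by
  rw [LocR, hq, show k' + m = t' + (d + 1 + m) by omega, sum_window _ _ _ _ (by omega), Comm4,
    show d + 1 + m + 1 = (d + 2) + m by omega, sum_range_add]
  congr 1
  · have hB : ∀ i ∈ range (d + 2), (y ^ (t - (t' + i)) * (if t' < t' + i then 1 - b * y else 1) *
        x ^ (k - max (t' + i) k') * b ^ (max (t' + i) k' - (t' + i))) =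
        (y ^ (t - k') * x ^ (k - k')) *
        ((b * y) ^ (d + 1 - i) * (if 0 < i then 1 - b * y else 1)) := by
      intro i hi
      rw [mem_range] at hi
      have e0 : (t' < t' + i) = (0 < i) := by apply propext; omega
      have e1 : max (t' + i) k' = k' := by omega
      rw [e1, show t - (t' + i) = (t - k') + (d + 1 - i) by omega, show k' - (t' + i) = d + 1 - i by omega,
        mul_pow]
      grind
    rw [sum_congr rfl hB, ← mul_sum, show d + 2 = (d + 1) + 1 from rfl, tel2, mul_one]
    grind
  · rw [← sum_range_reflect]
    apply sum_congr rfl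
    intro j hj
    rw [mem_range] at hj
    rw [if_pos (by omega)]
    have e1 : max (t' + (d + 2 + (m - 1 - j))) k' = t' + (d + 2 + (m - 1 - j)) := by omega
    rw [e1, Nat.sub_self, show k - (t' + (d + 2 + (m - 1 - j))) = j + (k - (t' + (d + 1 + m))) by omega,
      show t - (t' + (d + 2 + (m - 1 - j))) = t - (t' + (d + 1 + m)) + 0 + j by omega]
    ring

theorem locL_A (x y b : R) (N k k' t t' : ℕ) (h1 : t < k') (h2 : t' ≤ t) (h3 : k' ≤ k) (hN : k ≤ N) :
    LocL x y b N k k' t t' = x ^ (k - k') * b ^ (k' - t) := by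
  obtain ⟨m, rfl⟩ := Nat.exists_eq_add_of_le h3
  rw [LocL, show max k' t' = k' by omega, sum_window _ _ _ _ hN]
  have hB : ∀ i ∈ range (m + 1), (y ^ (k' + i - k') * x ^ (k' + i - k') *
      (if k' + i < k' + m then 1 - b * y else 1) *
      x ^ (max (k' + m) t - max t (k' + i)) * b ^ (max t (k' + i) - t)) =
      (x ^ m * b ^ (k' - t)) * ((b * y) ^ i * (if i < m then 1 - b * y else 1)) := by
    intro i hi
    rw [mem_range] at hi
    have e0 : (k' + i < k' + m) = (i < m) := by apply propext; omega
    rw [show k' + i - k' = i by omega, show max (k' + m) t - max t (k' + i) = m - i by omega,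
      show max t (k' + i) - t = i + (k' - t) by omega, mul_pow]
    simp only [e0]
    have e5 : x ^ m = x ^ i * x ^ (m - i) := by rw [← pow_add]; congr 1; omega
    grind
  rw [sum_congr rfl hB, ← mul_sum, tel1, mul_one]
  grind

theorem locR_A (x y b : R) (N k k' t t' : ℕ) (h1 : t < k') (h2 : t' ≤ t) (h3 : k' ≤ k) (hN : k ≤ N) :
    LocR x y b N k k' t t' = x ^ (k - k') * b ^ (k' - t) := by
  obtain ⟨m, rfl⟩ := Nat.exists_eq_add_of_le h2
  rw [LocR, show min k (t' + m) = t' + m by omega, sum_window _ _ _ _ (by omega)]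
  have hB : ∀ i ∈ range (m + 1), (y ^ (t' + m - (t' + i)) * (if t' < t' + i then 1 - b * y else 1) *
      x ^ (k - max (t' + i) k') * b ^ (max (t' + i) k' - (t' + i))) =
      (x ^ (k - k') * b ^ (k' - (t' + m))) * ((b * y) ^ (m - i) * (if 0 < i then 1 - b * y else 1)) := by
    intro i hi
    rw [mem_range] at hi
    have e0 : (t' < t' + i) = (0 < i) := by apply propext; omega
    rw [show max (t' + i) k' = k' by omega, show t' + m - (t' + i) = m - i by omega,
      show k' - (t' + i) = (m - i) + (k' - (t' + m)) by omega, mul_pow]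
    grind
  rw [sum_congr rfl hB, ← mul_sum, tel2, mul_one]

theorem loc_id (x y b : R) (N k k' t t' : ℕ) (hk : k' ≤ k) (ht : t' ≤ t) (hN : k ≤ N) :
    y ^ (t - k) * LocL x y b N k k' t t' = y ^ (t' - k') * LocR x y b N k k' t t' := by
  by_cases h0 : k < t'
  · rw [LocL, LocR, sum_eq_zero, sum_eq_zero, mul_zero, mul_zero]
    · grind
    · grind
  by_cases h1 : t < k'
  · rw [locL_A _ _ _ _ _ _ _ _ h1 ht hk hN, locR_A _ _ _ _ _ _ _ _ h1 ht hk hN,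
      show t - k = 0 by omega, show t' - k' = 0 by omega]
  obtain ⟨m, hm⟩ : ∃ m, min k t = max k' t' + m := ⟨min k t - max k' t', by omega⟩
  have hRt : y ^ (t' - k') * LocR x y b N k k' t t' =
      Comm4 x y b (k - (max k' t' + m)) (t - (max k' t' + m)) m (max k' t' - k') := by
    by_cases h2 : k' ≤ t'
    · rw [show max k' t' = t' by omega] at hm ⊢
      exact locR_1 x y b N k k' t t' m h2 (by omega) hm
    · rw [show max k' t' = k' by omega] at hm ⊢
      rw [show t' - k' = 0 by omega, pow_zero, one_mul, Nat.sub_self]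
      exact locR_2 x y b N k k' t t' m (k' - t' - 1) (by omega) (by omega) hm
  rw [hRt]
  by_cases h3 : k ≤ t
  · have e1 : k = max k' t' + m := by omega
    obtain ⟨d, hd⟩ : ∃ d, t = max k' t' + m + d := ⟨t - k, by omega⟩
    have := locL_1 x y b N k' t' m d (by omega)
    grind
  · obtain ⟨c, hc⟩ : ∃ c, k = max k' t' + (m + 1 + c) := ⟨k - t - 1, by omega⟩
    have e1 : t = max k' t' + m := by omega
    have := locL_2 x y b N k' t' m c (by omega)
    rw [← hc, ← e1] at this
    rw [← e1, show t - k = 0 by omega, pow_zero, one_mul, this, Nat.sub_self,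
      show k - t = c + 1 by omega]

end Local

def PF : ℕ → ℕ → Finset (ℕ → ℕ)
  | 0, _ => {fun _ => 0}
  | K + 1, N => (range (N + 1) ×ˢ PF K N).image (fun p => Function.update p.2 K p.1)

theorem mem_PF {K N : ℕ} {f : ℕ → ℕ} : f ∈ PF K N ↔ (∀ i, f i ≤ N) ∧ ∀ i, K ≤ i → f i = 0 := by
  induction K generalizing f with
  | zero =>
    simp only [PF, mem_singleton]
    grind
  | succ K ih =>
    simp only [PF, mem_image, mem_product, mem_range, Prod.exists]
    constructor
    · rintro ⟨a, g, ⟨ha, hg⟩, rfl⟩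
      grind
    · rintro ⟨h1, h2⟩
      refine ⟨f K, Function.update f K 0, ⟨by have := h1 K; omega, ?_⟩, ?_⟩
      · grind
      · simp

section CommR
variable {R : Type*} [CommRing R]

theorem sum_PF (K N : ℕ) (φ : ℕ → ℕ → R) :
    ∑ f ∈ PF K N, ∏ i ∈ range K, φ i (f i) =
    ∏ i ∈ range K, ∑ a ∈ range (N + 1), φ i a := by
  induction K with
  | zero => simp [PF]
  | succ K ih =>
    rw [PF, sum_image, sum_product, prod_range_succ, ← ih, mul_comm,
      sum_mul_sum]
    · apply sum_congr rfl
      intro a _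
      apply sum_congr rfl
      intro f _
      rw [prod_range_succ, mul_comm]
      simp only [Function.update_self]
      congr 1
      apply prod_congr rfl
      grind
    · rintro ⟨a, f⟩ hf ⟨b, g⟩ hg h
      simp only [Finset.coe_product, Set.mem_prod, mem_coe] at hf hg h
      have e1 : a = b := by have := congrFun h K; simpa using this
      have e2 : f = g := by
        funext i
        by_cases hi : i = K
        · subst hi; rw [(mem_PF.1 hf.2).2 i le_rfl, (mem_PF.1 hg.2).2 i le_rfl]
        · have := congrFun h i
          grind
      rw [e1, e2]

def WW (y b : R) (K : ℕ) (κ ν : ℕ → ℕ) : R :=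
  ∏ i ∈ range K, (if κ i ≤ ν i ∧ ν (i + 1) ≤ κ i then
    y ^ (ν i - κ i) * (if ν (i + 1) < κ i then 1 - b * y else 1) else 0)

def DD (x b : R) (K : ℕ) (ν τ : ℕ → ℕ) : R :=
  ∏ i ∈ range K, (if τ i ≤ ν i ∧ τ (i + 1) ≤ τ i then
    x ^ (ν i - max (τ i) (ν (i + 1))) * b ^ (max (τ i) (ν (i + 1)) - τ i) else 0)

theorem WD_sum (x y b : R) (r N : ℕ) (κ τ : ℕ → ℕ) (hκ : ∀ i, κ (i + 1) ≤ κ i)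
    (hτ : ∀ i, τ (i + 1) ≤ τ i) (hκr : ∀ i, r ≤ i → κ i = 0) :
    ∑ ν ∈ PF (r + 1) N, WW y b (r + 1) κ ν * DD x b (r + 1) ν τ =
    (∑ a ∈ range (N + 1), if max (κ 0) (τ 0) ≤ a then
      y ^ (a - κ 0) * x ^ (a - max (κ 0) (τ 0)) else 0) *
    ∏ i ∈ range r, LocL x y b N (κ i) (κ (i + 1)) (τ i) (τ (i + 1)) := by
  set A : ℕ → ℕ → R := fun i a => if max (κ i) (τ i) ≤ a then
      y ^ (a - κ i) * x ^ (a - max (κ i) (τ i)) else 0 with hA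
  set B : ℕ → ℕ → R := fun i a => if a ≤ κ i then (if a < κ i then 1 - b * y else 1) *
      x ^ (max (κ i) (τ i) - max (τ i) a) * b ^ (max (τ i) a - τ i) else 0 with hB
  have hprod : ∀ ν ∈ PF (r + 1) N, WW y b (r + 1) κ ν * DD x b (r + 1) ν τ =
      ∏ i ∈ range (r + 1), (match i with
        | 0 => A 0
        | j + 1 => fun a => B j a * A (j + 1) a) (ν i) := by
    intro ν hν
    rw [mem_PF] at hν
    have e1 : WW y b (r + 1) κ ν * DD x b (r + 1) ν τ =
        ∏ i ∈ range (r + 1), (A i (ν i) * B i (ν (i + 1))) := by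
      rw [WW, DD, ← prod_mul_distrib]
      apply prod_congr rfl
      intro i _
      simp only [hA, hB]
      have := hτ i
      by_cases h1 : κ i ≤ ν i
      · by_cases h2 : ν (i + 1) ≤ κ i
        · by_cases h3 : τ i ≤ ν i
          · rw [if_pos (c := κ i ≤ ν i ∧ _) ⟨h1, h2⟩, if_pos (c := τ i ≤ ν i ∧ _) ⟨h3, this⟩,
              if_pos (c := max (κ i) (τ i) ≤ ν i) (by omega), if_pos (c := ν (i + 1) ≤ κ i) h2,
              show ν i - max (τ i) (ν (i + 1)) = (ν i - max (κ i) (τ i)) +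
                (max (κ i) (τ i) - max (τ i) (ν (i + 1))) by omega]
            ring
          · grind
        · grind
      · grind
    rw [e1, prod_mul_distrib, prod_range_succ' (fun i => A i (ν i)),
      prod_range_succ (fun i => B i (ν (i + 1))), prod_range_succ']
    have e2 : B r (ν (r + 1)) = 1 := by
      simp only [hB]
      rw [hν.2 (r + 1) le_rfl, hκr r le_rfl]; simp
    rw [e2, prod_mul_distrib]
    ring
  rw [sum_congr rfl hprod, sum_PF, prod_range_succ', mul_comm]
  congr 1
  apply prod_congr rfl
  intro i _
  rw [LocL]
  grind

theorem DW_sum (x y b : R) (r N : ℕ) (κ τ : ℕ → ℕ) (hκ : ∀ i, κ (i + 1) ≤ κ i)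
    (hτ : ∀ i, τ (i + 1) ≤ τ i) (hκr : ∀ i, r ≤ i → κ i = 0) (hτr : ∀ i, r + 1 ≤ i → τ i = 0) :
    ∑ σ ∈ PF (r + 1) N, DD x b (r + 1) κ σ * WW y b (r + 1) σ τ =
    y ^ (τ r) * ∏ i ∈ range r, LocR x y b N (κ i) (κ (i + 1)) (τ i) (τ (i + 1)) := by
  set ρ : ℕ → ℕ → R := fun i a => if τ (i + 1) ≤ a ∧ a ≤ min (κ i) (τ i) then
    y ^ (τ i - a) * (if τ (i + 1) < a then 1 - b * y else 1) *
      x ^ (κ i - max a (κ (i + 1))) * b ^ (max a (κ (i + 1)) - a) else 0 with hρ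
  have hprod : ∀ σ ∈ PF (r + 1) N, DD x b (r + 1) κ σ * WW y b (r + 1) σ τ =
      ∏ i ∈ range (r + 1), ρ i (σ i) := by
    intro σ hσ
    rw [mem_PF] at hσ
    rw [WW, DD, ← prod_mul_distrib]
    by_cases hd : ∀ i, i < r + 1 → σ (i + 1) ≤ σ i
    · grind
    · push Not at hd
      obtain ⟨i, hi, hlt⟩ := hd
      rw [prod_eq_zero (i := i) (mem_range.2 hi) (by rw [if_neg (by omega), zero_mul])]
      symm
      by_cases h1 : τ (i + 1) ≤ σ i
      · have hi1 : i + 1 < r + 1 := by grind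
        rw [prod_eq_zero (i := i + 1) (mem_range.2 hi1)]
        grind
      · rw [prod_eq_zero (i := i) (mem_range.2 hi)]
        grind
  rw [sum_congr rfl hprod, sum_PF, prod_range_succ, mul_comm]
  congr 1
  simp only [hρ]
  rw [hκr r le_rfl, hτr (r + 1) le_rfl, hκr (r + 1) (by omega), sum_eq_single 0]
  · simp
  · grind
  · grind

theorem commute (x y b : R) (r N : ℕ) (κ τ : ℕ → ℕ) (hκ : ∀ i, κ (i + 1) ≤ κ i)
    (hτ : ∀ i, τ (i + 1) ≤ τ i) (hκr : ∀ i, r ≤ i → κ i = 0) (hτr : ∀ i, r + 1 ≤ i → τ i = 0)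
    (hκN : κ 0 ≤ N) (hτN : τ 0 ≤ N) :
    y ^ (N + 1 - κ 0) ∣ (1 - x * y) * (∑ ν ∈ PF (r + 1) N, WW y b (r + 1) κ ν * DD x b (r + 1) ν τ) -
      ∑ σ ∈ PF (r + 1) N, DD x b (r + 1) κ σ * WW y b (r + 1) σ τ := by
  rw [WD_sum x y b r N κ τ hκ hτ hκr, DW_sum x y b r N κ τ hκ hτ hκr hτr]
  have tel : ∀ s, y ^ (τ 0 - κ 0) * ∏ i ∈ range s, LocL x y b N (κ i) (κ (i + 1)) (τ i) (τ (i + 1))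
      = y ^ (τ s - κ s) * ∏ i ∈ range s, LocR x y b N (κ i) (κ (i + 1)) (τ i) (τ (i + 1)) := by
    intro s
    induction s with
    | zero => simp
    | succ s ih =>
      rw [prod_range_succ, prod_range_succ, ← mul_assoc, ih]
      have := loc_id x y b N (κ s) (κ (s + 1)) (τ s) (τ (s + 1)) (hκ s) (hτ s)
        ((anti_le0 κ hκ s).trans hκN)
      grind
  have t := tel r
  rw [hκr r le_rfl, Nat.sub_zero] at t
  rw [← t]
  have geo : (1 - x * y) * (∑ a ∈ range (N + 1), if max (κ 0) (τ 0) ≤ a then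
      y ^ (a - κ 0) * x ^ (a - max (κ 0) (τ 0)) else 0) = y ^ (τ 0 - κ 0) -
      y ^ (N + 1 - κ 0) * x ^ (N + 1 - max (κ 0) (τ 0)) := by
    obtain ⟨m, hm⟩ : ∃ m, N = max (κ 0) (τ 0) + m := ⟨N - max (κ 0) (τ 0), by omega⟩
    have e : ∀ a ∈ range (N + 1), (if max (κ 0) (τ 0) ≤ a then
      y ^ (a - κ 0) * x ^ (a - max (κ 0) (τ 0)) else 0) = (if max (κ 0) (τ 0) ≤ a ∧ a ≤ max (κ 0) (τ 0) + m then
      y ^ (a - κ 0) * x ^ (a - max (κ 0) (τ 0)) else 0) := by grind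
    rw [sum_congr rfl e, sum_window _ _ _ _ hm.ge]
    have e2 : ∀ j ∈ range (m + 1), y ^ (max (κ 0) (τ 0) + j - κ 0) * x ^ (max (κ 0) (τ 0) + j - max (κ 0) (τ 0))
        = y ^ (τ 0 - κ 0) * (x * y) ^ j := by
      intro j _
      rw [show max (κ 0) (τ 0) + j - κ 0 = (τ 0 - κ 0) + j by omega, Nat.add_sub_cancel_left, mul_pow]
      ring
    rw [sum_congr rfl e2, ← mul_sum]
    have e3 := mul_neg_geom_sum (x * y) (m + 1)
    rw [show N + 1 - κ 0 = (τ 0 - κ 0) + (m + 1) by omega, show N + 1 - max (κ 0) (τ 0) = m + 1 by omega]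
    rw [mul_pow] at e3
    grind
  rw [← mul_assoc, geo]
  exact ⟨-x ^ (N + 1 - max (κ 0) (τ 0)) * ∏ i ∈ range r, LocL x y b N (κ i) (κ (i + 1)) (τ i) (τ (i + 1)),
    by ring⟩

def Grec (x : ℕ → R) (b : R) (K N : ℕ) : ℕ → (ℕ → ℕ) → R
  | 0, ν => if ν = (fun _ => 0) then 1 else 0
  | k + 1, ν => ∑ τ ∈ PF K N, DD (x k) b K ν τ * Grec x b K N k τ

theorem DD_zero (x b : R) (K N : ℕ) (κ τ : ℕ → ℕ) (hτ : τ ∈ PF K N) (h : DD x b K κ τ ≠ 0) :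
    (∀ i, τ i ≤ κ i ∨ K ≤ i) ∧ ∀ i, τ (i + 1) ≤ τ i := by
  rw [mem_PF] at hτ
  have key : ∀ i, i < K → τ i ≤ κ i ∧ τ (i + 1) ≤ τ i := by
    intro i hi
    by_contra hcon
    exact h (prod_eq_zero (i := i) (mem_range.2 hi) (if_neg hcon))
  grind

theorem pieri (x : ℕ → R) (y b : R) (r N k : ℕ) : ∀ (κ : ℕ → ℕ), (∀ i, κ (i + 1) ≤ κ i) →
    (∀ i, r ≤ i → κ i = 0) → κ 0 ≤ N →
    y ^ (N + 1 - κ 0) ∣ (∏ l ∈ range k, (1 - x l * y)) *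
      (∑ ν ∈ PF (r + 1) N, WW y b (r + 1) κ ν * Grec x b (r + 1) N k ν) - Grec x b (r + 1) N k κ := by
  induction k with
  | zero =>
    intro κ h1 h2 h3
    have hk : ∑ ν ∈ PF (r + 1) N, WW y b (r + 1) κ ν * Grec x b (r + 1) N 0 ν = Grec x b (r + 1) N 0 κ := by
      rw [sum_eq_single (fun _ => 0)]
      · simp only [Grec]
        rw [if_pos trivial, mul_one]
        by_cases hκ : κ = fun _ => 0
        · subst hκ; simp [WW]
        · rw [if_neg hκ]
          have h0 : κ 0 ≠ 0 := by
            intro h; apply hκ; funext i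
            have := anti_le0 κ h1 i; omega
          exact prod_eq_zero (i := 0) (by simp) (if_neg (by
            grind))
      · intro ν _ hν; simp only [Grec]; rw [if_neg hν, mul_zero]
      · intro h; exact absurd (mem_PF.2 ⟨fun _ => Nat.zero_le _, fun _ _ => rfl⟩) h
    rw [hk]; simp
  | succ k ih =>
    intro κ h1 h2 h3
    set P := ∏ l ∈ range k, (1 - x l * y) with hP
    set F := PF (r + 1) N with hF
    have e1 : ∑ ν ∈ F, WW y b (r + 1) κ ν * Grec x b (r + 1) N (k + 1) ν =
        ∑ τ ∈ F, (∑ ν ∈ F, WW y b (r + 1) κ ν * DD (x k) b (r + 1) ν τ) * Grec x b (r + 1) N k τ := by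
      simp only [Grec, mul_sum, sum_mul]
      rw [sum_comm]
      grind
    have e2 : y ^ (N + 1 - κ 0) ∣ (∑ τ ∈ F, ((1 - x k * y) *
        (∑ ν ∈ F, WW y b (r + 1) κ ν * DD (x k) b (r + 1) ν τ) -
        ∑ σ ∈ F, DD (x k) b (r + 1) κ σ * WW y b (r + 1) σ τ) * (P * Grec x b (r + 1) N k τ)) := by
      apply Finset.dvd_sum
      intro τ hτ
      apply Dvd.dvd.mul_right
      have hτ' := mem_PF.1 hτ
      by_cases ha : ∀ i, τ (i + 1) ≤ τ i
      · exact commute (x k) y b r N κ τ h1 ha h2 hτ'.2 h3 (hτ'.1 0)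
      · rw [sum_eq_zero, sum_eq_zero]
        · simp
        · intro σ hσ
          by_cases hD : DD (x k) b (r + 1) κ σ = 0
          · grind
          · have hσ2 := (DD_zero _ _ _ _ _ _ hσ hD).2
            push Not at ha
            obtain ⟨i, hi⟩ := ha
            by_cases hir : i < r + 1
            · by_cases hc : τ (i + 1) ≤ σ i
              · rw [WW, prod_eq_zero (i := i) (mem_range.2 hir) (if_neg (by omega)), mul_zero]
              · rw [WW, prod_eq_zero (i := i) (mem_range.2 hir) (if_neg (by omega)), mul_zero]
            · grind
        · intro ν _
          by_cases hD : DD (x k) b (r + 1) ν τ = 0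
          · grind
          · exact absurd (DD_zero _ _ _ _ _ _ hτ hD).2 ha
    have e3 : y ^ (N + 1 - κ 0) ∣ (∑ σ ∈ F, DD (x k) b (r + 1) κ σ *
        (P * (∑ ν ∈ F, WW y b (r + 1) σ ν * Grec x b (r + 1) N k ν) - Grec x b (r + 1) N k σ)) := by
      apply Finset.dvd_sum
      intro σ hσ
      by_cases hD : DD (x k) b (r + 1) κ σ = 0
      · simp_all
      · have hσ2 := DD_zero _ _ _ _ _ _ hσ hD
        have h0 : σ 0 ≤ κ 0 := by grind
        have hσr : ∀ i, r ≤ i → σ i = 0 := by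
          intro i hi
          rcases hσ2.1 i with h | h
          · grind
          · exact (mem_PF.1 hσ).2 i h
        apply Dvd.dvd.mul_left
        exact (pow_dvd_pow y (by omega)).trans (ih σ hσ2.2 hσr (by omega))
    have e4 : (∏ l ∈ range (k + 1), (1 - x l * y)) *
        (∑ ν ∈ F, WW y b (r + 1) κ ν * Grec x b (r + 1) N (k + 1) ν) - Grec x b (r + 1) N (k + 1) κ =
        (∑ τ ∈ F, ((1 - x k * y) *
        (∑ ν ∈ F, WW y b (r + 1) κ ν * DD (x k) b (r + 1) ν τ) -
        ∑ σ ∈ F, DD (x k) b (r + 1) κ σ * WW y b (r + 1) σ τ) * (P * Grec x b (r + 1) N k τ)) +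
        (∑ σ ∈ F, DD (x k) b (r + 1) κ σ *
        (P * (∑ ν ∈ F, WW y b (r + 1) σ ν * Grec x b (r + 1) N k ν) - Grec x b (r + 1) N k σ)) := by
      rw [e1, prod_range_succ]
      have f1 : Grec x b (r + 1) N (k + 1) κ = ∑ σ ∈ F, DD (x k) b (r + 1) κ σ * Grec x b (r + 1) N k σ := rfl
      have f2 : ∑ τ ∈ F, (∑ σ ∈ F, DD (x k) b (r + 1) κ σ * WW y b (r + 1) σ τ) * (P * Grec x b (r + 1) N k τ) =
          ∑ σ ∈ F, DD (x k) b (r + 1) κ σ * (P * ∑ ν ∈ F, WW y b (r + 1) σ ν * Grec x b (r + 1) N k ν) := by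
        simp only [mul_sum, sum_mul]
        rw [sum_comm]
        apply sum_congr rfl; intro τ _
        grind
      have f4 : (∑ τ ∈ F, ((1 - x k * y) *
        (∑ ν ∈ F, WW y b (r + 1) κ ν * DD (x k) b (r + 1) ν τ) -
        ∑ σ ∈ F, DD (x k) b (r + 1) κ σ * WW y b (r + 1) σ τ) * (P * Grec x b (r + 1) N k τ)) =
        P * (1 - x k * y) * (∑ τ ∈ F, (∑ ν ∈ F, WW y b (r + 1) κ ν * DD (x k) b (r + 1) ν τ) *
          Grec x b (r + 1) N k τ) -
        ∑ τ ∈ F, (∑ σ ∈ F, DD (x k) b (r + 1) κ σ * WW y b (r + 1) σ τ) * (P * Grec x b (r + 1) N k τ) := by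
        rw [mul_sum, ← sum_sub_distrib]
        apply sum_congr rfl; intro τ _; ring
      have f5 : (∑ σ ∈ F, DD (x k) b (r + 1) κ σ *
        (P * (∑ ν ∈ F, WW y b (r + 1) σ ν * Grec x b (r + 1) N k ν) - Grec x b (r + 1) N k σ)) =
        ∑ σ ∈ F, DD (x k) b (r + 1) κ σ * (P * ∑ ν ∈ F, WW y b (r + 1) σ ν * Grec x b (r + 1) N k ν) -
        ∑ σ ∈ F, DD (x k) b (r + 1) κ σ * Grec x b (r + 1) N k σ := by
        rw [← sum_sub_distrib]
        apply sum_congr rfl; intro τ _; ring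
      grind
    rw [e4]
    exact dvd_add e2 e3

end CommR

section Pieri
variable {A : Type*} [CommRing A]

theorem DD_map {B : Type*} [CommRing B] (φ : A →+* B) (x b : A) (K : ℕ) (ν τ : ℕ → ℕ) :
    DD (φ x) (φ b) K ν τ = φ (DD x b K ν τ) := by
  rw [DD, DD, map_prod]
  grind

theorem Grec_map {B : Type*} [CommRing B] (φ : A →+* B) (x : ℕ → A) (b : A) (K N k : ℕ) (ν : ℕ → ℕ) :
    Grec (fun l => φ (x l)) (φ b) K N k ν = φ (Grec x b K N k ν) := by
  induction k generalizing ν with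
  | zero => simp only [Grec]; split_ifs <;> simp
  | succ k ih =>
    simp only [Grec, map_sum, map_mul]
    apply sum_congr rfl
    intro τ _
    rw [DD_map, ih]

open Polynomial in
theorem pieri_coeff (x : ℕ → A) (k N : ℕ) : ∃ h : ℕ → A, ∀ (b : A) (r : ℕ) (κ : ℕ → ℕ),
    (∀ i, κ (i + 1) ≤ κ i) → (∀ i, r ≤ i → κ i = 0) → ∀ m, κ 0 + m ≤ N →
    ∑ ν ∈ PF (r + 1) N, (WW (X : A[X]) (C b) (r + 1) κ ν).coeff m * Grec x b (r + 1) N k ν =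
      h m * Grec x b (r + 1) N k κ := by
  set P : A[X] := ∏ l ∈ range k, (1 - C (x l) * X) with hP
  have hX : (X : A[X]) ∣ 1 - P := by
    rw [X_dvd_iff]
    simp [hP, coeff_zero_prod]
  set H : A[X] := ∑ j ∈ range (N + 1), (1 - P) ^ j with hH
  have hPH : P * H = 1 - (1 - P) ^ (N + 1) := by
    have := mul_neg_geom_sum (1 - P) (N + 1)
    grind
  refine ⟨fun m => H.coeff m, ?_⟩
  intro b r κ h1 h2 m hm
  have hp := pieri (fun l => C (x l)) X (C b) r N k κ h1 h2 (by omega)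
  rw [← hP] at hp
  simp only [Grec_map (C : A →+* A[X])] at hp
  set S : A[X] := ∑ ν ∈ PF (r + 1) N, WW X (C b) (r + 1) κ ν * C (Grec x b (r + 1) N k ν) with hS
  have hd : (X : A[X]) ^ (N + 1 - κ 0) ∣ S - H * C (Grec x b (r + 1) N k κ) := by
    have e : S - H * C (Grec x b (r + 1) N k κ) =
        H * (P * S - C (Grec x b (r + 1) N k κ)) + (1 - P) ^ (N + 1) * S := by grind
    rw [e]
    refine dvd_add (hp.mul_left _) (Dvd.dvd.mul_right ?_ _)
    exact (pow_dvd_pow X (by omega)).trans (pow_dvd_pow_of_dvd hX _)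
  rw [X_pow_dvd_iff] at hd
  have := hd m (by omega)
  rw [coeff_sub, coeff_mul_C, hS, finset_sum_coeff, sub_eq_zero] at this
  simp_all

def Stp (K : ℕ) (κ ν e : ℕ → ℕ) : Prop := ∀ i, i < K → κ i ≤ ν i ∧ ν (i + 1) + e i ≤ κ i

def sdeg (K : ℕ) (κ ν e : ℕ → ℕ) : ℕ := ∑ i ∈ range K, ((ν i - κ i) + e i)

open Polynomial in
theorem WW_coeff (b : A) (K : ℕ) (κ ν : ℕ → ℕ) (m : ℕ) :
    (WW (X : A[X]) (C b) K κ ν).coeff m =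
    ∑ e ∈ PF K 1, (if Stp K κ ν e ∧ sdeg K κ ν e = m then (-b) ^ (∑ i ∈ range K, e i) else 0) := by
  have e1 : WW (X : A[X]) (C b) K κ ν = ∑ e ∈ PF K 1, ∏ i ∈ range K,
      (if κ i ≤ ν i ∧ ν (i + 1) + e i ≤ κ i then
        (X : A[X]) ^ ((ν i - κ i) + e i) * C ((-b) ^ (e i)) else 0) := by
    rw [sum_PF K 1 (fun i a => (if κ i ≤ ν i ∧ ν (i + 1) + a ≤ κ i then
        (X : A[X]) ^ ((ν i - κ i) + a) * C ((-b) ^ a) else 0)), WW]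
    apply prod_congr rfl
    intro i _
    rw [sum_range_succ, sum_range_succ, sum_range_zero]
    grind
  rw [e1, finset_sum_coeff]
  apply sum_congr rfl
  intro e _
  by_cases hs : Stp K κ ν e
  · rw [prod_congr rfl (g := fun i => (X : A[X]) ^ ((ν i - κ i) + e i) * C ((-b) ^ (e i)))
      (fun i hi => if_pos (hs i (mem_range.1 hi))), prod_mul_distrib,
      prod_pow_eq_pow_sum, ← map_prod, prod_pow_eq_pow_sum, coeff_mul_C, coeff_X_pow]
    rw [show ∑ i ∈ range K, ((ν i - κ i) + e i) = sdeg K κ ν e from rfl]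
    grind
  · rw [if_neg (fun h => hs h.1)]
    unfold Stp at hs
    push Not at hs
    obtain ⟨i, hi, hc⟩ := hs
    rw [prod_eq_zero (mem_range.2 hi) (if_neg (by
      omega)), coeff_zero]

theorem pieri_step (x : ℕ → A) (k N : ℕ) : ∃ h : ℕ → A, ∀ (b : A) (r : ℕ) (κ : ℕ → ℕ),
    (∀ i, κ (i + 1) ≤ κ i) → (∀ i, r ≤ i → κ i = 0) → ∀ m, κ 0 + m ≤ N →
    ∑ u ∈ PF (r + 1) N ×ˢ PF (r + 1) 1,
      (if Stp (r + 1) κ u.1 u.2 ∧ sdeg (r + 1) κ u.1 u.2 = m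
        then (-b) ^ (∑ i ∈ range (r + 1), u.2 i) else 0) * Grec x b (r + 1) N k u.1 =
      h m * Grec x b (r + 1) N k κ := by
  obtain ⟨h, hh⟩ := pieri_coeff x k N
  refine ⟨h, fun b r κ h1 h2 m hm => ?_⟩
  rw [← hh b r κ h1 h2 m hm, sum_product]
  apply sum_congr rfl
  intro ν _
  rw [WW_coeff, sum_mul]

def Ch {St : Type*} (s0 : St) (U : Finset St) : ℕ → Finset (ℕ → St)
  | 0 => {fun _ => s0}
  | k + 1 => (Ch s0 U k ×ˢ U).image (fun p x => if x ≤ k then p.1 x else p.2)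

theorem mem_Ch {St : Type*} {s0 : St} {U : Finset St} {k : ℕ} {c : ℕ → St} :
    c ∈ Ch s0 U k ↔ c 0 = s0 ∧ (∀ x, x < k → c (x + 1) ∈ U) ∧ ∀ x, k ≤ x → c x = c k := by
  induction k generalizing c with
  | zero =>
    simp only [Ch, mem_singleton]
    grind
  | succ k ih =>
    simp only [Ch, mem_image, mem_product, Prod.exists]
    constructor
    · grind
    · rintro ⟨h1, h2, h3⟩
      refine ⟨fun x => c (min x k), c (k + 1), ⟨?_, h2 k (by omega)⟩, ?_⟩
      · grind
      · grind

theorem sum_Ch_succ {St : Type*} (s0 : St) (U : Finset St) (k : ℕ) (D : ℕ → St → St → A) (g : St → A) :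
    ∑ c ∈ Ch s0 U (k + 1), (∏ x ∈ range (k + 1), D x (c x) (c (x + 1))) * g (c (k + 1)) =
    ∑ c ∈ Ch s0 U k, (∏ x ∈ range k, D x (c x) (c (x + 1))) * ∑ u ∈ U, D k (c k) u * g u := by
  rw [Ch, sum_image, sum_product]
  · apply sum_congr rfl
    intro c _
    rw [mul_sum]
    apply sum_congr rfl
    intro u _
    beta_reduce
    rw [prod_range_succ, if_pos (show k ≤ k from le_rfl), if_neg (show ¬ k + 1 ≤ k by omega), mul_assoc]
    congr 1
    apply prod_congr rfl
    grind
  · rintro ⟨c, u⟩ hc ⟨d, v⟩ hd h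
    simp only [Finset.coe_product, Set.mem_prod, mem_coe] at hc hd h
    have hc' := mem_Ch.1 hc.1
    have hd' := mem_Ch.1 hd.1
    have e : ∀ x, x ≤ k → c x = d x := by
      intro x hx
      have := congrFun h x
      grind
    have e1 : c = d := by grind
    have e2 : u = v := by
      have := congrFun h (k + 1)
      grind
    rw [e1, e2]

theorem sum_Ch_Grec (x : ℕ → A) (b : A) (K N k : ℕ) : ∀ g : (ℕ → ℕ) → A,
    ∑ c ∈ Ch (fun _ => 0) (PF K N) k, (∏ l ∈ range k, DD (x l) b K (c (l + 1)) (c l)) * g (c k) =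
    ∑ τ ∈ PF K N, Grec x b K N k τ * g τ := by
  induction k with
  | zero =>
    intro g
    simp only [Ch, sum_singleton, Finset.range_zero, prod_empty, one_mul, Grec]
    rw [sum_eq_single (fun _ => 0)]
    · simp
    · grind
    · intro h; exact absurd (mem_PF.2 ⟨fun _ => Nat.zero_le _, fun _ _ => rfl⟩) h
  | succ k ih =>
    intro g
    rw [sum_Ch_succ (fun _ => 0) (PF K N) k (fun l a c => DD (x l) b K c a) g,
      ih (fun τ => ∑ u ∈ PF K N, DD (x k) b K u τ * g u)]
    simp only [Grec, mul_sum, sum_mul]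
    rw [sum_comm]
    grind

theorem svt_chain (x : ℕ → A) (b : A) (n N : ℕ) (α : ℕ → ℕ) (h : ℕ → A)
    (hN : ∑ l ∈ range n, α l ≤ N)
    (hh : ∀ κ : ℕ → ℕ, (∀ i, κ (i + 1) ≤ κ i) → (∀ i, n ≤ i → κ i = 0) → ∀ m, κ 0 + m ≤ N →
    ∑ u ∈ PF (n + 1) N ×ˢ PF (n + 1) 1,
      (if Stp (n + 1) κ u.1 u.2 ∧ sdeg (n + 1) κ u.1 u.2 = m
        then (-b) ^ (∑ i ∈ range (n + 1), u.2 i) else 0) * Grec x b (n + 1) N n u.1 =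
      h m * Grec x b (n + 1) N n κ) (k : ℕ) (hk : k ≤ n) :
    ∑ c ∈ Ch ((fun _ => 0, fun _ => 0) : (ℕ → ℕ) × (ℕ → ℕ)) (PF (n + 1) N ×ˢ PF (n + 1) 1) k,
      (∏ l ∈ range k, (if Stp (n + 1) (c l).1 (c (l + 1)).1 (c (l + 1)).2 ∧
        sdeg (n + 1) (c l).1 (c (l + 1)).1 (c (l + 1)).2 = α l
        then (-b) ^ (∑ i ∈ range (n + 1), (c (l + 1)).2 i) else 0)) *
        Grec x b (n + 1) N n (c k).1 =
      (∏ l ∈ range k, h (α l)) * Grec x b (n + 1) N n (fun _ => 0) := by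
  induction k with
  | zero => simp [Ch]
  | succ k ih =>
    rw [sum_Ch_succ (St := (ℕ → ℕ) × (ℕ → ℕ)) _ _ k (fun l s t => (if Stp (n + 1) s.1 t.1 t.2 ∧
        sdeg (n + 1) s.1 t.1 t.2 = α l
        then (-b) ^ (∑ i ∈ range (n + 1), t.2 i) else 0)) (fun s => Grec x b (n + 1) N n s.1),
      prod_range_succ, mul_right_comm, ← ih (by omega), sum_mul]
    apply sum_congr rfl
    intro c hc
    rw [mem_Ch] at hc
    by_cases hv : ∀ l, l < k → Stp (n + 1) (c l).1 (c (l + 1)).1 (c (l + 1)).2 ∧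
        sdeg (n + 1) (c l).1 (c (l + 1)).1 (c (l + 1)).2 = α l
    · have good : ∀ l, l ≤ k → (∀ i, (c l).1 (i + 1) ≤ (c l).1 i) ∧ (∀ i, l ≤ i → (c l).1 i = 0) ∧
          (c l).1 0 ≤ ∑ y ∈ range l, α y := by
        intro l
        induction l with
        | zero => intro _; rw [hc.1]; simp
        | succ l ihl =>
          intro hl
          obtain ⟨g1, g2, g3⟩ := ihl (by omega)
          obtain ⟨v1, v2⟩ := hv l (by omega)
          have hU := hc.2.1 l (by omega)
          rw [mem_product, mem_PF, mem_PF] at hU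
          refine ⟨fun i => ?_, fun i hi => ?_, ?_⟩
          · by_cases hi : i < n + 1
            · have := v1 i hi; omega
            · grind
          · by_cases hi' : i < n + 1
            · have := v1 (i - 1) (by omega)
              grind
            · grind
          · rw [sum_range_succ, ← v2]
            have : ((c (l + 1)).1 0 - (c l).1 0) + (c (l + 1)).2 0 ≤
                sdeg (n + 1) (c l).1 (c (l + 1)).1 (c (l + 1)).2 :=
              single_le_sum (f := fun i => ((c (l + 1)).1 i - (c l).1 i) + (c (l + 1)).2 i)
                (fun _ _ => Nat.zero_le _) (mem_range.2 (by omega))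
            omega
      obtain ⟨g1, g2, g3⟩ := good k le_rfl
      have hle : ∑ y ∈ range (k + 1), α y ≤ ∑ y ∈ range n, α y :=
        sum_le_sum_of_subset (Finset.range_mono hk)
      rw [sum_range_succ] at hle
      have := hh (c k).1 g1 (fun i hi => g2 i (by omega)) (α k) (by omega)
      grind
    · push Not at hv
      obtain ⟨l, hl, hv⟩ := hv
      rw [prod_eq_zero (mem_range.2 hl) (if_neg (fun h => hv h.1 h.2))]
      ring

end Pieri

section Alg
variable {A : Type*} [CommRing A]

def xw (x : ℕ → A) (n : ℕ) (w : List ℕ) : A := ∏ l ∈ range n, x l ^ (w.count (l + 1))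

theorem wd_count (n : ℕ) (C : Dat) (l : ℕ) (hl : l < n) :
    (wd n C).count (l + 1) = ∑ i ∈ range (n + 1), mI C i l := by
  rw [wd, seg_count]
  apply sum_congr rfl
  intro i _
  rw [rowW, rowOf_count, if_pos hl]

theorem Grec_chain (x : ℕ → A) (b : A) (n N : ℕ) (ν : ℕ → ℕ) (h1 : ∀ i, ν (i + 1) ≤ ν i)
    (h2 : ∀ i, n ≤ i → ν i = 0) (h3 : ν 0 ≤ N) :
    Grec x b (n + 1) N n ν = ∑ C ∈ RDs n ν (fun _ => 0),
      ∏ l ∈ range n, ∏ i ∈ range (n + 1),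
        (x l ^ (mI C i l) * b ^ (max (C i l) (C (i + 1) (l + 1)) - C i l)) := by
  have hν : ν ∈ PF (n + 1) N :=
    mem_PF.2 ⟨fun i => (anti_le0 ν h1 i).trans h3, fun i hi => h2 i (by omega)⟩
  have e := sum_Ch_Grec x b (n + 1) N n (fun τ => if τ = ν then 1 else 0)
  rw [sum_eq_single ν (fun τ _ h => by rw [if_neg h, mul_zero]) (fun h => absurd hν h),
    if_pos rfl, mul_one] at e
  rw [← e]
  symm
  apply sum_of_injOn (fun (C : Dat) => (fun x i => C i x : ℕ → ℕ → ℕ))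
  · intro C _ C' _ h
    funext i y
    exact congrFun (congrFun h y) i
  · intro C hC
    rw [mem_coe, mem_RDs h2] at hC
    rw [mem_coe, mem_Ch]
    refine ⟨?_, fun y hy => ?_, fun y hy => ?_⟩
    · funext i; exact hC.zero i
    · rw [mem_PF]
      refine ⟨fun i => ?_, fun i hi => ?_⟩
      · exact (hC.le_lam i _).trans ((anti_le0 ν h1 i).trans h3)
      · have := hC.le_lam i (y + 1); rw [h2 i (by omega)] at this
        grind
    · funext i
      show C i y = C i n
      rw [hC.top i y hy, hC.top i n le_rfl]
  · intro c hc hni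
    by_contra hne
    apply hni
    rw [mem_Ch] at hc
    have hn : c n = ν := by grind
    have hz : ∀ y, c y ∈ PF (n + 1) N := by
      intro y
      have key : ∀ y, y ≤ n → c y ∈ PF (n + 1) N := by
        intro y hy
        rcases y with _ | y
        · rw [hc.1]; exact mem_PF.2 ⟨fun _ => Nat.zero_le _, fun _ _ => rfl⟩
        · grind
      grind
    have hD : ∀ l, l < n → DD (x l) b (n + 1) (c (l + 1)) (c l) ≠ 0 := by
      intro l hl h0
      rw [prod_eq_zero (mem_range.2 hl) h0, zero_mul] at hne
      grind
    refine ⟨fun i y => c y i, ?_, rfl⟩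
    rw [mem_coe, mem_RDs h2]
    refine ⟨fun i => ?_, fun i y => ?_, fun i y => ?_, fun i y hy => ?_⟩
    · grind
    · rcases lt_or_ge y n with h | h
      · rcases (DD_zero _ _ _ N _ _ (hz y) (hD y h)).1 i with h' | h'
        · exact h'
        · have := (mem_PF.1 (hz y)).2 i h'; omega
      · grind
    · rcases lt_or_ge y n with h | h
      · exact (DD_zero _ _ _ N _ _ (hz y) (hD y h)).2 i
      · simp_all
    · grind
  · intro C hC
    rw [mem_RDs h2] at hC
    rw [if_pos (funext fun i => hC.top i n le_rfl), mul_one]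
    apply prod_congr rfl
    intro l _
    rw [DD]
    apply prod_congr rfl
    intro i _
    rw [if_pos ⟨hC.mono i l, hC.anti i l⟩]
    rfl

theorem Grec_one (x : ℕ → A) (n N : ℕ) (ν : ℕ → ℕ) (h1 : ∀ i, ν (i + 1) ≤ ν i)
    (h2 : ∀ i, n ≤ i → ν i = 0) (h3 : ν 0 ≤ N) :
    Grec x 1 (n + 1) N n ν = ∑ C ∈ RDs n ν (fun _ => 0), xw x n (wd n C) := by
  rw [Grec_chain x 1 n N ν h1 h2 h3]
  apply sum_congr rfl
  intro C _
  apply prod_congr rfl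
  intro l hl
  rw [wd_count n C l (mem_range.1 hl)]
  simp only [one_pow, mul_one, prod_pow_eq_pow_sum]

theorem Grec_zero (x : ℕ → A) (n N : ℕ) (ν : ℕ → ℕ) (h1 : ∀ i, ν (i + 1) ≤ ν i)
    (h2 : ∀ i, n ≤ i → ν i = 0) (h3 : ν 0 ≤ N) :
    Grec x 0 (n + 1) N n ν = ∑ C ∈ (TDs n N).filter (fun C => (fun i => C i n) = ν), xw x n (wd n C) := by
  rw [Grec_chain x 0 n N ν h1 h2 h3]
  symm
  apply sum_subset_zero_on_sdiff
  · intro C hC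
    rw [mem_filter, mem_TDs] at hC
    rw [mem_RDs h2]
    have := hC.1.1.rd
    grind
  · intro C hC
    rw [mem_sdiff, mem_RDs h2, mem_filter, mem_TDs] at hC
    obtain ⟨hC, hn⟩ := hC
    by_contra hne
    apply hn
    have hs : (fun i => C i n) = ν := funext fun i => hC.top i n le_rfl
    refine ⟨⟨?_, (hC.le_lam 0 n).trans h3⟩, hs⟩
    apply TD.of_strict
    · grind
    · intro i l hl
      rcases lt_or_ge i (n + 1) with hi | hi
      · by_contra hlt
        apply hne
        apply prod_eq_zero (mem_range.2 hl)
        apply prod_eq_zero (mem_range.2 hi)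
        rw [zero_pow (by omega), mul_zero]
      · have := hC.le_lam (i + 1) (l + 1)
        grind
  · intro C hC
    rw [mem_filter, mem_TDs] at hC
    apply prod_congr rfl
    intro l hl
    rw [wd_count n C l (mem_range.1 hl), ← prod_pow_eq_pow_sum]
    apply prod_congr rfl
    intro i _
    rw [max_eq_left (hC.1.1.strict i l), Nat.sub_self, pow_zero, mul_one]

def exw (n : ℕ) (e : Dat) : ℕ := ∑ i ∈ range (n + 1), (rowE n e i).length

theorem rowS_count (n : ℕ) (s e : Dat) (i l : ℕ) (hl : l < n) :
    (rowS n (s, e) i).count (l + 1) = (s i (l + 1) - s i l) + e i (l + 1) := by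
  simp only [rowS, rowE, rowM, List.count_append, List.count_reverse, rowOf_count, if_pos hl, mS, mE]
  omega

theorem ws_count (n : ℕ) (s e : Dat) (l : ℕ) (hl : l < n) :
    (ws n (s, e)).count (l + 1) =
      sdeg (n + 1) (fun i => s i l) (fun i => s i (l + 1)) (fun i => e i (l + 1)) := by
  rw [ws, seg_count, sdeg]
  apply sum_congr rfl
  intro i _
  rw [rowS_count n s e i l hl]

theorem ws_length' (n : ℕ) (s e : Dat) :
    (ws n (s, e)).length = ∑ l ∈ range n, (ws n (s, e)).count (l + 1) := by
  rw [ws, seg_length]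
  simp only [seg_count]
  rw [sum_comm]
  apply sum_congr rfl
  intro i _
  simp only [rowS, rowE, rowM, List.length_append, List.length_reverse, rowOf_length,
    List.count_append, List.count_reverse, sum_add_distrib]
  congr 1 <;>
  · apply sum_congr rfl
    intro l hl
    rw [rowOf_count, if_pos (mem_range.1 hl)]

theorem svt_sum (x : ℕ → A) (n N : ℕ) : ∃ h : ℕ → A, ∀ (b : A) (α : ℕ → ℕ),
    ∑ l ∈ range n, α l = N →
    ∑ p ∈ (SDs n N).filter (fun p => ∀ l, l < n → (ws n p).count (l + 1) = α l),
      (-b) ^ (exw n p.2) * Grec x b (n + 1) N n (fun i => p.1 i n) =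
    ∏ l ∈ range n, h (α l) := by
  obtain ⟨h, hh⟩ := pieri_step x n N
  refine ⟨h, fun b α hα => ?_⟩
  have hz0 : Grec x b (n + 1) N n (fun _ => 0) = 1 := by
    rw [Grec_chain x b n N _ (fun _ => le_rfl) (fun _ _ => rfl) (Nat.zero_le _)]
    rw [sum_eq_single (fun _ _ => 0)]
    · simp [mI]
    · intro C hC hne
      rw [mem_RDs (fun _ _ => rfl)] at hC
      exact absurd (funext fun i => funext fun y => Nat.le_zero.1 (hC.le_lam i y)) hne
    · intro hn
      exact absurd ((mem_RDs (fun _ _ => rfl)).2 ⟨fun _ => rfl, fun _ _ => le_rfl, fun _ _ => le_rfl,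
        fun _ _ _ => rfl⟩) hn
  have key := svt_chain x b n N α h hα.le (hh b n) n le_rfl
  rw [hz0, mul_one] at key
  rw [← key]
  apply sum_of_injOn
    (fun (p : Dat × Dat) => (fun y => (fun i => p.1 i y, fun i => p.2 i y) : ℕ → (ℕ → ℕ) × (ℕ → ℕ)))
  · rintro ⟨s, e⟩ _ ⟨s', e'⟩ _ h
    have h' := fun y => congrFun h y
    simp only [Prod.mk.injEq] at h'
    rw [Prod.mk.injEq]
    exact ⟨funext fun i => funext fun y => congrFun (h' y).1 i,
      funext fun i => funext fun y => congrFun (h' y).2 i⟩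
  · rintro ⟨s, e⟩ hp
    rw [mem_coe, mem_filter, mem_SDs] at hp
    obtain ⟨⟨hp, hl⟩, hc⟩ := hp
    simp only at hp
    rw [mem_coe, mem_Ch]
    refine ⟨?_, fun y hy => ?_, fun y hy => ?_⟩
    · exact Prod.ext (funext hp.zero) (funext hp.e0)
    · rw [mem_product, mem_PF, mem_PF]
      refine ⟨⟨fun i => ?_, fun i hi => hp.row0 i (by omega) _⟩,
        ⟨fun i => hp.e1 i _, fun i hi => hp.rowe0 i (by omega) _⟩⟩
      have h4 : s i (y + 1) ≤ s i n := monotone_nat_of_le_succ (hp.mono i) (by omega)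
      rcases lt_or_ge i (n + 1) with hi | hi
      · have := hp.len i hi
        grind
      · show s i (y + 1) ≤ N
        rw [hp.row0 i (by omega)]; omega
    · exact Prod.ext (funext fun i => hp.top i y hy) (funext fun i => hp.etop i y hy)
  · intro c hc hni
    by_contra hne
    apply hni
    rw [mem_Ch] at hc
    have hS : ∀ l, l < n → Stp (n + 1) (c l).1 (c (l + 1)).1 (c (l + 1)).2 ∧
        sdeg (n + 1) (c l).1 (c (l + 1)).1 (c (l + 1)).2 = α l := by
      intro l hl
      by_contra h0
      rw [prod_eq_zero (mem_range.2 hl) (if_neg h0), zero_mul] at hne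
      grind
    have key : ∀ y, y ≤ n → c y ∈ PF (n + 1) N ×ˢ PF (n + 1) 1 := by
      intro y hy
      rcases y with _ | y
      · rw [hc.1, mem_product, mem_PF, mem_PF]
        grind
      · grind
    have hz : ∀ y, c y ∈ PF (n + 1) N ×ˢ PF (n + 1) 1 := by grind
    have hz1 : ∀ y i, n + 1 ≤ i → (c y).1 i = 0 := fun y i hi =>
      (mem_PF.1 (mem_product.1 (hz y)).1).2 i hi
    have hz2 : ∀ y i, n + 1 ≤ i → (c y).2 i = 0 := fun y i hi =>
      (mem_PF.1 (mem_product.1 (hz y)).2).2 i hi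
    have hcnt : ∀ l, l < n → (ws n (fun i y => (c y).1 i, fun i y => (c y).2 i)).count (l + 1) = α l := by
      intro l hl
      rw [ws_count n _ _ l hl]
      grind
    refine ⟨(fun i y => (c y).1 i, fun i y => (c y).2 i), ?_, rfl⟩
    rw [mem_coe, mem_filter, mem_SDs]
    refine ⟨⟨⟨fun i => ?_, fun i y => ?_, fun i y hy => ?_, fun i y => ?_, fun i => ?_, fun i y hy => ?_,
      fun i y hy => ?_⟩, ?_⟩, hcnt⟩
    · grind
    · show (c y).1 i ≤ (c (y + 1)).1 i
      rcases lt_or_ge y n with h | h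
      · rcases lt_or_ge i (n + 1) with hi | hi
        · exact ((hS y h).1 i hi).1
        · grind
      · grind
    · grind
    · exact (mem_PF.1 (mem_product.1 (hz y)).2).1 i
    · grind
    · grind
    · show (c (y + 1)).1 (i + 1) + (c (y + 1)).2 i ≤ (c y).1 i
      rcases lt_or_ge i (n + 1) with hi | hi
      · exact ((hS y hy).1 i hi).2
      · grind
    · rw [ws_length', ← hα]
      exact sum_congr rfl fun l hl => hcnt l (mem_range.1 hl)
  · rintro ⟨s, e⟩ hp
    rw [mem_filter, mem_SDs] at hp
    obtain ⟨⟨hp, hl⟩, hc⟩ := hp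
    simp only at hp
    beta_reduce
    congr 1
    rw [exw, ← prod_pow_eq_pow_sum]
    have e1 : ∀ l ∈ range n, (if Stp (n + 1) (fun i => s i l) (fun i => s i (l + 1)) (fun i => e i (l + 1)) ∧
        sdeg (n + 1) (fun i => s i l) (fun i => s i (l + 1)) (fun i => e i (l + 1)) = α l
        then (-b) ^ (∑ i ∈ range (n + 1), e i (l + 1)) else 0) =
        ∏ i ∈ range (n + 1), (-b) ^ (e i (l + 1)) := by
      intro l hl
      rw [mem_range] at hl
      rw [if_pos, prod_pow_eq_pow_sum]
      refine ⟨fun i _ => ⟨hp.mono i l, hp.strict i l hl⟩, ?_⟩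
      rw [← hc l hl, ws_count n s e l hl]
    rw [prod_congr rfl e1, prod_comm]
    apply prod_congr rfl
    intro i _
    rw [prod_pow_eq_pow_sum, rowE, List.length_reverse, rowOf_length]
    rfl

theorem TD.sum_ge {n : ℕ} : ∀ (m : ℕ) (Q : Dat), TD n Q → (wd n Q).sum = m →
    Q = Hd (fun i => Q i n) ∨ (wd n (Hd (fun i => Q i n))).sum < (wd n Q).sum := by
  intro m
  induction m using Nat.strong_induction_on with
  | _ m ih =>
    intro Q hQ hm
    by_cases hy : ∀ v, opn (v + 1) (wd n Q) = 0
    · exact Or.inl (hQ.yam hy)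
    · push Not at hy
      obtain ⟨v, hv⟩ := hy
      have hv : 0 < opn (v + 1) (wd n Q) := by omega
      have hvn : v + 2 ≤ n := (wd_mem (opn_pos_mem _ _ hv)).2
      obtain ⟨D, d1, d2, d3⟩ := hQ.ew v hvn hv
      have hs := sum_ew _ _ hv
      grind

theorem TD.anti {n : ℕ} {Q : Dat} (h : TD n Q) (i : ℕ) : Q (i + 1) n ≤ Q i n := h.rd.anti i n

def FF (x : ℕ → A) (b : A) (n N : ℕ) (ν : ℕ → ℕ) : A :=
  ∑ p ∈ (SDs n N).filter (fun p => KnuthEquiv (ws n p) (wd n (Hd ν))),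
    (-b) ^ (exw n p.2) * Grec x b (n + 1) N n (fun i => p.1 i n)

theorem FF_rel {n : ℕ} (hR : HasRect n) (x : ℕ → A) (b : A) (N : ℕ) (α : ℕ → ℕ) :
    ∑ p ∈ (SDs n N).filter (fun p => ∀ l, l < n → (ws n p).count (l + 1) = α l),
      (-b) ^ (exw n p.2) * Grec x b (n + 1) N n (fun i => p.1 i n) =
    ∑ Q ∈ (TDs n N).filter (fun Q => ∀ l, l < n → (wd n Q).count (l + 1) = α l),
      FF x b n N (fun i => Q i n) := by
  rw [sum_filter, Crys.group hR (SDs_crys n N), sum_filter]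
  apply sum_congr rfl
  intro Q hQ
  have hcount : ∀ p ∈ (SDs n N).filter (fun p => KnuthEquiv (ws n p) (wd n Q)), ∀ l,
      (ws n p).count (l + 1) = (wd n Q).count (l + 1) := by
    intro p hp l
    exact (knuth_perm (mem_filter.1 hp).2).count_eq _
  by_cases hc : ∀ l, l < n → (wd n Q).count (l + 1) = α l
  · rw [if_pos hc, FF]
    have := (SDs_crys n N).zconst (fun t : (ℕ → ℕ) × (ℕ → ℕ) =>
      (-b) ^ (∑ i ∈ range (n + 1), t.2 i) * Grec x b (n + 1) N n t.1) _ Q (mem_TDs.1 hQ).1 rfl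
    simp only [exw]
    rw [← this]
    apply sum_congr rfl
    grind
  · rw [if_neg hc]
    apply sum_eq_zero
    grind

theorem wd_count_big (n : ℕ) (C : Dat) (l : ℕ) (hl : n ≤ l) : (wd n C).count (l + 1) = 0 :=
  List.count_eq_zero_of_not_mem (fun h => by have := wd_mem h; omega)

theorem FF_eq {n : ℕ} (hR : HasRect n) (x : ℕ → A) (N : ℕ) : ∀ (m : ℕ) (ν : ℕ → ℕ), (∀ i, ν (i + 1) ≤ ν i) →
    (∀ i, n ≤ i → ν i = 0) → ∑ i ∈ range n, ν i = N → (wd n (Hd ν)).sum = m →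
    FF x 1 n N ν = FF x 0 n N ν := by
  obtain ⟨h, hh⟩ := svt_sum x n N
  intro m
  induction m using Nat.strong_induction_on with
  | _ m ih =>
    intro ν h1 h2 hN hm
    have e := (hh 1 ν hN).trans (hh 0 ν hN).symm
    rw [FF_rel hR, FF_rel hR] at e
    have hH := Hd_TD n ν h1 h2
    have hsh : (fun i => Hd ν i n) = ν := funext hH.2
    have hmem : Hd ν ∈ (TDs n N).filter (fun Q => ∀ l, l < n → (wd n Q).count (l + 1) = ν l) := by
      rw [mem_filter, mem_TDs, hH.2]
      refine ⟨⟨hH.1, ?_⟩, fun l _ => TD.count_highest ν h1 h2 l⟩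
      rcases Nat.eq_zero_or_pos n with h0 | h0
      · grind
      · rw [← hN]; exact single_le_sum (fun _ _ => Nat.zero_le _) (mem_range.2 h0)
    rw [← Finset.add_sum_erase _ _ hmem, ← Finset.add_sum_erase _ _ hmem, hsh] at e
    have e2 : ∀ Q ∈ ((TDs n N).filter (fun Q => ∀ l, l < n → (wd n Q).count (l + 1) = ν l)).erase (Hd ν),
        FF x 1 n N (fun i => Q i n) = FF x 0 n N (fun i => Q i n) := by
      intro Q hQ
      rw [mem_erase, mem_filter, mem_TDs] at hQ
      obtain ⟨hne, ⟨hQ, _⟩, hc⟩ := hQ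
      have hperm : (wd n Q).Perm (wd n (Hd ν)) := by
        rw [List.perm_iff_count]
        intro a
        rcases a with _ | l
        · rw [List.count_eq_zero_of_not_mem (fun h => by have := wd_mem h; omega),
            List.count_eq_zero_of_not_mem (fun h => by have := wd_mem h; omega)]
        · rcases lt_or_ge l n with hl | hl
          · grind
          · rw [wd_count_big n _ l hl, wd_count_big n _ l hl]
      have hlow : ∀ i, n ≤ i → Q i n = 0 := fun i hi => hQ.low n i hi
      rcases TD.sum_ge _ Q hQ rfl with h | h
      · exfalso
        apply hne
        rw [h]
        congr 1
        funext i
        rw [← TD.count_highest (n := n) (fun i => Q i n) hQ.anti hlow i, ← h]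
        rcases lt_or_ge i n with hl | hl
        · grind
        · rw [wd_count_big n _ i hl, h2 i hl]
      · rw [hperm.sum_eq, hm] at h
        apply ih _ h _ hQ.anti hlow _ rfl
        have t1 := hQ.total
        have t2 := hH.1.total
        rw [hperm.length_eq, t2, sum_range_succ, sum_range_succ, hlow n le_rfl,
          hH.2 n, h2 n le_rfl] at t1
        grind
    rw [sum_congr rfl e2] at e
    grind

theorem FF_zero (x : ℕ → A) (n N : ℕ) (ν : ℕ → ℕ) (h1 : ∀ i, ν (i + 1) ≤ ν i)
    (h2 : ∀ i, n ≤ i → ν i = 0) (hN : ∑ i ∈ range n, ν i = N) :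
    FF x 0 n N ν = Grec x 0 (n + 1) N n ν := by
  have hH := Hd_TD n ν h1 h2
  have hw : ∀ s : Dat, TD n s → ws n (s, fun _ _ => 0) = wd n s := by
    intro s hs
    apply seg_congr
    intro i _ _
    have e1 : rowE n (fun _ _ => 0) i = [] := by
      rw [rowE, List.reverse_eq_nil_iff, ← List.length_eq_zero_iff, rowOf_length]
      simp [mE]
    simp only [rowS, e1, List.nil_append, rowM, rowW]
    congr 1
    funext y
    simp only [mS, mI]
    rw [max_eq_left (hs.strict i y)]
  have hSD : ∀ s : Dat, TD n s → SD n s (fun _ _ => 0) := by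
    intro s hs
    exact ⟨hs.rd.zero, hs.rd.mono, fun i y hy => hs.rd.top i y hy, fun _ _ => by simp, fun _ => rfl,
      fun _ _ _ => rfl, fun i y _ => by simpa using hs.strict i y⟩
  rw [FF, sum_eq_single (Hd ν, fun _ _ => 0)]
  · have : exw n (fun _ _ => 0) = 0 := by simp [exw, rowE, rowOf_length, mE]
    simp_all
  · rintro ⟨s, e⟩ hp hne
    rw [mem_filter, mem_SDs] at hp
    obtain ⟨⟨hp, hl⟩, hk⟩ := hp
    simp only at hp
    by_cases h0 : exw n e = 0
    · exfalso
      apply hne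
      have he : e = fun _ _ => 0 := by
        funext i y
        have key : ∀ y, y < n → i < n + 1 → e i (y + 1) = 0 := by
          intro y hy hi
          rw [exw, sum_eq_zero_iff] at h0
          have := h0 i (mem_range.2 hi)
          rw [rowE, List.length_reverse, rowOf_length, sum_eq_zero_iff] at this
          exact this y (mem_range.2 hy)
        have key2 : ∀ y, y ≤ n → e i y = 0 := by
          intro y hy
          rcases y with _ | y
          · exact hp.e0 i
          · rcases lt_or_ge i (n + 1) with hi | hi
            · grind
            · exact hp.rowe0 i (by omega) _
        rcases le_total y n with hy | hy
        · grind
        · rw [hp.etop i y hy]; exact key2 n le_rfl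
      subst he
      have hs : TD n s := by
        have hst : ∀ i y, y < n → s (i + 1) (y + 1) ≤ s i y := fun i y hy => by
          simpa using hp.strict i y hy
        refine TD.of_strict ⟨hp.zero, hp.mono, fun i y => ?_, fun i y hy => hp.top i y hy⟩ hst
        have : ∀ y, y ≤ n → s (i + 1) y ≤ s i y := by
          intro y hy
          rcases y with _ | y
          · rw [hp.zero, hp.zero]
          · exact (hst i y (by omega)).trans (hp.mono i y)
        rcases le_total y n with hy | hy
        · grind
        · rw [hp.top _ y hy, hp.top _ y hy]; exact this n le_rfl
      rw [hw s hs] at hk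
      rw [TD.uniq _ s (Hd ν) hs hH.1 rfl hk]
    · simp_all
  · intro hn
    exfalso
    apply hn
    rw [mem_filter, mem_SDs, hw _ hH.1]
    refine ⟨⟨hSD _ hH.1, ?_⟩, knuth_refl _⟩
    rw [hH.1.total, sum_range_succ, hH.2 n, h2 n le_rfl, ← hN]
    grind

theorem FF_main {n : ℕ} (hR : HasRect n) (x : ℕ → A) (N : ℕ) (ν : ℕ → ℕ) (h1 : ∀ i, ν (i + 1) ≤ ν i)
    (h2 : ∀ i, n ≤ i → ν i = 0) (hN : ∑ i ∈ range n, ν i = N) :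
    FF x 1 n N ν = Grec x 0 (n + 1) N n ν := by
  rw [FF_eq hR x N _ ν h1 h2 hN rfl, FF_zero x n N ν h1 h2 hN]

end Alg

section Alg2
variable {A : Type*} [CommRing A]

def cont (w : List ℕ) : ℕ → ℕ := fun v => w.count (v + 1)

theorem xw_perm (x : ℕ → A) (n : ℕ) {w w' : List ℕ} (h : w.Perm w') : xw x n w = xw x n w' := by
  unfold xw
  grind

theorem cont_anti {w : List ℕ} (h : ∀ v, opn (v + 1) w = 0) (i : ℕ) : cont w (i + 1) ≤ cont w i := by
  have h1 := cls_opn_count (i + 1) w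
  rw [h i] at h1
  simp only [cont]
  omega

theorem cont_big {n : ℕ} {w : List ℕ} (h : ∀ a ∈ w, 1 ≤ a ∧ a ≤ n) (i : ℕ) (hi : n ≤ i) : cont w i = 0 :=
  List.count_eq_zero_of_not_mem (fun hm => by have := h _ hm; omega)

theorem cont_sum {n : ℕ} {w : List ℕ} (h : ∀ a ∈ w, 1 ≤ a ∧ a ≤ n) :
    ∑ i ∈ range n, cont w i = w.length := by
  induction w with
  | nil => simp [cont]
  | cons a w ih =>
    have ha := h a (by simp)
    have := ih (fun b hb => h b (by simp [hb]))
    simp only [cont, List.count_cons, List.length_cons, sum_add_distrib] at this ⊢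
    rw [this]
    congr 1
    rw [sum_eq_single (a - 1)]
    · simp; omega
    · grind
    · grind

theorem lhs_schur {n : ℕ} (hR : HasRect n) (x : ℕ → A) (lam mu : ℕ → ℕ) (hl : ∀ i, n ≤ i → lam i = 0)
    (τ : (ℕ → ℕ) → A) :
    ∑ C ∈ RDs n lam mu, τ (fun i => (rowW n C i).length) * xw x n (wd n C) =
    ∑ C ∈ (RDs n lam mu).filter (fun C => ∀ v, opn (v + 1) (wd n C) = 0),
      τ (fun i => (rowW n C i).length) *
        Grec x 0 (n + 1) (wd n C).length n (cont (wd n C)) := by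
  have hcr := RDs_crys n lam mu hl
  set N0 := ∑ i ∈ range (n + 1), lam i with hN0
  rw [Crys.group hR hcr]
  have e1 : ∀ Q ∈ TDs n N0, ∑ C ∈ (RDs n lam mu).filter (fun C => KnuthEquiv (wd n C) (wd n Q)),
      τ (fun i => (rowW n C i).length) * xw x n (wd n C) =
      ∑ C ∈ (RDs n lam mu).filter (fun C => ∀ v, opn (v + 1) (wd n C) = 0),
        if (fun i => Q i n) = cont (wd n C) then τ (fun i => (rowW n C i).length) * xw x n (wd n Q) else 0 := by
    intro Q hQ
    have hQ' := (mem_TDs.1 hQ).1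
    rw [sum_congr rfl (fun C hC => by
      rw [xw_perm x n (knuth_perm (mem_filter.1 hC).2)]), ← sum_mul]
    have z := hcr.zconst τ _ Q hQ' rfl
    rw [z, sum_mul, ← sum_filter, Finset.filter_filter]
    apply sum_congr _ (fun _ _ => rfl)
    apply Finset.filter_congr
    intro C _
    rw [equiv_highest_iff hR _ hQ'.anti (fun i hi => hQ'.low n i hi) _ (fun a ha => wd_mem ha)]
    constructor
    · rintro ⟨h1, h2⟩; exact ⟨h1, funext fun v => (h2 v).symm⟩
    · rintro ⟨h1, h2⟩; exact ⟨h1, fun v => (congrFun h2 v).symm⟩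
  rw [sum_congr rfl e1, sum_comm]
  apply sum_congr rfl
  intro C hC
  rw [mem_filter] at hC
  have hlen := hcr.len C hC.1
  have hb := cont_big (n := n) (w := wd n C) (fun a ha => wd_mem ha)
  have h0 : cont (wd n C) 0 ≤ (wd n C).length := List.count_le_length
  have g1 := Grec_zero x n N0 (cont (wd n C)) (cont_anti hC.2) hb (by omega)
  have g2 : Grec x 0 (n + 1) N0 n (cont (wd n C)) = Grec x 0 (n + 1) (wd n C).length n (cont (wd n C)) := by
    rw [Grec_chain x 0 n N0 _ (cont_anti hC.2) hb (by omega),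
      Grec_chain x 0 n (wd n C).length _ (cont_anti hC.2) hb (by omega)]
  rw [← g2, g1, mul_sum, sum_filter]

theorem abstract_main {n : ℕ} (hR : HasRect n) (x : ℕ → A) (lam mu : ℕ → ℕ) (hl : ∀ i, n ≤ i → lam i = 0)
    (τ : (ℕ → ℕ) → A) (Qof : Dat → Dat)
    (hQ : ∀ C ∈ RDs n lam mu, (∀ v, opn (v + 1) (wd n C) = 0) → TD n (Qof C) ∧
      (fun i => Qof C i n) = cont (wd n C)) :
    ∑ C ∈ RDs n lam mu, τ (fun i => (rowW n C i).length) * xw x n (wd n C) =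
    ∑ C ∈ (RDs n lam mu).filter (fun C => ∀ v, opn (v + 1) (wd n C) = 0),
      ∑ p ∈ (SDs n (wd n C).length).filter (fun p => KnuthEquiv (ws n p) (wd n (Qof C))),
      τ (fun i => (rowW n C i).length) * ((-1) ^ (exw n p.2) *
        ∑ D ∈ RDs n (fun i => p.1 i n) (fun _ => 0), xw x n (wd n D)) := by
  rw [lhs_schur hR x lam mu hl τ]
  apply sum_congr rfl
  intro C hC
  rw [mem_filter] at hC
  obtain ⟨q1, q2⟩ := hQ C hC.1 hC.2
  have hb := cont_big (n := n) (w := wd n C) (fun a ha => wd_mem ha)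
  rw [← FF_main hR x _ _ (cont_anti hC.2) hb (cont_sum (fun a ha => wd_mem ha)), FF, ← q2, ← mul_sum]
  congr 1
  set N := (wd n C).length
  have z := (SDs_crys n N).zconst (fun t : (ℕ → ℕ) × (ℕ → ℕ) =>
      (-1 : A) ^ (∑ i ∈ range (n + 1), t.2 i) * Grec x 1 (n + 1) N n t.1) _ _ q1 rfl
  simp only [exw]
  rw [← z]
  apply sum_congr rfl
  intro p hp
  rw [mem_filter, mem_SDs] at hp
  congr 1
  have hsd := hp.1.1
  apply Grec_one
  · intro i
    show p.1 (i + 1) n ≤ p.1 i n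
    rcases lt_or_ge 0 n with h0 | h0
    · have := hsd.strict i (n - 1) (by omega)
      rw [Nat.sub_add_cancel (by omega)] at this
      have := hsd.mono i (n - 1)
      grind
    · rw [hsd.row0 _ (by omega)]; omega
  · intro i hi; exact hsd.row0 i hi n
  · have := hsd.len 0 (by omega)
    grind

end Alg2

def cn (M : ℕ) (P : ℕ → Prop) : ℕ := ((range M).filter P).card

theorem cn_lt (M : ℕ) (P : ℕ → Prop) (hP : ∀ j, j + 1 < M → P (j + 1) → P j) (j : ℕ) :
    j < cn M P ↔ j < M ∧ P j := by
  have hd : ∀ a b, a ≤ b → b < M → P b → P a := by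
    intro a b hab
    induction b, hab using Nat.le_induction with
    | base => exact fun _ => id
    | succ b _ ih => exact fun hM h => ih (by omega) (hP b hM h)
  constructor
  · intro h
    by_contra hc
    have : (range M).filter P ⊆ range j := by grind
    have := card_le_card this
    rw [card_range] at this
    unfold cn at h; omega
  · rintro ⟨h1, h2⟩
    have : range (j + 1) ⊆ (range M).filter P := by grind
    have := card_le_card this
    rw [card_range] at this
    unfold cn; omega

theorem nat_lt_ext {a b : ℕ} (h : ∀ j, j < a ↔ j < b) : a = b := by
  have h1 := h a
  have h2 := h b
  omega

def rl (sh : Finset Cell) (i : ℕ) : ℕ := cn (sh.sup Prod.snd + 1) (fun j => (i, j) ∈ sh)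

theorem snd_lt {sh : Finset Cell} {i j : ℕ} (h : (i, j) ∈ sh) : j < sh.sup Prod.snd + 1 :=
  Nat.lt_succ_of_le (Finset.le_sup (f := Prod.snd) h)

theorem fst_lt {sh : Finset Cell} {i j : ℕ} (h : (i, j) ∈ sh) : i < sh.sup Prod.fst + 1 :=
  Nat.lt_succ_of_le (Finset.le_sup (f := Prod.fst) h)

theorem mem_rl {sh : Finset Cell} (h : IsPartitionShape sh) (i j : ℕ) :
    (i, j) ∈ sh ↔ j < rl sh i := by
  rw [rl, cn_lt _ _ (fun j _ hj => h _ _ _ _ hj le_rfl (by omega))]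
  exact ⟨fun h => ⟨snd_lt h, h⟩, fun h => h.2⟩

theorem rl_anti {sh : Finset Cell} (h : IsPartitionShape sh) (i : ℕ) : rl sh (i + 1) ≤ rl sh i := by
  by_contra hc
  have h1 := (mem_rl h (i + 1) (rl sh i)).2 (by omega)
  have h2 := (mem_rl h i (rl sh i)).1 (h _ _ _ _ h1 (by omega) le_rfl)
  omega

theorem rl_zero {sh : Finset Cell} (h : IsPartitionShape sh) {n : ℕ} (hn : AtMostRows sh n) (i : ℕ)
    (hi : n ≤ i) : rl sh i = 0 := by
  by_contra hc
  have := hn _ ((mem_rl h i 0).2 (by omega))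
  omega

theorem anti_all (f : ℕ → ℕ) (h : ∀ i, f (i + 1) ≤ f i) {i j : ℕ} (hij : i ≤ j) : f j ≤ f i :=
  antitone_nat_of_succ_le h hij

def shOf (n : ℕ) (ν : ℕ → ℕ) : Finset Cell :=
  (range n ×ˢ range (ν 0)).filter (fun c => c.2 < ν c.1)

theorem mem_shOf {n : ℕ} {ν : ℕ → ℕ} (h1 : ∀ i, ν (i + 1) ≤ ν i) (h2 : ∀ i, n ≤ i → ν i = 0)
    (i j : ℕ) : (i, j) ∈ shOf n ν ↔ j < ν i := by
  simp only [shOf, mem_filter, mem_product, mem_range]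
  constructor
  · omega
  · intro h
    have := anti_all ν h1 (Nat.zero_le i)
    grind

theorem shOf_part {n : ℕ} {ν : ℕ → ℕ} (h1 : ∀ i, ν (i + 1) ≤ ν i) (h2 : ∀ i, n ≤ i → ν i = 0) :
    IsPartitionShape (shOf n ν) := by
  intro i j i' j' h hi hj
  rw [mem_shOf h1 h2] at h ⊢
  have := anti_all ν h1 hi
  omega

theorem rl_shOf {n : ℕ} {ν : ℕ → ℕ} (h1 : ∀ i, ν (i + 1) ≤ ν i) (h2 : ∀ i, n ≤ i → ν i = 0) :
    rl (shOf n ν) = ν := by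
  funext i
  apply nat_lt_ext
  intro j
  rw [← mem_rl (shOf_part h1 h2), mem_shOf h1 h2]

theorem sh_ext {s s' : Finset Cell} (h : IsPartitionShape s) (h' : IsPartitionShape s')
    (e : rl s = rl s') : s = s' := by
  ext ⟨i, j⟩
  rw [mem_rl h, mem_rl h', e]

structure RG (n : ℕ) (s : Finset Cell) (L M : ℕ → ℕ) (R : Cell → ℕ) (C : Dat) : Prop where
  hs : ∀ i j, (i, j) ∈ s ↔ M i ≤ j ∧ j < L i
  hn : ∀ i, n ≤ i → L i = 0
  rd : RD n L M C
  off : ∀ c, c ∉ s → R c = 0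
  gal : ∀ i j x, j < C i x ↔ j < L i ∧ R (i, j) ≤ x

def CofR (L : ℕ → ℕ) (R : Cell → ℕ) : Dat := fun i x => cn (L i) (fun j => R (i, j) ≤ x)

def RofC (n : ℕ) (L : ℕ → ℕ) (C : Dat) : Cell → ℕ := fun c =>
  if c.2 < L c.1 then cn n (fun x => C c.1 x ≤ c.2) else 0

theorem RG.of_rpp {n : ℕ} {s : Finset Cell} {L M : ℕ → ℕ} {R : Cell → ℕ}
    (hs : ∀ i j, (i, j) ∈ s ↔ M i ≤ j ∧ j < L i) (hn : ∀ i, n ≤ i → L i = 0)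
    (hL : ∀ i, L (i + 1) ≤ L i) (hM : ∀ i, M (i + 1) ≤ M i) (hML : ∀ i, M i ≤ L i)
    (h : IsRPPOn s R) (hR : ∀ c ∈ s, R c ≤ n) : RG n s L M R (CofR L R) := by
  obtain ⟨h1, h2, h3, h4⟩ := h
  have gal : ∀ i j x, j < CofR L R i x ↔ j < L i ∧ R (i, j) ≤ x := by
    intro i j x
    apply cn_lt
    grind
  refine ⟨hs, hn, ⟨fun i => ?_, fun i x => ?_, fun i x => ?_, fun i x hx => ?_⟩, h2, gal⟩
  · apply nat_lt_ext
    grind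
  · by_contra hc
    have e1 := gal i (CofR L R i (x + 1)) x
    have e2 := gal i (CofR L R i (x + 1)) (x + 1)
    omega
  · by_contra hc
    have e1 := (gal (i + 1) (CofR L R i x) x).1 (by omega)
    have e2 := gal i (CofR L R i x) x
    grind
  · apply nat_lt_ext
    grind

theorem RG.of_rd {n : ℕ} {s : Finset Cell} {L M : ℕ → ℕ} {C : Dat}
    (hs : ∀ i j, (i, j) ∈ s ↔ M i ≤ j ∧ j < L i) (hn : ∀ i, n ≤ i → L i = 0)
    (h : RD n L M C) : RG n s L M (RofC n L C) C := by
  have key : ∀ i j, j < L i → ∀ x, x < RofC n L C (i, j) ↔ x < n ∧ C i x ≤ j := by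
    intro i j hj x
    simp only [RofC, if_pos hj]
    apply cn_lt
    intro x _ hx
    have := h.mono i x
    omega
  refine ⟨hs, hn, h, ?_, ?_⟩
  · rintro ⟨i, j⟩ hc
    by_cases hj : j < L i
    · by_contra h0
      have := (key i j hj 0).1 (by omega)
      rw [h.zero] at this
      grind
    · simp [RofC, hj]
  · intro i j x
    constructor
    · intro hj
      have hL := h.le_lam i x
      grind
    · rintro ⟨hj, hx⟩
      have := key i j hj x
      by_cases hxn : x < n
      · omega
      · rw [h.top i x (by omega)]; exact hj

theorem RG.rpp {n : ℕ} {s : Finset Cell} {L M : ℕ → ℕ} {R : Cell → ℕ} {C : Dat}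
    (h : RG n s L M R C) : IsRPPOn s R ∧ ∀ c ∈ s, R c ≤ n := by
  refine ⟨⟨?_, h.off, ?_, ?_⟩, ?_⟩
  · rintro ⟨i, j⟩ hc
    have e := h.gal i j 0
    rw [h.rd.zero] at e
    have := (h.hs _ _).1 hc
    omega
  · intro i j h1 h2
    have e1 := (h.gal i (j + 1) (R (i, j + 1))).2 ⟨((h.hs _ _).1 h2).2, le_rfl⟩
    exact ((h.gal i j (R (i, j + 1))).1 (by omega)).2
  · intro i j h1 h2
    have e1 := (h.gal (i + 1) j (R (i + 1, j))).2 ⟨((h.hs _ _).1 h2).2, le_rfl⟩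
    have := h.rd.anti i (R (i + 1, j))
    exact ((h.gal i j (R (i + 1, j))).1 (by omega)).2
  · rintro ⟨i, j⟩ hc
    have := ((h.hs _ _).1 hc).2
    exact ((h.gal i j n).1 (by rw [h.rd.top i n le_rfl]; exact this)).2

theorem RG.uniqC {n : ℕ} {s : Finset Cell} {L M : ℕ → ℕ} {R : Cell → ℕ} {C C' : Dat}
    (h : RG n s L M R C) (h' : RG n s L M R C') : C = C' := by
  funext i x
  exact nat_lt_ext (fun j => by rw [h.gal, h'.gal])

theorem RG.uniqR {n : ℕ} {s : Finset Cell} {L M : ℕ → ℕ} {R R' : Cell → ℕ} {C : Dat}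
    (h : RG n s L M R C) (h' : RG n s L M R' C) : R = R' := by
  funext ⟨i, j⟩
  by_cases hc : (i, j) ∈ s
  · have hj := ((h.hs _ _).1 hc).2
    have e1 := h.gal i j (R (i, j))
    have e2 := h'.gal i j (R (i, j))
    have e3 := h.gal i j (R' (i, j))
    have e4 := h'.gal i j (R' (i, j))
    omega
  · rw [h.off _ hc, h'.off _ hc]

theorem slist_ext {l l' : List ℕ} (h : l.Pairwise (· < ·)) (h' : l'.Pairwise (· < ·))
    (hc : ∀ x, x ∈ l ↔ x ∈ l') : l = l' := by
  have n1 : l.Nodup := h.imp (fun h => Nat.ne_of_lt h)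
  have n2 : l'.Nodup := h'.imp (fun h => Nat.ne_of_lt h)
  exact ((List.perm_ext_iff_of_nodup n1 n2).2 hc).eq_of_pairwise (fun a b _ _ h1 h2 => by omega) h h'

theorem rowList_sorted (s : Finset Cell) (i : ℕ) : (rowList s i).Pairwise (· < ·) :=
  List.Pairwise.filter _ List.pairwise_lt_range

theorem mem_rowList (s : Finset Cell) (i j : ℕ) : j ∈ rowList s i ↔ (i, j) ∈ s := by
  simp only [rowList, List.mem_filter, List.mem_range, decide_eq_true_eq]
  exact ⟨fun h => h.2, fun h => ⟨snd_lt h, h⟩⟩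

theorem outer {n : ℕ} (s : Finset Cell) (hs : ∀ c ∈ s, c.1 < n) (F : ℕ → List ℕ)
    (hF : ∀ i, rowList s i = [] → F i = []) :
    ((List.range (s.sup Prod.fst + 1)).reverse.map F).flatten = seg F 0 (n + 1) := by
  rw [flatten_eq_seg]
  apply seg_extend
  intro i hi
  apply hF
  rw [List.eq_nil_iff_forall_not_mem]
  intro j hj
  rw [mem_rowList] at hj
  have h1 := hs _ hj
  have h2 := fst_lt hj
  omega

theorem count_map_nodup (l : List ℕ) (hl : l.Nodup) (f : ℕ → ℕ) (v : ℕ) (F : Finset ℕ)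
    (hF : ∀ j, j ∈ F ↔ j ∈ l ∧ f j = v) : (l.map f).count v = F.card := by
  rw [List.count_eq_countP, List.countP_map, List.countP_eq_length_filter]
  have : F = (l.filter ((fun x => x == v) ∘ f)).toFinset := by
    ext j; simp [hF]
  rw [this, List.toFinset_card_of_nodup (hl.filter _)]

def kp (s : Finset Cell) (R : Cell → ℕ) (i : ℕ) : List ℕ :=
  (rowList s i).filter (fun j => decide ((i + 1, j) ∉ s ∨ R (i + 1, j) ≠ R (i, j)))

theorem kp_sorted (s : Finset Cell) (R : Cell → ℕ) (i : ℕ) : (kp s R i).Pairwise (· < ·) :=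
  List.Pairwise.filter _ (rowList_sorted s i)

theorem mem_kp (s : Finset Cell) (R : Cell → ℕ) (i j : ℕ) :
    j ∈ kp s R i ↔ (i, j) ∈ s ∧ ((i + 1, j) ∉ s ∨ R (i + 1, j) ≠ R (i, j)) := by
  simp [kp, mem_rowList]

theorem RG.val {n : ℕ} {s : Finset Cell} {L M : ℕ → ℕ} {R : Cell → ℕ} {C : Dat}
    (h : RG n s L M R C) (i j x : ℕ) :
    ((i, j) ∈ s ∧ R (i, j) = x + 1) ↔ C i x ≤ j ∧ j < C i (x + 1) := by
  have e1 := h.gal i j x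
  have e2 := h.gal i j (x + 1)
  have e3 := h.hs i j
  have e4 := h.rd.mono' i (Nat.zero_le x)
  rw [h.rd.zero] at e4
  grind

theorem RG.keep {n : ℕ} {s : Finset Cell} {L M : ℕ → ℕ} {R : Cell → ℕ} {C : Dat}
    (h : RG n s L M R C) (i j x : ℕ) :
    (j ∈ kp s R i ∧ R (i, j) = x + 1) ↔ max (C i x) (C (i + 1) (x + 1)) ≤ j ∧ j < C i (x + 1) := by
  rw [mem_kp]
  have e1 := h.val i j x
  have e2 := h.val (i + 1) j x
  have a1 := h.rd.anti i x
  grind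

theorem RG.row {n : ℕ} {s : Finset Cell} {L M : ℕ → ℕ} {R : Cell → ℕ} {C : Dat}
    (h : RG n s L M R C) (i : ℕ) : (kp s R i).map (fun j => R (i, j)) = rowW n C i := by
  have hr := h.rpp
  apply eq_rowOf
  · rw [List.pairwise_map]
    refine (kp_sorted s R i).imp_of_mem ?_
    intro a b ha hb hab
    rw [mem_kp] at ha hb
    have h1 := (h.hs _ _).1 hb.1
    have e1 := (h.gal i b (R (i, b))).2 ⟨h1.2, le_rfl⟩
    exact ((h.gal i a (R (i, b))).1 (by omega)).2
  · intro x hx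
    rw [List.mem_map] at hx
    obtain ⟨j, hj, rfl⟩ := hx
    rw [mem_kp] at hj
    exact ⟨hr.1.1 _ hj.1, hr.2 _ hj.1⟩
  · intro x hx
    rw [count_map_nodup _ ((kp_sorted s R i).imp (fun h => Nat.ne_of_lt h)) _ _
      (Ico (max (C i x) (C (i + 1) (x + 1))) (C i (x + 1)))]
    · rw [Nat.card_Ico]; rfl
    · intro j
      rw [mem_Ico, h.keep]

theorem RG.rows_lt {n : ℕ} {s : Finset Cell} {L M : ℕ → ℕ} {R : Cell → ℕ} {C : Dat}
    (h : RG n s L M R C) : ∀ c ∈ s, c.1 < n := by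
  rintro ⟨i, j⟩ hc
  have := (h.hs _ _).1 hc
  by_contra h1
  have := h.hn i (by simpa using h1)
  omega

theorem RG.word {n : ℕ} {s : Finset Cell} {L M : ℕ → ℕ} {R : Cell → ℕ} {C : Dat}
    (h : RG n s L M R C) : rppRowWord s R = wd n C := by
  have e : rppRowWord s R = ((List.range (s.sup Prod.fst + 1)).reverse.map (fun i =>
    (kp s R i).map (fun j => R (i, j)))).flatten := by
    unfold rppRowWord kp
    grind
  rw [e, outer s h.rows_lt]
  · unfold wd; congr; funext i; exact h.row i
  · intro i hi
    simp [kp, hi]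

theorem RG.heights {n : ℕ} {s : Finset Cell} {L M : ℕ → ℕ} {R : Cell → ℕ} {C : Dat}
    (h : RG n s L M R C) :
    rppHeights s R = seg (fun i => List.replicate (rowW n C i).length (i + 1)) 0 (n + 1) := by
  have e : rppHeights s R = ((List.range (s.sup Prod.fst + 1)).reverse.map (fun i =>
    (kp s R i).map (fun j => i + 1))).flatten := by
    unfold rppHeights kp
    grind
  rw [e, outer s h.rows_lt]
  · congr; funext i; rw [← h.row i]; simp
  · intro i hi
    simp [kp, hi]

theorem RG.ceq {n : ℕ} {s : Finset Cell} {L M : ℕ → ℕ} {R : Cell → ℕ} {C : Dat}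
    (h : RG n s L M R C) (i : ℕ) : ceqOn s R i = L i - M i - (rowW n C i).length := by
  rw [← h.row i, List.length_map]
  have e1 : (kp s R i).toFinset.card = (kp s R i).length :=
    List.toFinset_card_of_nodup ((kp_sorted s R i).imp (fun h => Nat.ne_of_lt h))
  have e2 : (Ico (M i) (L i)).card = L i - M i := Nat.card_Ico _ _
  have e3 : (kp s R i).toFinset ⊆ Ico (M i) (L i) := by
    intro j hj
    rw [List.mem_toFinset, mem_kp] at hj
    rw [mem_Ico]
    exact (h.hs _ _).1 hj.1
  have e4 : ceqOn s R i = (Ico (M i) (L i) \ (kp s R i).toFinset).card := by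
    unfold ceqOn
    symm
    apply card_bij (fun j _ => (i, j))
    · intro j hj
      simp only [mem_sdiff, mem_Ico, List.mem_toFinset, mem_kp] at hj
      have h1 := (h.hs i j).2 hj.1
      grind
    · grind
    · rintro ⟨a, b⟩ hb
      simp only [mem_filter] at hb
      obtain ⟨h1, rfl, h2, h3⟩ := hb
      refine ⟨b, ?_, rfl⟩
      simp only [mem_sdiff, mem_Ico, List.mem_toFinset, mem_kp]
      refine ⟨(h.hs _ _).1 h1, ?_⟩
      grind
  grind

theorem RG.wt {n : ℕ} {s : Finset Cell} {L M : ℕ → ℕ} {R : Cell → ℕ} {C : Dat}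
    (h : RG n s L M R C) (x : ℕ) (hx : x < n) : wtRPP s R (x + 1) = (wd n C).count (x + 1) := by
  rw [wd_count _ _ _ hx]
  have e : ∀ i, mI C i x = (Ico (max (C i x) (C (i + 1) (x + 1))) (C i (x + 1))).card := by
    intro i; rw [Nat.card_Ico]; rfl
  simp only [e]
  rw [← card_biUnion]
  · unfold wtRPP
    congr 1
    ext j
    simp only [mem_filter, mem_biUnion, mem_range, mem_Ico]
    constructor
    · rintro ⟨_, i, hi⟩
      have hv : ∀ i, n ≤ i → ¬ j < C i (x + 1) := by
        intro i hi
        have := h.rd.le_lam i (x + 1)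
        rw [h.hn i hi] at this
        omega
      rw [h.val] at hi
      by_contra hc
      push Not at hc
      have key : ∀ d, C (i + d) x ≤ j ∧ j < C (i + d) (x + 1) := by
        intro d
        induction d with
        | zero => exact hi
        | succ d ih =>
          have h1 : i + d < n + 1 := by grind
          have h2 := hc (i + d) h1
          have h3 := h.rd.anti (i + d) x
          grind
      exact hv (i + n) (by omega) (key n).2
    · rintro ⟨i, _, hi⟩
      rw [max_le_iff] at hi
      have := (h.val i j x).2 ⟨hi.1.1, hi.2⟩
      exact ⟨snd_lt this.1, i, this⟩
  · intro a _ b _ hab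
    rw [Function.onFun, Finset.disjoint_left]
    intro j ha hb
    rw [mem_Ico, max_le_iff] at ha hb
    have an : ∀ a b, a < b → C b (x + 1) ≤ C (a + 1) (x + 1) := fun a b hab =>
      anti_all (fun i => C i (x + 1)) (fun i => h.rd.anti i (x + 1)) hab
    rcases lt_or_gt_of_ne hab with hl | hl
    · grind
    · grind

theorem biword_append {t1 b1 t2 b2 : List ℕ} (h1 : IsBiword t1 b1) (h2 : IsBiword t2 b2)
    (h : ∀ x ∈ t1, ∀ y ∈ t2, y < x) : IsBiword (t1 ++ t2) (b1 ++ b2) := by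
  obtain ⟨l1, p1, q1, r1⟩ := h1
  obtain ⟨l2, p2, q2, r2⟩ := h2
  refine ⟨by simp [l1, l2], ?_, ?_, ?_⟩
  · grind
  · grind
  · intro p hp
    rw [List.length_append] at hp
    by_cases c1 : p + 1 < t1.length
    · grind
    · by_cases c2 : p + 1 = t1.length
      · grind
      · rw [List.getD_append_right _ _ _ _ (show t1.length ≤ p + 1 by omega),
          List.getD_append_right _ _ _ _ (show t1.length ≤ p by omega),
          List.getD_append_right _ _ _ _ (show b1.length ≤ p + 1 by omega),
          List.getD_append_right _ _ _ _ (show b1.length ≤ p by omega), ← l1,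
          show p + 1 - t1.length = p - t1.length + 1 by omega]
        grind

theorem biword_const (k : ℕ) (hk : 1 ≤ k) (l : List ℕ) (hl : l.Pairwise (· ≤ ·)) (h1 : ∀ x ∈ l, 1 ≤ x) :
    IsBiword (List.replicate l.length k) l := by
  refine ⟨by simp, fun x hx => by rw [List.eq_of_mem_replicate hx]; exact hk, h1, ?_⟩
  intro p hp
  rw [List.length_replicate] at hp
  rw [List.getD_eq_getElem _ _ (show p + 1 < (List.replicate l.length k).length by simpa using hp),
    List.getD_eq_getElem _ _ (show p < (List.replicate l.length k).length by simp; omega),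
    List.getD_eq_getElem _ _ hp, List.getD_eq_getElem _ _ (show p < l.length by omega)]
  simp only [List.getElem_replicate]
  refine ⟨le_rfl, fun h => ?_⟩
  have := List.pairwise_iff_getElem.1 hl p (p + 1) (by omega) hp (by omega)
  omega

theorem biword_seg (L : ℕ → List ℕ) (hL : ∀ i, (L i).Pairwise (· ≤ ·)) (h1 : ∀ i, ∀ x ∈ L i, 1 ≤ x)
    (K : ℕ) : IsBiword (seg (fun i => List.replicate (L i).length (i + 1)) 0 K) (seg L 0 K) ∧
      ∀ x ∈ seg (fun i => List.replicate (L i).length (i + 1)) 0 K, x ≤ K := by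
  induction K with
  | zero => exact ⟨⟨rfl, by simp [seg], by simp [seg], by simp [seg]⟩, by simp [seg]⟩
  | succ K ih =>
    simp only [seg]
    constructor
    · refine biword_append (biword_const _ (by omega) _ (hL _) (h1 _)) ih.1 ?_
      grind
    · grind

def hts (n : ℕ) (C : Dat) : List ℕ := seg (fun i => List.replicate (rowW n C i).length (i + 1)) 0 (n + 1)

theorem hts_biword (n : ℕ) (C : Dat) : IsBiword (hts n C) (wd n C) :=
  (biword_seg (rowW n C) (fun i => rowOf_sorted _ _) (fun i x hx => (rowOf_mem _ _ _ hx).1) (n + 1)).1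

theorem hts_count (n : ℕ) (C : Dat) (i : ℕ) (hi : i < n + 1) :
    (hts n C).count (i + 1) = (rowW n C i).length := by
  rw [hts, seg_count, sum_eq_single i]
  · simp
  · grind
  · grind

theorem hts_mem (n : ℕ) {L M : ℕ → ℕ} {C : Dat} (h : RD n L M C) (hn : ∀ i, n ≤ i → L i = 0) (x : ℕ)
    (hx : x ∈ hts n C) : 1 ≤ x ∧ x ≤ n := by
  obtain ⟨i, hi⟩ := seg_mem _ _ _ _ hx
  have h1 := List.eq_of_mem_replicate hi
  have h2 : (rowW n C i).length ≠ 0 := by grind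
  have h3 := h.row_len i
  grind

theorem RD.eq_of_hts {n : ℕ} {L M : ℕ → ℕ} {C C' : Dat} (h : RD n L M C) (h' : RD n L M C')
    (hn : ∀ i, n ≤ i → L i = 0) (e1 : hts n C = hts n C') (e2 : wd n C = wd n C') : C = C' := by
  apply RD.inj h h' (fun i hi => hn i (by omega)) e2
  intro i
  by_cases hi : i < n + 1
  · rw [← hts_count n C i hi, ← hts_count n C' i hi, e1]
  · have h3 := h.row_len i
    have h4 := h'.row_len i
    grind

theorem wtS_pos {s : Finset Cell} {T : Cell → ℕ} {c : Cell} (hc : c ∈ s) : 0 < wtS s T (T c) := by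
  unfold wtS
  apply sum_pos'
  · omega
  · grind

theorem mem_of_wt {s : Finset Cell} {T : Cell → ℕ} {w : List ℕ}
    (h : ∀ v, wtS s T v = @List.count ℕ (@instBEqOfDecidableEq ℕ (fun a b => Classical.propDecidable (a = b))) v w)
    {c : Cell} (hc : c ∈ s) : T c ∈ w := by
  have h1 := wtS_pos (T := T) hc
  grind

theorem ssyt_low {sh : Finset Cell} {T : Cell → ℕ} (hp : IsPartitionShape sh) (h : IsSSYTOn sh T)
    (i j : ℕ) (hc : (i, j) ∈ sh) : i + 1 ≤ T (i, j) := by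
  induction i with
  | zero => exact h.1 _ hc
  | succ i ih =>
    have h1 := hp _ _ i j hc (by omega) le_rfl
    have := ih h1
    have := h.2.2.2 i j h1 hc
    omega

theorem ssyt_rpp {sh : Finset Cell} {T : Cell → ℕ} (h : IsSSYTOn sh T) : IsRPPOn sh T :=
  ⟨h.1, h.2.1, h.2.2.1, fun i j h1 h2 => (h.2.2.2 i j h1 h2).le⟩

theorem ssyt_rg {n : ℕ} {sh : Finset Cell} {T : Cell → ℕ} (hp : IsPartitionShape sh) (h : IsSSYTOn sh T)
    (hT : ∀ c ∈ sh, T c ≤ n) : RG n sh (rl sh) (fun _ => 0) T (CofR (rl sh) T) ∧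
      TD n (CofR (rl sh) T) ∧ (∀ i, CofR (rl sh) T i n = rl sh i) ∧
      readingWordOn sh T = wd n (CofR (rl sh) T) := by
  have hrows : AtMostRows sh n := by
    rintro ⟨i, j⟩ hc
    have h1 := ssyt_low hp h i j hc
    grind
  have hg : RG n sh (rl sh) (fun _ => 0) T (CofR (rl sh) T) :=
    RG.of_rpp (fun i j => by rw [mem_rl hp]; simp) (rl_zero hp hrows) (rl_anti hp) (fun _ => le_rfl)
      (fun _ => Nat.zero_le _) (ssyt_rpp h) hT
  have hn : ∀ i, CofR (rl sh) T i n = rl sh i := fun i => hg.rd.top i n le_rfl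
  refine ⟨hg, ?_, hn, ?_⟩
  · apply TD.of_strict
    · rw [show (fun i => CofR (rl sh) T i n) = rl sh from funext hn]
      exact hg.rd
    · intro i x hx
      by_contra hc
      have e1 := (hg.gal (i + 1) (CofR (rl sh) T i x) (x + 1)).1 (by omega)
      have m1 := (mem_rl hp _ _).2 e1.1
      have m2 := hp _ _ i _ m1 (by omega) le_rfl
      have := h.2.2.2 _ _ m2 m1
      have e2 := (hg.gal i (CofR (rl sh) T i x) x).2 ⟨(mem_rl hp _ _).1 m2, by omega⟩
      omega
  · rw [← hg.word]
    unfold readingWordOn rppRowWord rowWordOn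
    congr 2
    funext i
    congr 1
    symm
    rw [List.filter_eq_self]
    intro j hj
    rw [mem_rowList] at hj
    refine @decide_eq_true _ (Classical.propDecidable _) ?_
    by_cases h1 : (i + 1, j) ∈ sh
    · right
      have := h.2.2.2 i j hj h1
      omega
    · grind

theorem hasRect (B : BurgeData) (n : ℕ) : HasRect n := by
  intro w hw
  have hb : IsBiword ((List.range w.length).reverse.map (· + 1)) w := by
    refine ⟨by simp, fun x hx => ?_, fun x hx => (hw x hx).1, ?_⟩
    · grind
    · grind
  have hp := B.shape_part _ _ hb
  have hs := B.ssytP _ _ hb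
  have hk := B.knuthP _ _ hb
  have hc := B.contentP _ _ hb
  have hT : ∀ c ∈ (B.out ((List.range w.length).reverse.map (· + 1)) w).sh,
    (B.out ((List.range w.length).reverse.map (· + 1)) w).P c ≤ n :=
    fun c h => (hw _ (mem_of_wt hc h)).2
  obtain ⟨_, h1, _, h2⟩ := ssyt_rg hp hs hT
  grind

theorem rowList_part {sh : Finset Cell} (h : IsPartitionShape sh) (i : ℕ) :
    rowList sh i = List.range (rl sh i) := by
  apply slist_ext (rowList_sorted sh i) List.pairwise_lt_range
  intro j
  rw [mem_rowList, mem_rl h, List.mem_range]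

structure SG (n : ℕ) (sh : Finset Cell) (S : Cell → Finset ℕ) (s e : Dat) : Prop where
  part : IsPartitionShape sh
  sd : SD n s e
  shp : ∀ i, rl sh i = s i n
  mem : ∀ i j x, x ∈ S (i, j) ↔ (1 ≤ x ∧ x ≤ n) ∧
    ((s i (x - 1) ≤ j ∧ j < s i x) ∨ (e i x = 1 ∧ s i (x - 1) = j + 1))

theorem SD.mono' {n : ℕ} {s e : Dat} (h : SD n s e) (i : ℕ) {x y : ℕ} (hxy : x ≤ y) : s i x ≤ s i y :=
  monotone_nat_of_le_succ (h.mono i) hxy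

theorem SG.up {n : ℕ} {sh : Finset Cell} {S : Cell → Finset ℕ} {s e : Dat} (h : SG n sh S s e)
    {i j x : ℕ} (hx : x ∈ S (i, j)) : j < s i x := by
  have h1 := (h.mem i j x).1 hx
  have := h.sd.mono' i (show x - 1 ≤ x by omega)
  omega

theorem SG.min {n : ℕ} {sh : Finset Cell} {S : Cell → Finset ℕ} {s e : Dat} (h : SG n sh S s e)
    {i j : ℕ} (hj : j < s i n) : boxMin (S (i, j)) ∈ S (i, j) ∧
      ∀ x, boxMin (S (i, j)) ≤ x ↔ j < s i x := by
  have hex : ∃ x, j < s i x := ⟨n, hj⟩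
  obtain ⟨y, hy1, hy2⟩ : ∃ y, j < s i y ∧ ∀ z, z < y → ¬ j < s i z :=
    ⟨Nat.find hex, Nat.find_spec hex, fun z hz => Nat.find_min hex hz⟩
  have hy0 : 1 ≤ y := by
    by_contra hc
    have : y = 0 := by omega
    rw [this, h.sd.zero] at hy1
    omega
  have hyn : y ≤ n := by grind
  have hyS : y ∈ S (i, j) := (h.mem i j y).2 ⟨⟨hy0, hyn⟩, Or.inl ⟨by
    grind, hy1⟩⟩
  have hle : ∀ z ∈ S (i, j), y ≤ z := by
    intro z hz
    by_contra hc
    exact hy2 z (by omega) (h.up hz)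
  have hb : boxMin (S (i, j)) = y := by
    unfold boxMin
    apply le_antisymm
    · exact Nat.sInf_le hyS
    · exact hle _ (Nat.sInf_mem (s := (↑(S (i, j)) : Set ℕ)) ⟨y, hyS⟩)
  rw [hb]
  refine ⟨hyS, fun x => ⟨fun hx => ?_, fun hx => ?_⟩⟩
  · have := h.sd.mono' i hx; omega
  · grind

theorem SG.svt {n : ℕ} {sh : Finset Cell} {S : Cell → Finset ℕ} {s e : Dat} (h : SG n sh S s e) :
    IsSVTOn n sh S := by
  have hsh : ∀ i j, (i, j) ∈ sh ↔ j < s i n := fun i j => by rw [mem_rl h.part, h.shp]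
  refine ⟨?_, ?_, ?_, ?_, ?_⟩
  · rintro ⟨i, j⟩ hc
    exact ⟨_, (h.min ((hsh i j).1 hc)).1⟩
  · rintro ⟨i, j⟩ hc
    rw [Finset.eq_empty_iff_forall_notMem]
    intro x hx
    apply hc
    rw [hsh]
    have h1 := h.up hx
    have := h.sd.mono' i ((h.mem i j x).1 hx).1.2
    omega
  · rintro ⟨i, j⟩ x hx
    exact ((h.mem i j x).1 hx).1
  · intro i j _ _ x hx y hy
    have h1 := h.up hy
    have h2 := ((h.mem i j x).1 hx)
    by_contra hc
    have := h.sd.mono' i (show y ≤ x - 1 by omega)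
    omega
  · intro i j _ _ x hx y hy
    have h1 := h.up hy
    have h2 := ((h.mem i j x).1 hx)
    have h3 := ((h.mem (i + 1) j y).1 hy)
    have h4 := h.sd.strict i (x - 1) (by omega)
    have h5 := h.sd.strict i (y - 1) (by omega)
    rw [show x - 1 + 1 = x by omega] at h4
    rw [show y - 1 + 1 = y by omega] at h5
    by_contra hc
    have h6 := h.sd.mono' (i + 1) (show y ≤ x by omega)
    omega

theorem SG.ext {n : ℕ} {sh : Finset Cell} {S : Cell → Finset ℕ} {s e : Dat} (h : SG n sh S s e)
    (i j x : ℕ) : (x ∈ S (i, j) ∧ x ≠ boxMin (S (i, j))) ↔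
      (1 ≤ x ∧ x ≤ n) ∧ e i x = 1 ∧ s i (x - 1) = j + 1 := by
  constructor
  · rintro ⟨h1, h2⟩
    have h3 := (h.mem i j x).1 h1
    refine ⟨h3.1, ?_⟩
    rcases h3.2 with h4 | h4
    · exfalso
      have h5 := h.sd.mono' i h3.1.2
      have h6 := (h.min (show j < s i n by omega)).2
      grind
    · exact h4
  · rintro ⟨h1, h2, h3⟩
    refine ⟨(h.mem i j x).2 ⟨h1, Or.inr ⟨h2, h3⟩⟩, ?_⟩
    have h5 := h.sd.mono' i (show x - 1 ≤ n by omega)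
    have h6 := (h.min (show j < s i n by omega)).2
    grind

theorem SG.ext_ex {n : ℕ} {sh : Finset Cell} {S : Cell → Finset ℕ} {s e : Dat} (h : SG n sh S s e)
    (i x : ℕ) (hx : 1 ≤ x ∧ x ≤ n) : e i x = 1 ↔ ∃ j, x ∈ S (i, j) ∧ x ≠ boxMin (S (i, j)) := by
  constructor
  · intro he
    have h1 := h.sd.strict i (x - 1) (by omega)
    rw [show x - 1 + 1 = x by omega] at h1
    exact ⟨s i (x - 1) - 1, (h.ext i _ x).2 ⟨hx, he, by omega⟩⟩
  · rintro ⟨j, hj⟩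
    exact ((h.ext i j x).1 hj).2.1

theorem SG.uniqD {n : ℕ} {sh : Finset Cell} {S : Cell → Finset ℕ} {s e s' e' : Dat} (h : SG n sh S s e)
    (h' : SG n sh S s' e') : s = s' ∧ e = e' := by
  have hn : ∀ i, s i n = s' i n := fun i => by rw [← h.shp, h'.shp]
  constructor
  · funext i x
    apply nat_lt_ext
    intro j
    have key : ∀ {s e : Dat}, SG n sh S s e → (j < s i x ↔ j < s i n ∧ boxMin (S (i, j)) ≤ x) := by
      intro s e h
      constructor
      · intro hj
        have : j < s i n := by
          have := h.sd.mono' i (le_max_left x n)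
          rw [h.sd.top i _ (le_max_right x n)] at this
          omega
        exact ⟨this, ((h.min this).2 x).2 hj⟩
      · rintro ⟨h1, h2⟩
        exact ((h.min h1).2 x).1 h2
    grind
  · have key : ∀ i x, 1 ≤ x ∧ x ≤ n → e i x = e' i x := by
      intro i x hx
      have h1 := h.ext_ex i x hx
      have h2 := h'.ext_ex i x hx
      have h3 := h.sd.e1 i x
      have h4 := h'.sd.e1 i x
      grind
    funext i x
    by_cases hx0 : x = 0
    · rw [hx0, h.sd.e0, h'.sd.e0]
    · by_cases hxn : x ≤ n
      · grind
      · rw [h.sd.etop i x (by omega), h'.sd.etop i x (by omega)]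
        by_cases hn0 : n = 0
        · rw [hn0, h.sd.e0, h'.sd.e0]
        · grind

theorem SG.uniqS {n : ℕ} {sh sh' : Finset Cell} {S S' : Cell → Finset ℕ} {s e : Dat} (h : SG n sh S s e)
    (h' : SG n sh' S' s e) : sh = sh' ∧ S = S' := by
  constructor
  · exact sh_ext h.part h'.part (funext fun i => by rw [h.shp, h'.shp])
  · funext ⟨i, j⟩
    ext x
    rw [h.mem, h'.mem]

def SofD (n : ℕ) (s e : Dat) : Cell → Finset ℕ := fun c => (Icc 1 n).filter
  (fun x => (s c.1 (x - 1) ≤ c.2 ∧ c.2 < s c.1 x) ∨ (e c.1 x = 1 ∧ s c.1 (x - 1) = c.2 + 1))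

theorem SD.topanti {n : ℕ} {s e : Dat} (h : SD n s e) (i : ℕ) : s (i + 1) n ≤ s i n := by
  by_cases hn : n = 0
  · rw [hn, h.zero, h.zero]
  · have h1 := h.strict i (n - 1) (by omega)
    have h2 := h.mono' i (show n - 1 ≤ n by omega)
    grind

theorem SG.of_sd {n : ℕ} {s e : Dat} (h : SD n s e) : SG n (shOf n (fun i => s i n)) (SofD n s e) s e := by
  have h1 : ∀ i, s (i + 1) n ≤ s i n := h.topanti
  have h2 : ∀ i, n ≤ i → s i n = 0 := fun i hi => h.row0 i hi n
  refine ⟨shOf_part h1 h2, h, fun i => by rw [rl_shOf h1 h2], fun i j x => ?_⟩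
  simp only [SofD, mem_filter, mem_Icc]

def sOf (sh : Finset Cell) (S : Cell → Finset ℕ) : Dat :=
  fun i x => cn (rl sh i) (fun j => boxMin (S (i, j)) ≤ x)

def eOf (n : ℕ) (S : Cell → Finset ℕ) : Dat :=
  fun i x => if ∃ j, min x n ∈ S (i, j) ∧ min x n ≠ boxMin (S (i, j)) then 1 else 0

theorem SG.of_svt {n : ℕ} {sh : Finset Cell} {S : Cell → Finset ℕ} (hp : IsPartitionShape sh)
    (h : IsSVTOn n sh S) : SG n sh S (sOf sh S) (eOf n S) := by
  obtain ⟨h1, h2, h3, h4, h5⟩ := h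
  have hmem : ∀ i j x, x ∈ S (i, j) → (i, j) ∈ sh := by grind
  have hm : ∀ i j, (i, j) ∈ sh → boxMin (S (i, j)) ∈ S (i, j) := by
    intro i j hc
    obtain ⟨y, hy⟩ := h1 _ hc
    exact Nat.sInf_mem (s := (↑(S (i, j)) : Set ℕ)) ⟨y, hy⟩
  have hle : ∀ i j x, x ∈ S (i, j) → boxMin (S (i, j)) ≤ x := fun i j x hx =>
    Nat.sInf_le (show x ∈ (↑(S (i, j)) : Set ℕ) from hx)
  have gal : ∀ i j x, j < sOf sh S i x ↔ (i, j) ∈ sh ∧ boxMin (S (i, j)) ≤ x := by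
    intro i j x
    rw [mem_rl hp]
    apply cn_lt
    intro j hj hb
    have m1 := (mem_rl hp i (j + 1)).2 hj
    have m2 := (mem_rl hp i j).2 (by omega)
    grind
  have hshp : ∀ i x, n ≤ x → sOf sh S i x = rl sh i := by
    intro i x hx
    apply nat_lt_ext
    intro j
    rw [gal, ← mem_rl hp]
    grind
  have hmono : ∀ i x, sOf sh S i x ≤ sOf sh S i (x + 1) := by
    intro i x
    by_contra hc
    have e1 := (gal i (sOf sh S i (x + 1)) x).1 (by omega)
    have e2 := (gal i (sOf sh S i (x + 1)) (x + 1)).2 ⟨e1.1, by omega⟩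
    omega
  have hmono' : ∀ i x y, x ≤ y → sOf sh S i x ≤ sOf sh S i y := fun i x y hxy =>
    monotone_nat_of_le_succ (hmono i) hxy
  have hE : ∀ i x, x ≤ n → (eOf n S i x = 1 ↔ ∃ j, x ∈ S (i, j) ∧ x ≠ boxMin (S (i, j))) := by
    intro i x hx
    simp only [eOf, min_eq_left hx]
    simp_all
  have hE1 : ∀ i x, eOf n S i x ≤ 1 := by
    intro i x; unfold eOf; split_ifs <;> omega
  have hpos : ∀ i j x, x ∈ S (i, j) → x ≠ boxMin (S (i, j)) → sOf sh S i (x - 1) = j + 1 := by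
    intro i j x hx hne
    have hc := hmem _ _ _ hx
    have hl := hle _ _ _ hx
    have e1 := (gal i j (x - 1)).2 ⟨hc, by omega⟩
    by_contra hcon
    have e2 := (gal i (j + 1) (x - 1)).1 (by omega)
    grind
  refine ⟨hp, ⟨?_, hmono, ?_, hE1, ?_, ?_, ?_⟩, fun i => (hshp i n le_rfl).symm, ?_⟩
  · intro i
    by_contra hc
    have e1 := (gal i 0 0).1 (by omega)
    grind
  · grind
  · grind
  · intro i x hx
    simp only [eOf, min_eq_right hx, min_self]
  · intro i x hx
    have e0 : sOf sh S (i + 1) (x + 1) ≤ sOf sh S i x := by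
      by_contra hc
      have e1 := (gal (i + 1) (sOf sh S i x) (x + 1)).1 (by omega)
      have m2 := hp _ _ i (sOf sh S i x) e1.1 (by omega) le_rfl
      grind
    have e1 := hE1 i (x + 1)
    by_cases he : eOf n S i (x + 1) = 1
    · obtain ⟨j, hj, hne⟩ := (hE i (x + 1) (by omega)).1 he
      have e2 := hpos i j _ hj hne
      rw [show x + 1 - 1 = x by omega] at e2
      by_contra hc
      have e3 := (gal (i + 1) j (x + 1)).1 (by omega)
      grind
    · omega
  · grind

theorem sdesc_ext {l l' : List ℕ} (h : l.Pairwise (· > ·)) (h' : l'.Pairwise (· > ·))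
    (hc : ∀ x, x ∈ l ↔ x ∈ l') : l = l' := by
  have n1 : l.Nodup := h.imp (fun h => Nat.ne_of_gt h)
  have n2 : l'.Nodup := h'.imp (fun h => Nat.ne_of_gt h)
  exact ((List.perm_ext_iff_of_nodup n1 n2).2 hc).eq_of_pairwise (fun a b _ _ h1 h2 => by omega) h h'

theorem mem_boxExtras (A : Finset ℕ) (x : ℕ) : x ∈ boxExtras A ↔ x ∈ A ∧ x ≠ boxMin A := by
  simp only [boxExtras, List.mem_reverse, List.mem_filter, List.mem_range, decide_eq_true_eq]
  exact ⟨fun h => h.2, fun h => ⟨Nat.lt_succ_of_le (Finset.le_sup (f := id) h.1), h⟩⟩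

theorem boxExtras_desc (A : Finset ℕ) : (boxExtras A).Pairwise (· > ·) := by
  unfold boxExtras
  rw [List.pairwise_reverse]
  exact List.Pairwise.filter _ List.pairwise_lt_range

theorem boxExtras_length (A : Finset ℕ) (h : A.Nonempty) : (boxExtras A).length + 1 = A.card := by
  have hm : boxMin A ∈ A := by
    obtain ⟨y, hy⟩ := h
    exact Nat.sInf_mem (s := (↑A : Set ℕ)) ⟨y, hy⟩
  have e : (boxExtras A).toFinset = A.erase (boxMin A) := by
    ext x
    rw [List.mem_toFinset, mem_boxExtras, mem_erase, and_comm]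
  rw [← List.toFinset_card_of_nodup ((boxExtras_desc A).imp (fun h => Nat.ne_of_gt h)), e,
    card_erase_add_one hm]

theorem SG.rowMin {n : ℕ} {sh : Finset Cell} {S : Cell → Finset ℕ} {s e : Dat} (h : SG n sh S s e)
    (i : ℕ) : (rowList sh i).map (fun j => boxMin (S (i, j))) = rowM n s i := by
  rw [rowList_part h.part, h.shp]
  apply eq_rowOf
  · rw [List.pairwise_map]
    refine List.pairwise_lt_range.imp_of_mem ?_
    intro a b ha hb hab
    rw [List.mem_range] at ha hb
    have h1 := (((h.min hb).2 _).1 le_rfl)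
    exact ((h.min ha).2 _).2 (by omega)
  · intro x hx
    rw [List.mem_map] at hx
    obtain ⟨j, hj, rfl⟩ := hx
    rw [List.mem_range] at hj
    exact ((h.mem _ _ _).1 (h.min hj).1).1
  · intro x hx
    rw [count_map_nodup _ List.nodup_range _ _ (Ico (s i x) (s i (x + 1)))]
    · rw [Nat.card_Ico]; rfl
    · intro j
      rw [mem_Ico, List.mem_range]
      have h1 := h.sd.mono' i (show x + 1 ≤ n by omega)
      constructor
      · rintro ⟨h2, h3⟩
        have h4 := (h.min (show j < s i n by omega)).2
        grind
      · rintro ⟨h2, h3⟩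
        have h4 := (h.min h2).2
        grind

theorem SG.rowExt {n : ℕ} {sh : Finset Cell} {S : Cell → Finset ℕ} {s e : Dat} (h : SG n sh S s e)
    (i : ℕ) : ((rowList sh i).reverse.map (fun j => boxExtras (S (i, j)))).flatten = rowE n e i := by
  apply sdesc_ext
  · rw [List.pairwise_flatten]
    constructor
    · intro l hl
      rw [List.mem_map] at hl
      obtain ⟨j, _, rfl⟩ := hl
      exact boxExtras_desc _
    · rw [List.pairwise_map, List.pairwise_reverse]
      refine (rowList_sorted sh i).imp ?_
      intro a b hab x hx y hy
      rw [mem_boxExtras, h.ext] at hx hy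
      by_contra hc
      have := h.sd.mono' i (show x - 1 ≤ y - 1 by omega)
      omega
  · exact rowE_desc h.sd i
  · intro x
    rw [List.mem_flatten]
    have hR : x ∈ rowE n e i ↔ (1 ≤ x ∧ x ≤ n) ∧ e i x = 1 := by
      rw [rowE, List.mem_reverse]
      constructor
      · intro hx
        have h1 := rowOf_mem _ _ _ hx
        refine ⟨h1, ?_⟩
        have h2 := List.count_pos_iff.2 hx
        obtain ⟨y, rfl⟩ : ∃ y, x = y + 1 := ⟨x - 1, by omega⟩
        rw [rowOf_count, if_pos (show y < n by omega), mE] at h2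
        have := h.sd.e1 i (y + 1)
        omega
      · rintro ⟨h1, h2⟩
        obtain ⟨y, rfl⟩ : ∃ y, x = y + 1 := ⟨x - 1, by omega⟩
        apply List.count_pos_iff.1
        rw [rowOf_count, if_pos (show y < n by omega), mE]
        omega
    rw [hR]
    constructor
    · rintro ⟨l, hl, hx⟩
      rw [List.mem_map] at hl
      obtain ⟨j, _, rfl⟩ := hl
      rw [mem_boxExtras, h.ext] at hx
      omega
    · rintro ⟨h1, h2⟩
      obtain ⟨j, hj⟩ := (h.ext_ex i x h1).1 h2
      refine ⟨_, List.mem_map.2 ⟨j, ?_, rfl⟩, (mem_boxExtras _ _).2 hj⟩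
      rw [List.mem_reverse, mem_rowList, mem_rl h.part, h.shp]
      have := (h.ext i j x).1 hj
      have := h.sd.mono' i (show x - 1 ≤ n by omega)
      omega

theorem SG.rows_lt {n : ℕ} {sh : Finset Cell} {S : Cell → Finset ℕ} {s e : Dat} (h : SG n sh S s e) :
    ∀ c ∈ sh, c.1 < n := by
  rintro ⟨i, j⟩ hc
  rw [mem_rl h.part, h.shp] at hc
  by_contra h1
  rw [h.sd.row0 i (by simpa using h1)] at hc
  omega

theorem SG.word {n : ℕ} {sh : Finset Cell} {S : Cell → Finset ℕ} {s e : Dat} (h : SG n sh S s e) :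
    svtReadingWord sh S = ws n (s, e) := by
  unfold svtReadingWord
  rw [outer sh h.rows_lt]
  · unfold ws; congr; funext i; rw [h.rowMin, h.rowExt]; rfl
  · grind

theorem SG.exc {n : ℕ} {sh : Finset Cell} {S : Cell → Finset ℕ} {s e : Dat} (h : SG n sh S s e) :
    exTotal sh S = exw n e := by
  have e1 : ∑ c ∈ sh, (S c).card = ∑ c ∈ sh, (boxExtras (S c)).length + sh.card := by
    rw [card_eq_sum_ones, ← sum_add_distrib]
    exact sum_congr rfl fun c hc => (boxExtras_length _ (h.svt.1 c hc)).symm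
  have e2 : ∀ i, (rowE n e i).length = ∑ j ∈ range (rl sh i), (boxExtras (S (i, j))).length := by
    intro i
    rw [← h.rowExt i, List.length_flatten, rowList_part h.part, List.map_map, List.map_reverse,
      List.sum_reverse]
    rw [← List.sum_toFinset _ List.nodup_range, List.toFinset_range]
    rfl
  have e3 : exw n e = ∑ c ∈ sh, (boxExtras (S c)).length := by
    unfold exw
    simp only [e2]
    rw [sum_sigma']
    apply sum_bij (fun (p : (_ : ℕ) × ℕ) _ => (p.1, p.2))
    · intro p hp
      rw [mem_sigma, mem_range, mem_range] at hp
      exact (mem_rl h.part _ _).2 hp.2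
    · grind
    · rintro ⟨i, j⟩ hc
      have := h.rows_lt _ hc
      refine ⟨⟨i, j⟩, ?_, rfl⟩
      rw [mem_sigma, mem_range, mem_range]
      exact ⟨by simp only at this ⊢; omega, (mem_rl h.part _ _).1 hc⟩
    · omega
  unfold exTotal
  omega

theorem fs {α β A : Type*} [CommRing A] {p : α → Prop} (f : {a // p a} → A) (S : Finset β) (g : β → A)
    (u : α → β) (v : β → α) (hu : ∀ a (h : p a), u a ∈ S ∧ v (u a) = a ∧ f ⟨a, h⟩ = g (u a))
    (hv : ∀ b ∈ S, p (v b) ∧ u (v b) = b) : ∑ᶠ a, f a = ∑ b ∈ S, g b := by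
  let e : {a // p a} ≃ {b // b ∈ S} :=
    { toFun := fun a => ⟨u a.1, (hu a.1 a.2).1⟩
      invFun := fun b => ⟨v b.1, (hv b.1 b.2).1⟩
      left_inv := fun a => Subtype.ext (hu a.1 a.2).2.1
      right_inv := fun b => Subtype.ext (hv b.1 b.2).2 }
  rw [← finsum_mem_coe_finset, ← finsum_set_coe_eq_finsum_mem]
  refine finsum_eq_of_bijective e e.bijective ?_
  grind

def xv (n : ℕ) (R : Type) [CommRing R] : ℕ → MvPolynomial (Fin n) R :=
  fun l => if h : l < n then MvPolynomial.X ⟨l, h⟩ else 0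

theorem xv_prod {n : ℕ} {R : Type} [CommRing R] {s : Finset Cell} {L M : ℕ → ℕ} {T : Cell → ℕ} {C : Dat}
    (h : RG n s L M T C) : (∏ i : Fin n, (MvPolynomial.X i : MvPolynomial (Fin n) R) ^ wtRPP s T ((i : ℕ) + 1)) =
      xw (xv n R) n (wd n C) := by
  unfold xw
  rw [prod_range]
  apply prod_congr rfl
  intro i _
  rw [h.wt i i.2, xv, dif_pos i.2]

theorem conv {n : ℕ} {s : Finset Cell} {L M : ℕ → ℕ} {A : Type} [CommRing A]
    (hs : ∀ i j, (i, j) ∈ s ↔ M i ≤ j ∧ j < L i) (hn : ∀ i, n ≤ i → L i = 0)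
    (hL : ∀ i, L (i + 1) ≤ L i) (hM : ∀ i, M (i + 1) ≤ M i) (hML : ∀ i, M i ≤ L i)
    (f : (Cell → ℕ) → A) (g : Dat → A) (hfg : ∀ R C, RG n s L M R C → f R = g C) :
    (∑ᶠ R : {R : Cell → ℕ // IsRPPOn s R ∧ ∀ c ∈ s, R c ≤ n}, f R.1) = ∑ C ∈ RDs n L M, g C := by
  apply fs (fun R : {R : Cell → ℕ // IsRPPOn s R ∧ ∀ c ∈ s, R c ≤ n} => f R.1) (RDs n L M) g (CofR L) (RofC n L)
  · intro R h
    have h1 := RG.of_rpp hs hn hL hM hML h.1 h.2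
    exact ⟨(mem_RDs hn).2 h1.rd, (RG.of_rd hs hn h1.rd).uniqR h1, hfg _ _ h1⟩
  · intro C hC
    have h1 := RG.of_rd hs hn ((mem_RDs hn).1 hC)
    have h2 := h1.rpp
    exact ⟨h2, (RG.of_rpp hs hn hL hM hML h2.1 h2.2).uniqC h1⟩

theorem liftX_gDual {n : ℕ} {sh : Finset Cell} (hp : IsPartitionShape sh) (hr : AtMostRows sh n) :
    liftX n (gDual n sh) = ∑ D ∈ RDs n (rl sh) (fun _ => 0), xw (xv n (MvPolynomial (Fin n) ℤ)) n (wd n D) := by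
  have e : gDual n sh = ∑ D ∈ RDs n (rl sh) (fun _ => 0), xw (xv n ℤ) n (wd n D) := by
    unfold gDual
    refine conv (fun i j => ?_) (rl_zero hp hr) (rl_anti hp) (fun _ => le_refl _) (fun _ => Nat.zero_le _)
      (fun R => ∏ i : Fin n, (MvPolynomial.X i : XPoly n) ^ wtRPP sh R ((i : ℕ) + 1)) _ (fun R C h => xv_prod h)
    rw [mem_rl hp]; simp
  rw [e, liftX, map_sum]
  apply sum_congr rfl
  intro D _
  unfold xw
  rw [map_prod]
  apply prod_congr rfl
  intro l hl
  have hl' := mem_range.1 hl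
  rw [map_pow, xv, xv, dif_pos hl', dif_pos hl', MvPolynomial.map_X]

def Qof (n : ℕ) (B : BurgeData) (C : Dat) : Dat :=
  CofR (rl (B.out (hts n C) (wd n C)).sh) (B.out (hts n C) (wd n C)).Q

theorem Qof_spec {n : ℕ} (B : BurgeData) {L M : ℕ → ℕ} {C : Dat} (h : RD n L M C) (hn : ∀ i, n ≤ i → L i = 0)
    (hy : ∀ v, opn (v + 1) (wd n C) = 0) :
    TD n (Qof n B C) ∧ (fun i => Qof n B C i n) = cont (wd n C) ∧
    readingWordOn (B.out (hts n C) (wd n C)).sh (B.out (hts n C) (wd n C)).Q = wd n (Qof n B C) ∧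
    RG n (B.out (hts n C) (wd n C)).sh (rl (B.out (hts n C) (wd n C)).sh) (fun _ => 0)
      (B.out (hts n C) (wd n C)).P (Hd (rl (B.out (hts n C) (wd n C)).sh)) := by
  have hb := hts_biword n C
  have hp := B.shape_part _ _ hb
  have hP := ssyt_rg (n := n) hp (B.ssytP _ _ hb) (fun c hc => (wd_mem (mem_of_wt (B.contentP _ _ hb) hc)).2)
  have hQ := ssyt_rg (n := n) hp (B.ssytQ _ _ hb) (fun c hc => (hts_mem n h hn _ (mem_of_wt (B.contentQ _ _ hb) hc)).2)
  have hk := B.knuthP _ _ hb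
  rw [hP.2.2.2] at hk
  have hw : ∀ a ∈ wd n C, 1 ≤ a ∧ a ≤ n := fun a ha => wd_mem ha
  have h3 := (equiv_highest_iff (hasRect B n) (cont (wd n C)) (cont_anti hy) (cont_big hw) (wd n C) hw).2
    ⟨hy, fun v => rfl⟩
  obtain ⟨h4, h5⟩ := Hd_TD n (cont (wd n C)) (cont_anti hy) (cont_big hw)
  have h6 := TD.uniq _ _ _ hP.2.1 h4 rfl (knuth_trans hk h3)
  have h7 : rl (B.out (hts n C) (wd n C)).sh = cont (wd n C) := by
    funext i
    simp_all
  refine ⟨hQ.2.1, ?_, hQ.2.2.2, ?_⟩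
  · rw [← h7]; funext i; exact hQ.2.2.1 i
  · grind

theorem ssyt_supp {s s' : Finset Cell} {T : Cell → ℕ} (h : IsSSYTOn s T) (h' : IsSSYTOn s' T) : s = s' := by
  ext c
  have h1 := h.1 c
  have h2 := h.2.1 c
  have h3 := h'.1 c
  have h4 := h'.2.1 c
  grind

theorem Q_inj {n : ℕ} (B : BurgeData) {L M : ℕ → ℕ} {C C' : Dat} (h : RD n L M C) (h' : RD n L M C')
    (hn : ∀ i, n ≤ i → L i = 0)
    (hy : ∀ v, opn (v + 1) (wd n C) = 0) (hy' : ∀ v, opn (v + 1) (wd n C') = 0)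
    (e : (B.out (hts n C) (wd n C)).Q = (B.out (hts n C') (wd n C')).Q) : C = C' := by
  have hb := hts_biword n C
  have hb' := hts_biword n C'
  obtain ⟨_, _, _, h1⟩ := Qof_spec B h hn hy
  obtain ⟨_, _, _, h1'⟩ := Qof_spec B h' hn hy'
  have q1 := B.ssytQ _ _ hb
  have q2 := B.ssytQ _ _ hb'
  rw [e] at q1
  have hsh := ssyt_supp q1 q2
  have : B.out (hts n C) (wd n C) = B.out (hts n C') (wd n C') := by
    generalize B.out (hts n C) (wd n C) = o at *
    generalize B.out (hts n C') (wd n C') = o' at *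
    obtain ⟨a, b, c⟩ := o
    obtain ⟨a', b', c'⟩ := o'
    simp only at hsh e h1 h1'
    subst hsh
    subst e
    rw [h1.uniqR h1']
  obtain ⟨e1, e2⟩ := B.inj _ _ _ _ hb hb' this
  exact h.eq_of_hts h' hn e1 e2

theorem compat_iff {n : ℕ} (B : BurgeData) {s : Finset Cell} {L M : ℕ → ℕ}
    (hs : ∀ i j, (i, j) ∈ s ↔ M i ≤ j ∧ j < L i) (hn : ∀ i, n ≤ i → L i = 0)
    (hL : ∀ i, L (i + 1) ≤ L i) (hM : ∀ i, M (i + 1) ≤ M i) (hML : ∀ i, M i ≤ L i)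
    (q : BurgeOut) (T : Cell → ℕ) : IsCompatibleRPP n B s (fun _ => n) q T ↔
      RG n s L M T (CofR L T) ∧ (∀ v, opn (v + 1) (wd n (CofR L T)) = 0) ∧
      B.out (hts n (CofR L T)) (wd n (CofR L T)) = q := by
  have key : ∀ T, RG n s L M T (CofR L T) → rppHeights s T = hts n (CofR L T) := fun T h => h.heights
  constructor
  · rintro ⟨⟨h1, h2, h3, h4⟩, _⟩
    have hg := RG.of_rpp hs hn hL hM hML h1 h2
    rw [hg.word, key T hg] at h4
    rw [hg.word, yam_iff] at h3
    grind
  · rintro ⟨hg, h3, h4⟩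
    refine ⟨⟨hg.rpp.1, hg.rpp.2, ?_, ?_⟩, ?_⟩
    · rw [hg.word, yam_iff]; exact h3
    · rw [hg.word, key T hg]; exact h4
    · rintro T' ⟨k1, k2, k3, k4⟩
      have kg := RG.of_rpp hs hn hL hM hML k1 k2
      rw [kg.word, key T' kg] at k4
      rw [kg.word, yam_iff] at k3
      rw [← h4] at k4
      have := Q_inj B kg.rd hg.rd hn k3 h3 k4
      rw [this] at kg
      exact kg.uniqR hg

theorem main_thm (n : ℕ) (B : BurgeData)
    (lam mu : Finset Cell)
    (hlam : IsPartitionShape lam) (hmu : IsPartitionShape mu)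
    (hsub : mu ⊆ lam) (hlamn : AtMostRows lam n) (s : Finset Cell)
    (hss : ∀ c, c ∈ s ↔ c ∈ lam ∧ c ∉ mu) :
    gFlagged n s (fun _ => n) =
      ∑ᶠ x : {y : (BurgeOut × (Cell → ℕ)) × (Finset Cell × (Cell → Finset ℕ)) //
               IsCompatibleRPP n B s (fun _ => n) y.1.1 y.1.2 ∧
               IsPartitionShape y.2.1 ∧ IsSVTOn n y.2.1 y.2.2 ∧
               KnuthEquiv (svtReadingWord y.2.1 y.2.2)
                 (readingWordOn y.1.1.sh y.1.1.Q)},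
        ((-1 : XTPoly n) ^ exTotal x.1.2.1 x.1.2.2) *
          tMono n (ceqOn s x.1.1.2) * liftX n (gDual n x.1.2.1) := by
  have hs : ∀ i j, (i, j) ∈ s ↔ rl mu i ≤ j ∧ j < rl lam i := by
    intro i j
    rw [hss, mem_rl hlam, mem_rl hmu]; omega
  have hn := rl_zero hlam hlamn
  have hL := rl_anti hlam
  have hM := rl_anti hmu
  have hML : ∀ i, rl mu i ≤ rl lam i := by
    intro i
    by_contra hc
    have := (mem_rl hlam i (rl lam i)).1 (hsub ((mem_rl hmu i (rl lam i)).2 (by omega)))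
    omega
  generalize rl lam = L at *
  generalize rl mu = M at *
  let τ : (ℕ → ℕ) → XTPoly n := fun t => tMono n (fun i => L i - M i - t i)
  have hτ : ∀ R C, RG n s L M R C → tMono n (ceqOn s R) = τ (fun i => (rowW n C i).length) := by
    intro R C h
    have : ceqOn s R = fun i => L i - M i - (rowW n C i).length := funext h.ceq
    rw [this]
  have hlhs : gFlagged n s (fun _ => n) = ∑ C ∈ RDs n L M, τ (fun i => (rowW n C i).length) *
      xw (xv n (MvPolynomial (Fin n) ℤ)) n (wd n C) := by
    unfold gFlagged
    refine conv hs hn hL hM hML (fun R => tMono n (ceqOn s R) *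
      ∏ i : Fin n, (MvPolynomial.X i : XTPoly n) ^ wtRPP s R ((i : ℕ) + 1)) _ (fun R C h => ?_)
    rw [hτ R C h, xv_prod h]
  rw [hlhs, abstract_main (hasRect B n) (xv n (MvPolynomial (Fin n) ℤ)) L M hn τ (Qof n B)
    (fun C hC hy => by
      have := Qof_spec B ((mem_RDs hn).1 hC) hn hy
      grind), sum_sigma']
  symm
  refine fs (p := fun y : (BurgeOut × (Cell → ℕ)) × (Finset Cell × (Cell → Finset ℕ)) =>
               IsCompatibleRPP n B s (fun _ => n) y.1.1 y.1.2 ∧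
               IsPartitionShape y.2.1 ∧ IsSVTOn n y.2.1 y.2.2 ∧
               KnuthEquiv (svtReadingWord y.2.1 y.2.2)
                 (readingWordOn y.1.1.sh y.1.1.Q))
    (fun x => ((-1 : XTPoly n) ^ exTotal x.1.2.1 x.1.2.2) *
          tMono n (ceqOn s x.1.1.2) * liftX n (gDual n x.1.2.1)) _ _
    (fun y => (⟨CofR L y.1.2, (sOf y.2.1 y.2.2, eOf n y.2.2)⟩ : (_ : Dat) × (Dat × Dat)))
    (fun z => ((B.out (hts n z.1) (wd n z.1), RofC n L z.1),
      (shOf n (fun i => z.2.1 i n), SofD n z.2.1 z.2.2))) ?_ ?_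
  · rintro ⟨⟨q, T⟩, ⟨sh, S⟩⟩ ⟨h1, h2, h3, h4⟩
    simp only at h1 h2 h3 h4 ⊢
    rw [compat_iff B hs hn hL hM hML] at h1
    obtain ⟨hg, hy, ho⟩ := h1
    have hS := SG.of_svt h2 h3
    have hq := Qof_spec B hg.rd hn hy
    rw [hS.word, ← ho, hq.2.2.1] at h4
    have hlen : (ws n (sOf sh S, eOf n S)).length = (wd n (CofR L T)).length := by
      rw [(knuth_perm h4).length_eq, hq.1.total]
      have hw : ∀ a ∈ wd n (CofR L T), 1 ≤ a ∧ a ≤ n := fun a ha => wd_mem ha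
      rw [← cont_sum hw, ← hq.2.1, sum_range_succ]
      have := congrFun hq.2.1 n
      rw [this, cont_big hw n le_rfl, add_zero]
    have e1 := (RG.of_rd hs hn hg.rd).uniqR hg
    have e2 := (SG.of_sd hS.sd).uniqS hS
    refine ⟨?_, ?_, ?_⟩
    · rw [mem_sigma, mem_filter, mem_filter, mem_RDs hn, mem_SDs]
      exact ⟨⟨hg.rd, hy⟩, ⟨hS.sd, hlen⟩, h4⟩
    · grind
    · have hr : rl sh = fun i => sOf sh S i n := funext hS.shp
      rw [hτ T _ hg, hS.exc, liftX_gDual h2 hS.rows_lt, hr]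
      ring
  · rintro ⟨C, ⟨a, e⟩⟩ hz
    rw [mem_sigma, mem_filter, mem_filter, mem_RDs hn, mem_SDs] at hz
    obtain ⟨⟨hC, hy⟩, ⟨hsd, hlen⟩, hk⟩ := hz
    simp only at hC hy hsd hlen hk ⊢
    have hg := RG.of_rd hs hn hC
    have hS := SG.of_sd hsd
    have hq := Qof_spec B hC hn hy
    have hg' := RG.of_rpp hs hn hL hM hML hg.rpp.1 hg.rpp.2
    have e1 := hg'.uniqC hg
    have e2 := (SG.of_svt hS.part hS.svt).uniqD hS
    refine ⟨⟨?_, hS.part, hS.svt, ?_⟩, ?_⟩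
    · rw [compat_iff B hs hn hL hM hML, e1]
      grind
    · rw [hS.word, hq.2.2.1]; exact hk
    · grind


end Helpers

/-- Expansion of the refined dual stable Grothendieck polynomial in
terms of dual stable Grothendieck polynomials:
`g̃_{λ/μ}(x; t) = Σ_{S ∈ 𝕊(λ/μ)} (-1)^{|ex(S)|} wt_{λ/μ}(S) · g_{sh(S)}(x)`, where
`𝕊(λ/μ)` is the set of semistandard set-valued tableaux of partition shape whose
reading word is Knuth equivalent to an element `Q` of `𝕋(λ/μ)`, and
`wt_{λ/μ}(S) = t^{ceq(rect(w(S)))}`. -/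
theorem gtilde_gdual_expansion
    (n : ℕ) (B : BurgeData)
    (lam mu : Finset Cell)
    (hlam : IsPartitionShape lam) (hmu : IsPartitionShape mu)
    (hsub : mu ⊆ lam) (hlamn : AtMostRows lam n) (hmun : AtMostRows mu n) :
    gFlagged n (lam \ mu) (fun _ => n) =
      ∑ᶠ x : {y : (BurgeOut × (Cell → ℕ)) × (Finset Cell × (Cell → Finset ℕ)) //
               IsCompatibleRPP n B (lam \ mu) (fun _ => n) y.1.1 y.1.2 ∧
               IsPartitionShape y.2.1 ∧ IsSVTOn n y.2.1 y.2.2 ∧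
               KnuthEquiv (svtReadingWord y.2.1 y.2.2)
                 (readingWordOn y.1.1.sh y.1.1.Q)},
        ((-1 : XTPoly n) ^ exTotal x.1.2.1 x.1.2.2) *
          tMono n (ceqOn (lam \ mu) x.1.1.2) * liftX n (gDual n x.1.2.1) := by
  exact main_thm n B lam mu hlam hmu hsub hlamn (lam \ mu) (fun c => Finset.mem_sdiff)

end SkewG
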